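/- arXiv:2402.04348 — 3 statements merged into one kernel-verified Lean document; each statement's English description precedes it below -/
import Mathlib

section
/- For every δ > 0 there exists a constant c > 0, depending only on δ, such that for every real n > 0, every 1 ≤ p ≤ ∞, and every weighted polynomial P ∈ Π_n, one has ‖P‖_{p, ℝ \ [−√(2n)(1+δ), √(2n)(1+δ)]} ≤ exp(−c n) · ‖P‖_{p, [−√(2n)(1+δ), √(2n)(1+δ)]}. -/
open MeasureTheory Filter ENNReal ProbabilityTheory

noncomputable def psiH (k : ℕ) (x : ℝ) : ℝ :=
  (Real.sqrt Real.pi * 2 ^ k * (Nat.factorial k : ℝ)) ^ (-(1 : ℝ) / 2) * (-1 : ℝ) ^ k *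
    Real.exp (x ^ 2 / 2) * iteratedDeriv k (fun t : ℝ => Real.exp (-t ^ 2)) x

noncomputable def PiH (n : ℕ) : Submodule ℝ (ℝ → ℝ) :=
  Submodule.span ℝ {f : ℝ → ℝ | ∃ k, k < n ∧ f = psiH k}

noncomputable def degApproxH (p : ℝ≥0∞) (n : ℕ) (f : ℝ → ℝ) : ℝ≥0∞ :=
  ⨅ (P : ℝ → ℝ) (_ : P ∈ PiH n), eLpNorm (fun x => f x - P x) p volume

noncomputable def fourierT (f : ℝ → ℝ) (ω : ℝ) : ℂ :=
  (Real.sqrt (2 * Real.pi) : ℂ)⁻¹ * ∫ t : ℝ, (f t : ℂ) * Complex.exp (-(Complex.I * ω * t))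

def SMZ (m : ℕ) (c₁ c₂ c₃ c₄ : ℝ) (ν : Measure ℝ) : Prop :=
  (∀ P ∈ PiH m,
      ENNReal.ofReal c₁ * (∫⁻ t : ℝ, ENNReal.ofReal (P t ^ 2)) ≤ (∫⁻ t, ENNReal.ofReal (P t ^ 2) ∂ν) ∧
      (∫⁻ t, ENNReal.ofReal (P t ^ 2) ∂ν) ≤ ENNReal.ofReal c₂ * (∫⁻ t : ℝ, ENNReal.ofReal (P t ^ 2))) ∧
  ENNReal.ofReal (c₃ * Real.sqrt m) ≤ ν Set.univ ∧ ν Set.univ ≤ ENNReal.ofReal (c₄ * Real.sqrt m)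


lemma iterGauss (k : ℕ) : ∃ q : Polynomial ℝ, q ∈ Polynomial.degreeLT ℝ (k+1) ∧
    iteratedDeriv k (fun t : ℝ => Real.exp (-t ^ 2)) = fun x => q.eval x * Real.exp (-x^2) := by
  induction k with
  | zero =>
    refine ⟨1, ?_, ?_⟩
    · rw [Polynomial.mem_degreeLT]; simp
    · funext x; simp
  | succ k ih =>
    obtain ⟨q, hq, h⟩ := ih
    refine ⟨Polynomial.derivative q - Polynomial.C 2 * Polynomial.X * q, ?_, ?_⟩
    · rw [Polynomial.degreeLT_succ_eq_degreeLE] at *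
      rw [Polynomial.mem_degreeLE] at *
      refine (Polynomial.degree_sub_le _ _).trans (max_le ?_ ?_)
      · refine (Polynomial.degree_derivative_le).trans (hq.trans ?_)
        exact_mod_cast Nat.le_succ k
      · refine (Polynomial.degree_mul_le _ _).trans ?_
        have h1 : (Polynomial.C (2:ℝ) * Polynomial.X).degree ≤ 1 := by
          exact Polynomial.degree_C_mul_X_le (2:ℝ)
        calc _ ≤ (1 : WithBot ℕ) + k := add_le_add h1 hq
          _ = ((k+1 : ℕ) : WithBot ℕ) := by push_cast; rw [add_comm]
    · rw [iteratedDeriv_succ, h]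
      funext x
      have h1 : HasDerivAt (fun x : ℝ => -x^2) (-(2*x)) x := by
        have := (hasDerivAt_pow 2 x).fun_neg
        simpa using this
      have h2 := (q.hasDerivAt x).mul h1.exp
      refine h2.deriv.trans ?_
      simp; ring

lemma PiH_poly (m : ℕ) (P : ℝ → ℝ) (hP : P ∈ PiH m) : ∃ q : Polynomial ℝ,
    q ∈ Polynomial.degreeLT ℝ m ∧ P = fun x => q.eval x * Real.exp (-x^2/2) := by
  unfold PiH at hP
  induction hP using Submodule.span_induction with
  | mem x hx =>
    obtain ⟨k, hk, rfl⟩ := hx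
    obtain ⟨q, hq, h⟩ := iterGauss k
    refine ⟨Polynomial.C ((Real.sqrt Real.pi * 2 ^ k * (Nat.factorial k : ℝ)) ^ (-(1 : ℝ) / 2) * (-1 : ℝ) ^ k) * q, ?_, ?_⟩
    · rw [← Polynomial.smul_eq_C_mul]
      exact Submodule.smul_mem _ _ (Polynomial.degreeLT_mono (by omega) hq)
    · funext x
      unfold psiH
      rw [h]
      have : Real.exp (-x^2/2) = Real.exp (x^2/2) * Real.exp (-x^2) := by
        rw [← Real.exp_add]; ring_nf
      simp only [Polynomial.eval_mul, Polynomial.eval_C, this]; ring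
  | zero => exact ⟨0, Submodule.zero_mem _, by funext x; simp⟩
  | add x y _ _ hx hy =>
    obtain ⟨q, hq, rfl⟩ := hx
    obtain ⟨r, hr, rfl⟩ := hy
    exact ⟨q + r, Submodule.add_mem _ hq hr, by funext x; simp [add_mul]⟩
  | smul c x _ hx =>
    obtain ⟨q, hq, rfl⟩ := hx
    exact ⟨c • q, Submodule.smul_mem _ _ hq, by funext x; simp [mul_assoc]⟩

/-- inverse Joukowski -/
lemma jouk (a : ℝ) (ha : 0 < a) (r : ℂ) : ∃ ω : ℂ, ω ≠ 0 ∧ ‖ω‖ ≤ 1 ∧ r = a * (ω + ω⁻¹) / 2 := by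
  obtain ⟨s, hs⟩ := IsAlgClosed.exists_pow_nat_eq (r^2 - a^2) (n := 2) (by norm_num)
  have ha' : (a:ℂ) ≠ 0 := by exact_mod_cast ha.ne'
  have key : ((r + s)/a) * ((r-s)/a) = 1 := by
    field_simp; linear_combination -hs
  have h0 : (r+s)/a ≠ 0 := left_ne_zero_of_mul_eq_one key
  have h1 : (r-s)/a ≠ 0 := right_ne_zero_of_mul_eq_one key
  have i0 : ((r+s)/a)⁻¹ = (r-s)/a := inv_eq_of_mul_eq_one_right key
  have i1 : ((r-s)/a)⁻¹ = (r+s)/a := inv_eq_of_mul_eq_one_left key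
  rcases le_total ‖(r+s)/a‖ 1 with h | h
  · exact ⟨_, h0, h, by rw [i0]; field_simp; ring⟩
  · refine ⟨_, h1, ?_, by rw [i1]; field_simp; ring⟩
    have := congrArg norm key
    rw [norm_mul, norm_one] at this
    by_contra hc
    push Not at hc
    nlinarith

lemma cpow_diff (ω : ℂ) (hω : ‖ω‖ ≤ 1) (p : ℝ) :
    DifferentiableOn ℂ (fun w => (1 - ω * w) ^ (p:ℂ)) (Metric.ball 0 1) := by
  intro w hw
  apply DifferentiableAt.differentiableWithinAt
  have hw : ‖w‖ < 1 := by simpa using hw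
  have : ‖ω * w‖ < 1 := by
    rw [norm_mul]; nlinarith [norm_nonneg w, norm_nonneg ω]
  refine DifferentiableAt.cpow (by fun_prop) (by fun_prop) ?_
  left
  have := (Complex.abs_re_le_norm (ω*w))
  have := (abs_le.1 this).2
  simp only [Complex.sub_re, Complex.one_re]; linarith

lemma cpow_cont (p : ℝ) (hp : 0 < p) (ω : ℂ) (hω : ‖ω‖ ≤ 1) :
    ContinuousOn (fun w => (1 - ω * w) ^ (p:ℂ)) (Metric.closedBall 0 1) := by
  intro w hw
  apply ContinuousAt.continuousWithinAt
  have hw : ‖w‖ ≤ 1 := by simpa using hw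
  have h1 : ‖ω * w‖ ≤ 1 := by
    rw [norm_mul]; nlinarith [norm_nonneg w, norm_nonneg ω]
  by_cases h : 1 - ω * w = 0
  · have hc : ContinuousAt (fun x : ℂ => x ^ (p:ℂ)) (1 - ω * w) := by
      rw [h]
      exact Complex.continuousAt_cpow_zero_of_re_pos (z := (p:ℂ)) (by simpa using hp) |>.comp
        (f := fun x : ℂ => (x, (p:ℂ))) (by fun_prop)
    exact hc.comp (f := fun w => 1 - ω * w) (by fun_prop)
  · refine ContinuousAt.cpow (by fun_prop) (by fun_prop) ?_
    have h2 := (Complex.abs_re_le_norm (ω*w))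
    have h3 := (abs_le.1 h2).2
    rw [Complex.mem_slitPlane_iff]
    by_cases hr : 0 < (1 - ω*w).re
    · left; exact hr
    · exfalso
      simp only [Complex.sub_re, Complex.one_re, not_lt] at hr
      have h4 : (ω*w).re = 1 := by linarith
      have h5 : (ω*w).im = 0 := by
        have := Complex.sq_norm (ω*w)
        rw [Complex.normSq_apply, h4] at this
        have : (ω*w).im*(ω*w).im ≤ 0 := by nlinarith [norm_nonneg (ω*w)]
        nlinarith
      apply h
      apply Complex.ext
      · rw [Complex.sub_re, h4]; simp
      · rw [Complex.sub_im, h5]; simp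

structure GoodF (a p : ℝ) (D : ℕ) (P : Polynomial ℂ) (f : ℂ → ℂ) : Prop where
  diff : DifferentiableOn ℂ f (Metric.ball 0 1)
  cont : ContinuousOn f (Metric.closedBall 0 1)
  real : ∀ t : ℝ, |t| < 1 → f t = ((‖f t‖ : ℝ) : ℂ)
  bound : ∀ t : ℝ, t ≠ 0 → |t| < 1 → (‖P.eval ((a * (t + t⁻¹) / 2 : ℝ) : ℂ)‖ * |t| ^ D) ^ p ≤ ‖f t‖
  circ : ∀ θ : ℝ, ‖P.eval ((a * Real.cos θ : ℝ) : ℂ)‖ ^ p = ‖f (Complex.exp (θ * Complex.I))‖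

lemma GoodF.const (a p : ℝ) (c : ℂ) : GoodF a p 0 (Polynomial.C c) (fun _ => ((‖c‖ ^ p : ℝ) : ℂ)) where
  diff := by fun_prop
  cont := by fun_prop
  real t _ := by
    have : (0:ℝ) ≤ ‖c‖^p := by positivity
    rw [Complex.norm_real, Real.norm_of_nonneg this]
  bound t _ _ := by
    have : (0:ℝ) ≤ ‖c‖^p := by positivity
    rw [Complex.norm_real, Real.norm_of_nonneg this]; simp
  circ θ := by
    have : (0:ℝ) ≤ ‖c‖^p := by positivity
    rw [Complex.norm_real, Real.norm_of_nonneg this]; simp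

lemma GoodF.mul {a p : ℝ} {D E : ℕ} {P Q : Polynomial ℂ} {f g : ℂ → ℂ} (hf : GoodF a p D P f)
    (hg : GoodF a p E Q g) : GoodF a p (D + E) (P * Q) (fun w => f w * g w) where
  diff := hf.diff.mul hg.diff
  cont := hf.cont.mul hg.cont
  real t ht := by
    rw [norm_mul, Complex.ofReal_mul, ← hf.real t ht, ← hg.real t ht]
  bound t h0 ht := by
    rw [norm_mul]
    refine le_trans (le_of_eq ?_) (mul_le_mul (hf.bound t h0 ht) (hg.bound t h0 ht) (by positivity) (by positivity))
    rw [← Real.mul_rpow (by positivity) (by positivity), Polynomial.eval_mul, norm_mul, pow_add]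
    ring_nf
  circ θ := by
    rw [norm_mul, ← hf.circ, ← hg.circ, Polynomial.eval_mul, norm_mul, Real.mul_rpow (by positivity) (by positivity)]

lemma jnorm (a : ℝ) (ha : 0 < a) (ω w : ℂ) (h0 : ω ≠ 0) (hw : w ≠ 0) :
    ‖(a:ℂ) * (w + w⁻¹) / 2 - a * (ω + ω⁻¹) / 2‖ * ‖w‖ = a / (2 * ‖ω‖) * (‖w - ω‖ * ‖1 - ω * w‖) := by
  have : (a:ℂ) * (w + w⁻¹) / 2 - a * (ω + ω⁻¹) / 2 = - (a * (w - ω) * (1 - ω * w) / (2 * ω * w)) := by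
    field_simp; ring
  rw [this]
  simp only [norm_neg, norm_div, norm_mul, Complex.norm_real, Real.norm_of_nonneg ha.le, Complex.norm_ofNat]
  have h1 : ‖ω‖ ≠ 0 := by simpa
  have h2 : ‖w‖ ≠ 0 := by simpa
  field_simp

lemma jsq (ω w : ℂ) : ‖1 - (starRingEnd ℂ) ω * w‖ ^ 2 - ‖w - ω‖ ^ 2 = (1 - ‖w‖ ^ 2) * (1 - ‖ω‖ ^ 2) := by
  simp only [Complex.sq_norm, Complex.normSq_apply]
  simp; ring

lemma GoodF.linear (a p : ℝ) (ha : 0 < a) (hp : 0 < p) (r : ℂ) :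
    ∃ f, GoodF a p 1 (Polynomial.X - Polynomial.C r) f := by
  obtain ⟨ω, h0, h1, rfl⟩ := jouk a ha r
  have hωp : 0 < ‖ω‖ := by simpa
  have hc : 0 < a / (2 * ‖ω‖) := by positivity
  have h1' : ‖(starRingEnd ℂ) ω‖ ≤ 1 := by simpa using h1
  set c := a / (2 * ‖ω‖) with hcdef
  have hnorm : ∀ w : ℂ, ‖((c ^ p : ℝ) : ℂ) * ((1 - ω * w) ^ (p:ℂ) * (1 - (starRingEnd ℂ) ω * w) ^ (p:ℂ))‖
      = (c * (‖1 - (starRingEnd ℂ) ω * w‖ * ‖1 - ω * w‖)) ^ p := by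
    intro w
    rw [norm_mul, norm_mul, Complex.norm_cpow_real, Complex.norm_cpow_real, Complex.norm_real,
      Real.norm_of_nonneg (by positivity), ← Real.mul_rpow (by positivity) (by positivity),
      ← Real.mul_rpow (by positivity) (by positivity)]
    ring_nf
  refine ⟨fun w => ((c ^ p : ℝ) : ℂ) * ((1 - ω * w) ^ (p:ℂ) * (1 - (starRingEnd ℂ) ω * w) ^ (p:ℂ)),
    ?_, ?_, ?_, ?_, ?_⟩
  · exact (differentiableOn_const _).mul ((cpow_diff ω h1 p).mul (cpow_diff _ h1' p))
  · exact continuousOn_const.mul ((cpow_cont p hp ω h1).mul (cpow_cont p hp _ h1'))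
  · intro t ht
    have harg : (1 - ω * (t:ℂ)).arg ≠ Real.pi := by
      have hre : 0 < (1 - ω * (t:ℂ)).re := by
        have h3 : ‖ω * (t:ℂ)‖ < 1 := by
          rw [norm_mul, Complex.norm_real, Real.norm_eq_abs]; nlinarith [abs_nonneg t, norm_nonneg ω]
        have := (abs_le.1 (Complex.abs_re_le_norm (ω*(t:ℂ)))).2
        simp only [Complex.sub_re, Complex.one_re]; linarith
      intro h
      rw [Complex.arg_eq_pi_iff] at h
      linarith [h.1]
    have hconj : (1 - (starRingEnd ℂ) ω * (t:ℂ)) ^ (p:ℂ) = (starRingEnd ℂ) ((1 - ω * (t:ℂ)) ^ (p:ℂ)) := by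
      have := Complex.cpow_conj (1 - ω * (t:ℂ)) (p:ℂ) harg
      have h2 := Complex.conj_cpow (1 - ω * (t:ℂ)) (p:ℂ) harg
      simp only [map_sub, map_one, map_mul, Complex.conj_ofReal] at h2
      exact h2
    simp only [hconj, Complex.mul_conj]
    rw [← Complex.ofReal_mul, Complex.norm_real, Real.norm_of_nonneg]
    have := Complex.normSq_nonneg ((1 - ω * (t:ℂ)) ^ (p:ℂ))
    positivity
  · intro t ht0 ht
    rw [hnorm]
    refine Real.rpow_le_rpow (by positivity) ?_ hp.le
    have htc : (t:ℂ) ≠ 0 := by exact_mod_cast ht0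
    have := jnorm a ha ω t h0 htc
    rw [Complex.norm_real, Real.norm_eq_abs] at this
    simp only [Polynomial.eval_sub, Polynomial.eval_X, Polynomial.eval_C, pow_one]
    push_cast
    rw [this, ← hcdef]
    have h5 := jsq ω t
    rw [Complex.norm_real, Real.norm_eq_abs] at h5
    have h6 : ‖(t:ℂ) - ω‖ ≤ ‖1 - (starRingEnd ℂ) ω * (t:ℂ)‖ := by
      refine le_of_sq_le_sq ?_ (norm_nonneg _)
      have : 0 ≤ (1 - |t|^2) * (1 - ‖ω‖^2) :=
        mul_nonneg (by nlinarith [abs_nonneg t]) (by nlinarith)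
      linarith
    gcongr
  · intro θ
    rw [hnorm]
    congr 1
    set w := Complex.exp (θ * Complex.I) with hw
    have hw0 : w ≠ 0 := Complex.exp_ne_zero _
    have hw1 : ‖w‖ = 1 := Complex.norm_exp_ofReal_mul_I θ
    have := jnorm a ha ω w h0 hw0
    have h5 := jsq ω w
    rw [hw1] at this h5
    have h6 : ‖w - ω‖ = ‖1 - (starRingEnd ℂ) ω * w‖ := by
      have : ‖w - ω‖^2 = ‖1 - (starRingEnd ℂ) ω * w‖^2 := by linarith
      exact (sq_eq_sq₀ (norm_nonneg _) (norm_nonneg _)).1 this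
    rw [h6, mul_one, ← hcdef] at this
    rw [← this]
    simp only [Polynomial.eval_sub, Polynomial.eval_X, Polynomial.eval_C]
    congr 2
    push_cast
    rw [Complex.cos, hw, ← Complex.exp_neg]
    ring_nf

lemma GoodF.exists (a p : ℝ) (ha : 0 < a) (hp : 0 < p) (P : Polynomial ℂ) :
    ∃ f, GoodF a p P.natDegree P f := by
  have hs := IsAlgClosed.splits P
  have h1 : ∀ s : Multiset ℂ, ∃ f, GoodF a p (Multiset.card s) ((s.map (fun r => Polynomial.X - Polynomial.C r)).prod) f := by
    intro s
    induction s using Multiset.induction with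
    | empty =>
      have := GoodF.const a p 1
      exact ⟨_, by simpa using this⟩
    | cons r s ih =>
      obtain ⟨f, hf⟩ := ih
      obtain ⟨g, hg⟩ := GoodF.linear a p ha hp r
      refine ⟨fun w => g w * f w, ?_⟩
      rw [Multiset.map_cons, Multiset.prod_cons, Multiset.card_cons, add_comm]
      exact hg.mul hf
  obtain ⟨f, hf⟩ := h1 P.roots
  have h2 := (GoodF.const a p P.leadingCoeff).mul hf
  rw [← hs.eq_prod_roots, ← hs.natDegree_eq_card_roots, zero_add] at h2
  exact ⟨_, h2⟩

lemma Gpos0 (x : ℝ) (h0 : 0 ≤ x) (h1 : x ≤ 1/4) : 0 ≤ (1/25)*x^0 + (13/25)*x^1 + (88/25)*x^2 + (-116/5)*x^3 + (-53/100)*x^4 + (981/10)*x^5 + (-583/25)*x^6 + (-626/5)*x^7 + (752/25)*x^8 + (1008/25)*x^9 := by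
  have key : (1/25)*x^0 + (13/25)*x^1 + (88/25)*x^2 + (-116/5)*x^3 + (-53/100)*x^4 + (981/10)*x^5 + (-583/25)*x^6 + (-626/5)*x^7 + (752/25)*x^8 + (1008/25)*x^9 = (262144/25)*((x-0)^0*(1/4-x)^9) + (3211264/25)*((x-0)^1*(1/4-x)^8) + (3538944/5)*((x-0)^2*(1/4-x)^7) + (53592064/25)*((x-0)^3*(1/4-x)^6) + (96750336/25)*((x-0)^4*(1/4-x)^5) + (108055424/25)*((x-0)^5*(1/4-x)^4) + (75017792/25)*((x-0)^6*(1/4-x)^3) + (31404064/25)*((x-0)^7*(1/4-x)^2) + (7247936/25)*((x-0)^8*(1/4-x)^1) + (142224/5)*((x-0)^9*(1/4-x)^0) := by ring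
  rw [key]
  have hu : 0 ≤ x - 0 := by linarith
  have hv : 0 ≤ 1/4 - x := by linarith
  generalize x - 0 = u at *
  generalize 1/4 - x = v at *
  positivity

lemma Gpos1 (x : ℝ) (h0 : 1/4 ≤ x) (h1 : x ≤ 1/2) : 0 ≤ (1/25)*x^0 + (13/25)*x^1 + (88/25)*x^2 + (-116/5)*x^3 + (-53/100)*x^4 + (981/10)*x^5 + (-583/25)*x^6 + (-626/5)*x^7 + (752/25)*x^8 + (1008/25)*x^9 := by
  have key : (1/25)*x^0 + (13/25)*x^1 + (88/25)*x^2 + (-116/5)*x^3 + (-53/100)*x^4 + (981/10)*x^5 + (-583/25)*x^6 + (-626/5)*x^7 + (752/25)*x^8 + (1008/25)*x^9 = (142224/5)*((x-1/4)^0*(1/2-x)^9) + (5552224/25)*((x-1/4)^1*(1/2-x)^8) + (17838368/25)*((x-1/4)^2*(1/2-x)^7) + (30742912/25)*((x-1/4)^3*(1/2-x)^6) + (32325888/25)*((x-1/4)^4*(1/2-x)^5) + (25421824/25)*((x-1/4)^5*(1/2-x)^4) + (19915264/25)*((x-1/4)^6*(1/2-x)^3) + (14084096/25)*((x-1/4)^7*(1/2-x)^2)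 + (6098944/25)*((x-1/4)^8*(1/2-x)^1) + (1089536/25)*((x-1/4)^9*(1/2-x)^0) := by ring
  rw [key]
  have hu : 0 ≤ x - 1/4 := by linarith
  have hv : 0 ≤ 1/2 - x := by linarith
  generalize x - 1/4 = u at *
  generalize 1/2 - x = v at *
  positivity

lemma Gpos2 (x : ℝ) (h0 : 1/2 ≤ x) (h1 : x ≤ 3/4) : 0 ≤ (1/25)*x^0 + (13/25)*x^1 + (88/25)*x^2 + (-116/5)*x^3 + (-53/100)*x^4 + (981/10)*x^5 + (-583/25)*x^6 + (-626/5)*x^7 + (752/25)*x^8 + (1008/25)*x^9 := by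
  have key : (1/25)*x^0 + (13/25)*x^1 + (88/25)*x^2 + (-116/5)*x^3 + (-53/100)*x^4 + (981/10)*x^5 + (-583/25)*x^6 + (-626/5)*x^7 + (752/25)*x^8 + (1008/25)*x^9 = (1089536/25)*((x-1/2)^0*(3/4-x)^9) + (13512704/25)*((x-1/2)^1*(3/4-x)^8) + (73394176/25)*((x-1/2)^2*(3/4-x)^7) + (226348544/25)*((x-1/2)^3*(3/4-x)^6) + (433680384/25)*((x-1/2)^4*(3/4-x)^5) + (532715264/25)*((x-1/2)^5*(3/4-x)^4) + (417698176/25)*((x-1/2)^6*(3/4-x)^3) + (200667104/25)*((x-1/2)^7*(3/4-x)^2) + (53347808/25)*((x-1/2)^8*(3/4-x)^1) + (5967472/25)*((x-1/2)^9*(3/4-x)^0) := by ring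
  rw [key]
  have hu : 0 ≤ x - 1/2 := by linarith
  have hv : 0 ≤ 3/4 - x := by linarith
  generalize x - 1/2 = u at *
  generalize 3/4 - x = v at *
  positivity

lemma Gpos3 (x : ℝ) (h0 : 3/4 ≤ x) (h1 : x ≤ 7/8) : 0 ≤ (1/25)*x^0 + (13/25)*x^1 + (88/25)*x^2 + (-116/5)*x^3 + (-53/100)*x^4 + (981/10)*x^5 + (-583/25)*x^6 + (-626/5)*x^7 + (752/25)*x^8 + (1008/25)*x^9 := by
  have key : (1/25)*x^0 + (13/25)*x^1 + (88/25)*x^2 + (-116/5)*x^3 + (-53/100)*x^4 + (981/10)*x^5 + (-583/25)*x^6 + (-626/5)*x^7 + (752/25)*x^8 + (1008/25)*x^9 = (3055345664/25)*((x-3/4)^0*(7/8-x)^9) + (27590127616/25)*((x-3/4)^1*(7/8-x)^8) + (21856784384/5)*((x-3/4)^2*(7/8-x)^7) + (248760952832/25)*((x-3/4)^3*(7/8-x)^6) + (357835657216/25)*((x-3/4)^4*(7/8-x)^5) + (336451110912/25)*((x-3/4)^5*(7/8-x)^4) + (206143412992/25)*((x-3/4)^6*(7/8-x)^3) + (79098478976/25)*((x-3/4)^7*(7/8-x)^2)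 + (17194110496/25)*((x-3/4)^8*(7/8-x)^1) + (322355792/5)*((x-3/4)^9*(7/8-x)^0) := by ring
  rw [key]
  have hu : 0 ≤ x - 3/4 := by linarith
  have hv : 0 ≤ 7/8 - x := by linarith
  generalize x - 3/4 = u at *
  generalize 7/8 - x = v at *
  positivity

lemma Gpos4 (x : ℝ) (h0 : 7/8 ≤ x) (h1 : x ≤ 1) : 0 ≤ (1/25)*x^0 + (13/25)*x^1 + (88/25)*x^2 + (-116/5)*x^3 + (-53/100)*x^4 + (981/10)*x^5 + (-583/25)*x^6 + (-626/5)*x^7 + (752/25)*x^8 + (1008/25)*x^9 := by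
  have key : (1/25)*x^0 + (13/25)*x^1 + (88/25)*x^2 + (-116/5)*x^3 + (-53/100)*x^4 + (981/10)*x^5 + (-583/25)*x^6 + (-626/5)*x^7 + (752/25)*x^8 + (1008/25)*x^9 = (322355792/5)*((x-7/8)^0*(1-x)^9) + (11817910784/25)*((x-7/8)^1*(1-x)^8) + (7217776256/5)*((x-7/8)^2*(1-x)^7) + (11722075648/5)*((x-7/8)^3*(1-x)^6) + (53387270144/25)*((x-7/8)^4*(1-x)^5) + (26933796864/25)*((x-7/8)^5*(1-x)^4) + (9399959552/25)*((x-7/8)^6*(1-x)^3) + (6305087488/25)*((x-7/8)^7*(1-x)^2) + (4286578688/25)*((x-7/8)^8*(1-x)^1) + (1107296256/25)*((x-7/8)^9*(1-x)^0) := by ring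
  rw [key]
  have hu : 0 ≤ x - 7/8 := by linarith
  have hv : 0 ≤ 1 - x := by linarith
  generalize x - 7/8 = u at *
  generalize 1 - x = v at *
  positivity

lemma Gpos (x : ℝ) (h0 : 0 ≤ x) (h1 : x ≤ 1) : 0 ≤ (1/25)*x^0 + (13/25)*x^1 + (88/25)*x^2 + (-116/5)*x^3 + (-53/100)*x^4 + (981/10)*x^5 + (-583/25)*x^6 + (-626/5)*x^7 + (752/25)*x^8 + (1008/25)*x^9 := by
  rcases le_total x (1/4) with h2 | h2
  · exact Gpos0 x (by linarith) h2
  rcases le_total x (1/2) with h3 | h3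
  · exact Gpos1 x (by linarith) h3
  rcases le_total x (3/4) with h4 | h4
  · exact Gpos2 x (by linarith) h4
  rcases le_total x (7/8) with h5 | h5
  · exact Gpos3 x (by linarith) h5
  exact Gpos4 x (by linarith) h1

lemma qpos (x : ℝ) (h0 : 0 ≤ x) (h1 : x ≤ 1) : 0 ≤ (591/10000)*x^0 + (-339/5000)*x^1 + (1359/5000)*x^2 + (-719/5000)*x^3 + (-517/5000)*x^4 + (441/10000)*x^5 := by
  have key : (591/10000)*x^0 + (-339/5000)*x^1 + (1359/5000)*x^2 + (-719/5000)*x^3 + (-517/5000)*x^4 + (441/10000)*x^5 = (591/10000)*((x-0)^0*(1-x)^5) + (2277/10000)*((x-0)^1*(1-x)^4) + (1479/2500)*((x-0)^2*(1-x)^3) + (4279/5000)*((x-0)^3*(1-x)^2) + (4487/10000)*((x-0)^4*(1-x)^1) + (3/50)*((x-0)^5*(1-x)^0) := by ring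
  rw [key]
  have hu : 0 ≤ x - 0 := by linarith
  have hv : 0 ≤ 1 - x := by linarith
  generalize x - 0 = u at *
  generalize 1 - x = v at *
  positivity

noncomputable def Wm (w : ℂ) : ℂ :=
  1 + (1 + ((1 + Complex.I * w) / (1 - Complex.I * w)) ^ 2) *
    (-3/100 - 69/100 * ((1 + Complex.I * w) / (1 - Complex.I * w))
      + 21/100 * ((1 + Complex.I * w) / (1 - Complex.I * w)) ^ 2
      - 17/100 * ((1 + Complex.I * w) / (1 - Complex.I * w)) ^ 3
      + 21/100 * ((1 + Complex.I * w) / (1 - Complex.I * w)) ^ 4)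

noncomputable def Ym (x : ℝ) : ℝ :=
  1 + 26/25 * x + 39/50 * x^2 - 1/25 * x^3 - 168/25 * x^4 - 68/25 * x^5 + 168/25 * x^6

lemma Wm_den (w : ℂ) (hw : 0 ≤ w.im) : 1 - Complex.I * w ≠ 0 := by
  intro h
  have := congrArg Complex.re h
  simp at this
  linarith

lemma Wm_diff (w : ℂ) (hw : 0 ≤ w.im) : DifferentiableAt ℂ Wm w := by
  have := Wm_den w hw
  unfold Wm
  fun_prop (disch := assumption)

lemma Wm_circ (θ : ℝ) (h0 : 0 ≤ θ) (h1 : θ ≤ Real.pi) : ‖Wm (Complex.exp (θ * Complex.I))‖ ≤ 1 := by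
  have hs : 0 ≤ Real.sin θ := Real.sin_nonneg_of_nonneg_of_le_pi h0 h1
  have hsc := Real.sin_sq_add_cos_sq θ
  set s := Real.sin θ
  set c := Real.cos θ
  set t : ℝ := c / (1 + s) with ht
  have hw : Complex.exp (θ * Complex.I) = (c:ℂ) + (s:ℂ) * Complex.I := by
    rw [Complex.exp_mul_I, ← Complex.ofReal_cos, ← Complex.ofReal_sin]
  have h1s : 1 + s ≠ 0 := by positivity
  have h1sc : (1:ℂ) + (s:ℂ) ≠ 0 := by exact_mod_cast h1s
  have hm : (1 + Complex.I * Complex.exp (θ * Complex.I)) / (1 - Complex.I * Complex.exp (θ * Complex.I)) = Complex.I * (t:ℂ) := by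
    have hd : 1 - Complex.I * Complex.exp (θ * Complex.I) ≠ 0 := by
      apply Wm_den
      rw [hw]; simpa using hs
    rw [div_eq_iff hd, hw, ht]
    have hscc : (s:ℂ)^2 + (c:ℂ)^2 = 1 := by exact_mod_cast hsc
    have hI : Complex.I ^ 2 = -1 := Complex.I_sq
    push_cast
    field_simp
    apply Complex.ext
    · simp [pow_two]
      nlinarith
    · simp [pow_two]
  have ht2 : t^2 ≤ 1 := by
    rw [ht, div_pow, div_le_one (by positivity)]; nlinarith
  have hq := qpos (t^2) (by positivity) ht2
  unfold Wm
  rw [hm]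
  have he : (1 + (1 + (Complex.I * (t:ℂ)) ^ 2) * (-3/100 - 69/100 * (Complex.I * (t:ℂ))
      + 21/100 * (Complex.I * (t:ℂ)) ^ 2 - 17/100 * (Complex.I * (t:ℂ)) ^ 3
      + 21/100 * (Complex.I * (t:ℂ)) ^ 4) : ℂ) =
      ((1 + (1-t^2)*(-3/100 - 21/100*t^2 + 21/100*t^4) : ℝ) : ℂ) + (((1-t^2)*(-69/100*t + 17/100*t^3) : ℝ) : ℂ) * Complex.I := by
    have hI : Complex.I ^ 2 = -1 := Complex.I_sq
    have hI3 : Complex.I ^ 3 = -Complex.I := Complex.I_pow_three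
    have hI4 : Complex.I ^ 4 = 1 := Complex.I_pow_four
    simp only [mul_pow, hI, hI3, hI4]
    push_cast
    ring
  rw [he]
  rw [← abs_of_nonneg (norm_nonneg _), ← abs_one (α := ℝ), ← sq_le_sq, Complex.sq_norm, Complex.normSq_add_mul_I]
  nlinarith [mul_nonneg hq (sub_nonneg.2 ht2)]

lemma Wm_real (w : ℝ) : (Wm w).re = Ym ((1 - w^2)/(1+w^2)) := by
  have hd : (1:ℝ) + w^2 ≠ 0 := by positivity
  set C := (1 - w^2)/(1+w^2) with hC
  set S := 2*w/(1+w^2) with hS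
  have hCS : S^2 = 1 - C^2 := by
    rw [hC, hS]; field_simp; ring
  have hm : (1 + Complex.I * (w:ℂ)) / (1 - Complex.I * (w:ℂ)) = (C:ℂ) + (S:ℂ) * Complex.I := by
    have hden : 1 - Complex.I * (w:ℂ) ≠ 0 := Wm_den _ (by simp)
    have hdc : (1:ℂ) + (w:ℂ)^2 ≠ 0 := by exact_mod_cast hd
    rw [div_eq_iff hden, hC, hS]
    push_cast
    field_simp
    have hI : Complex.I ^ 2 = -1 := Complex.I_sq
    linear_combination (2 * (w:ℂ)^2) * hI
  have hre1 : ∀ x y : ℂ, (x + y).re = x.re + y.re := fun _ _ => rfl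
  unfold Wm
  rw [hm]
  set m : ℂ := (C:ℂ) + (S:ℂ) * Complex.I with hmdef
  have hsc : (S:ℂ)^2 = 1 - (C:ℂ)^2 := by exact_mod_cast hCS
  have hI : Complex.I ^ 2 = -1 := Complex.I_sq
  have m2 : m^2 = 2 * C * m - 1 := by
    rw [hmdef]; linear_combination (S:ℂ)^2 * hI - hsc
  have hexp : (1 + (1 + m ^ 2) * (-3/100 - 69/100 * m + 21/100 * m ^ 2 - 17/100 * m ^ 3 + 21/100 * m ^ 4) : ℂ)
    = 1 + 2 * C * (-3/100 * m - 69/100 * m^2 + 21/100 * m ^ 3 - 17/100 * m ^ 4 + 21/100 * m ^ 5) := by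
    linear_combination (-3/100 - 69/100 * m + 21/100 * m ^ 2 - 17/100 * m ^ 3 + 21/100 * m ^ 4) * m2
  have m3 : m^3 = (4 * C^2 - 1) * m - 2 * C := by linear_combination (m + 2 * C) * m2
  have m4 : m^4 = (8 * C^3 - 4 * C) * m - (4 * C^2 - 1) := by linear_combination m * m3 + (4*C^2-1) * m2
  have m5 : m^5 = (16 * C^4 - 12 * C^2 + 1) * m - (8 * C^3 - 4 * C) := by linear_combination m * m4 + (8*C^3-4*C) * m2
  rw [hexp, m5, m4, m3, m2]
  have : (1 + 2 * C * (-3/100 * m - 69/100 * (2 * C * m - 1) + 21/100 * ((4 * C^2 - 1) * m - 2 * C) - 17/100 * ((8 * C^3 - 4 * C) * m - (4 * C^2 - 1)) + 21/100 * ((16 * C^4 - 12 * C^2 + 1) * m - (8 * C^3 - 4 * C))) : ℂ)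
    = ((1 + 2 * C * (69/100 - 42/100 * C + 17/100 * (4 * C^2-1) - 21/100 * (8*C^3-4*C)) : ℝ) : ℂ)
     + ((2 * C * (-3/100 - 138/100 * C + 21/100 * (4*C^2-1) - 17/100 * (8*C^3-4*C) + 21/100 * (16*C^4-12*C^2+1)) : ℝ) : ℂ) * m := by
    push_cast; ring
  rw [this, Complex.add_re, Complex.ofReal_re, Complex.re_ofReal_mul]
  have : m.re = C := by simp [hmdef]
  rw [this]
  unfold Ym
  ring

lemma Ym_ge (τ : ℝ) (hτ : 0 ≤ τ) :
    Real.exp (τ - 11/4 * (Real.sinh τ * Real.cosh τ - τ)) ≤ Ym (Real.tanh τ) := by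
  let Φ : ℝ → ℝ := fun τ => Ym (Real.tanh τ) * Real.exp (-(τ - 11/4 * (Real.sinh τ * Real.cosh τ - τ)))
  have hder : ∀ x : ℝ, HasDerivAt Φ ((((26/25 + 78/50 * Real.tanh x - 3/25 * Real.tanh x^2 - 4*168/25 * Real.tanh x^3 - 5 * 68/25 * Real.tanh x^4 + 6 * 168/25 * Real.tanh x^5)) * (1 - Real.tanh x ^2)) * Real.exp (-(x - 11/4 * (Real.sinh x * Real.cosh x - x)))
     + Ym (Real.tanh x) * (Real.exp (-(x - 11/4 * (Real.sinh x * Real.cosh x - x))) * (-(1 - 11/4 * (Real.cosh x * Real.cosh x + Real.sinh x * Real.sinh x - 1))))) x := by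
    intro x
    have ht : HasDerivAt Real.tanh (1 - Real.tanh x ^ 2) x := by
      have h1 : Real.tanh = fun y => Real.sinh y / Real.cosh y := funext Real.tanh_eq_sinh_div_cosh
      have hc := (Real.cosh_pos x).ne'
      have := (Real.hasDerivAt_sinh x).div (Real.hasDerivAt_cosh x) hc
      have h2 : 1 - Real.tanh x ^ 2 = (Real.cosh x * Real.cosh x - Real.sinh x * Real.sinh x) / Real.cosh x ^ 2 := by
        rw [Real.tanh_eq_sinh_div_cosh]
        field_simp
      rw [h2, h1]
      exact this
    have hY : HasDerivAt Ym (26/25 + 78/50 * Real.tanh x - 3/25 * Real.tanh x^2 - 4*168/25 * Real.tanh x^3 - 5 * 68/25 * Real.tanh x^4 + 6 * 168/25 * Real.tanh x^5) (Real.tanh x) := by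
      unfold Ym
      have hid := hasDerivAt_id' (Real.tanh x)
      have := ((((((hid.const_mul (26/25)).const_add 1).fun_add ((hid.fun_pow 2).const_mul (39/50))).fun_sub ((hid.fun_pow 3).const_mul (1/25))).fun_sub ((hid.fun_pow 4).const_mul (168/25))).fun_sub ((hid.fun_pow 5).const_mul (68/25))).fun_add ((hid.fun_pow 6).const_mul (168/25))
      refine this.congr_deriv ?_
      simp only [Nat.cast_ofNat, Nat.reduceSub, pow_one, mul_one]
      ring
    have hx := hasDerivAt_id' x
    have hsc := (Real.hasDerivAt_sinh x).fun_mul (Real.hasDerivAt_cosh x)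
    exact (hY.comp x ht).fun_mul ((hx.fun_sub ((hsc.fun_sub hx).const_mul (11/4))).fun_neg.exp)
  have hmono : MonotoneOn Φ (Set.Ici 0) := by
    apply monotoneOn_of_deriv_nonneg (convex_Ici 0)
    · exact fun x _ => (hder x).continuousAt.continuousWithinAt
    · exact fun x _ => (hder x).differentiableAt.differentiableWithinAt
    · intro x hx
      rw [interior_Ici] at hx
      have hx : 0 < x := hx
      rw [(hder x).deriv]
      have hc := Real.cosh_pos x
      have hs : 0 < Real.sinh x := Real.sinh_pos_iff.2 hx
      have hcs := Real.cosh_sq x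
      set y := Real.tanh x with hy
      have hyd : y = Real.sinh x / Real.cosh x := Real.tanh_eq_sinh_div_cosh x
      have hy0 : 0 ≤ y := by rw [hyd]; positivity
      have hsy : Real.sinh x = y * Real.cosh x := by rw [hyd]; field_simp
      have hcy : Real.cosh x ^ 2 * (1 - y^2) = 1 := by
        have := hcs
        rw [hsy] at this; nlinarith
      have hy1 : y ≤ 1 := by
        by_contra h
        push Not at h
        have h1 : 1 - y^2 < 0 := by nlinarith
        nlinarith [sq_nonneg (Real.cosh x), mul_nonneg (sq_nonneg (Real.cosh x)) (neg_nonneg.2 h1.le)]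
      have hG := Gpos y hy0 hy1
      have hE := Real.exp_pos (-(x - 11/4 * (Real.sinh x * Real.cosh x - x)))
      rw [hsy] at *
      set E := Real.exp (-(x - 11/4 * (y * Real.cosh x * Real.cosh x - x)))
      set c := Real.cosh x
      have h3 : (26/25 + 78/50 * y - 3/25 * y^2 - 4*168/25 * y^3 - 5 * 68/25 * y^4 + 6 * 168/25 * y^5) * (1 - y^2) * E + Ym y * (E * (-(1 - 11/4 * (c * c + y * c * (y * c) - 1))))
        = E * c^2 * ((1/25)*y^0 + (13/25)*y^1 + (88/25)*y^2 + (-116/5)*y^3 + (-53/100)*y^4 + (981/10)*y^5 + (-583/25)*y^6 + (-626/5)*y^7 + (752/25)*y^8 + (1008/25)*y^9) := by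
        have : c * c + y * c * (y * c) = c^2 * (1 + y^2) := by ring
        rw [this]
        unfold Ym
        linear_combination (-E * ((26/25 + 78/50 * y - 3/25 * y^2 - 4*168/25 * y^3 - 5 * 68/25 * y^4 + 6 * 168/25 * y^5) * (1 - y^2) - (15/4) * (1 + 26/25 * y + 39/50 * y^2 - 1/25 * y^3 - 168/25 * y^4 - 68/25 * y^5 + 168/25 * y^6))) * hcy
      rw [h3]
      exact mul_nonneg (by positivity) hG
  have := hmono (Set.mem_Ici.2 le_rfl) (Set.mem_Ici.2 hτ) hτ
  have h0 : Φ 0 = 1 := by simp [Φ, Ym]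
  rw [h0] at this
  simp only [Φ] at this
  rw [Real.exp_neg, ← div_eq_mul_inv, le_div_iff₀ (Real.exp_pos _), one_mul] at this
  exact this

lemma halfdisc_R (F W : ℂ → ℂ) (hFc : ContinuousOn F (Metric.closedBall 0 1))
    (hFd : DifferentiableOn ℂ F (Metric.ball 0 1))
    (hW : ∀ w : ℂ, 0 ≤ w.im → DifferentiableAt ℂ W w)
    (hFr : ∀ t : ℝ, |t| < 1 → F t = ((‖F t‖ : ℝ) : ℂ))
    (hW1 : ∀ θ : ℝ, 0 ≤ θ → θ ≤ Real.pi → ‖W (Complex.exp (θ * Complex.I))‖ ≤ 1)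
    :
    ∃ M : ℝ, ∀ R : ℝ, 0 < R →
      ∫ x in (-R)..0, (‖F (Real.exp x : ℝ)‖ * (W (Real.exp x : ℝ)).re +
        ‖F ((-Real.exp x : ℝ))‖ * (W ((-Real.exp x : ℝ))).re) * Real.exp x
      ≤ (∫ θ in (0:ℝ)..Real.pi, ‖F (Complex.exp (θ * Complex.I))‖) + M * Real.exp (-R) := by
  have hpi := Real.pi_pos
  set S : Set ℂ := {w | ‖w‖ ≤ 1 ∧ 0 ≤ w.im} with hS
  have hSc : IsCompact S := by
    apply (isCompact_closedBall (0:ℂ) 1).of_isClosed_subset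
    · exact (isClosed_le continuous_norm continuous_const).inter
        (isClosed_le continuous_const Complex.continuous_im)
    · intro w hw; simpa using hw.1
  have hSb : S ⊆ Metric.closedBall 0 1 := fun w hw => by simpa using hw.1
  set g : ℂ → ℂ := fun w => F w * W w with hg
  have hgc : ContinuousOn g S := (hFc.mono hSb).mul
    (fun w hw => (hW w hw.2).continuousAt.continuousWithinAt)
  obtain ⟨M, hM⟩ := hSc.exists_bound_of_continuousOn hgc
  set h : ℂ → ℂ := fun z => g (Complex.exp z) * Complex.exp z with hh
  have hmem : ∀ z : ℂ, z.re ≤ 0 → 0 ≤ z.im → z.im ≤ Real.pi → Complex.exp z ∈ S := by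
    intro z h1 h2 h3
    refine ⟨by rw [Complex.norm_exp]; simpa using h1, ?_⟩
    rw [Complex.exp_im]
    exact mul_nonneg (Real.exp_pos _).le (Real.sin_nonneg_of_nonneg_of_le_pi h2 h3)
  have hhc : ContinuousOn h {z : ℂ | z.re ≤ 0 ∧ 0 ≤ z.im ∧ z.im ≤ Real.pi} := by
    apply ContinuousOn.mul
    · exact hgc.comp Complex.continuous_exp.continuousOn (fun z hz => hmem z hz.1 hz.2.1 hz.2.2)
    · exact Complex.continuous_exp.continuousOn
  refine ⟨Real.pi * M, fun R hR => ?_⟩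
  have key := Complex.integral_boundary_rect_eq_zero_of_continuousOn_of_differentiableOn h
    (⟨-R, 0⟩ : ℂ) (⟨0, Real.pi⟩ : ℂ) ?_ ?_
  rotate_left
  · apply hhc.mono
    intro z hz
    rw [Complex.mem_reProdIm] at hz
    simp only [Set.uIcc_of_le hpi.le, Set.uIcc_of_le (by linarith : -R ≤ 0)] at hz
    exact ⟨hz.1.2, hz.2.1, hz.2.2⟩
  · intro z hz
    rw [Complex.mem_reProdIm] at hz
    simp only [min_eq_left hpi.le, max_eq_right hpi.le, min_eq_left (by linarith : -R ≤ 0), max_eq_right (by linarith : -R ≤ 0)] at hz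
    have hb : Complex.exp z ∈ Metric.ball (0:ℂ) 1 := by
      rw [mem_ball_zero_iff, Complex.norm_exp]; simpa using hz.1.2
    have hm := hmem z hz.1.2.le hz.2.1.le hz.2.2.le
    have h1 : DifferentiableAt ℂ F (Complex.exp z) := hFd.differentiableAt (Metric.isOpen_ball.mem_nhds hb)
    have h2 := hW _ hm.2
    have h3 : DifferentiableAt ℂ g (Complex.exp z) := h1.mul h2
    exact ((h3.comp z Complex.differentiable_exp.differentiableAt).mul Complex.differentiable_exp.differentiableAt).differentiableWithinAt
  simp only at key
  have e1 : ∀ x : ℝ, h (↑x + ↑(0:ℝ) * Complex.I) - h (↑x + ↑Real.pi * Complex.I)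
      = (g (Real.exp x : ℝ) + g ((-Real.exp x : ℝ))) * ((Real.exp x : ℝ) : ℂ) := by
    intro x
    simp only [hh, Complex.ofReal_zero, zero_mul, add_zero, Complex.exp_add, Complex.exp_pi_mul_I]
    push_cast
    ring_nf
  have ci : ∀ y : ℝ, y = 0 ∨ y = Real.pi → IntervalIntegrable (fun x : ℝ => h (↑x + ↑y * Complex.I)) volume (-R) 0 := by
    intro y hy
    apply ContinuousOn.intervalIntegrable
    apply hhc.comp (by fun_prop)
    intro x hx
    rw [Set.uIcc_of_le (by linarith)] at hx
    rcases hy with rfl | rfl <;> simp [hx.2, hpi.le]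
  rw [← intervalIntegral.integral_sub (ci 0 (Or.inl rfl)) (ci Real.pi (Or.inr rfl))] at key
  simp_rw [e1] at key
  have key2 := congrArg Complex.re (sub_eq_zero.1 key)
  rw [Complex.add_re] at key2
  have hI1 : IntervalIntegrable (fun x : ℝ => (g (Real.exp x : ℝ) + g ((-Real.exp x : ℝ))) * ((Real.exp x : ℝ) : ℂ)) volume (-R) 0 := by
    have := (ci 0 (Or.inl rfl)).sub (ci Real.pi (Or.inr rfl))
    convert this using 1
    funext x
    exact (e1 x).symm
  have e2 : (∫ x in (-R)..0, (g (Real.exp x : ℝ) + g ((-Real.exp x : ℝ))) * ((Real.exp x : ℝ) : ℂ)).re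
      = ∫ x in (-R)..0, (‖F (Real.exp x : ℝ)‖ * (W (Real.exp x : ℝ)).re +
        ‖F ((-Real.exp x : ℝ))‖ * (W ((-Real.exp x : ℝ))).re) * Real.exp x := by
    have : (∫ x in (-R)..0, (g (Real.exp x : ℝ) + g ((-Real.exp x : ℝ))) * ((Real.exp x : ℝ) : ℂ)).re
        = ∫ x in (-R)..0, ((g (Real.exp x : ℝ) + g ((-Real.exp x : ℝ))) * ((Real.exp x : ℝ) : ℂ)).re := by
      exact (Complex.reCLM.intervalIntegral_comp_comm hI1).symm
    rw [this]
    rw [intervalIntegral.integral_of_le (by linarith), intervalIntegral.integral_of_le (by linarith),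
      integral_Ioc_eq_integral_Ioo, integral_Ioc_eq_integral_Ioo]
    apply setIntegral_congr_fun measurableSet_Ioo
    intro x hx
    have hx1 : Real.exp x < 1 := by simpa using hx.2
    have hx0 := Real.exp_pos x
    have a1 : |Real.exp x| < 1 := by rwa [abs_of_pos hx0]
    have a2 : |-Real.exp x| < 1 := by rwa [abs_neg]
    simp only [hg]
    rw [Complex.re_mul_ofReal, Complex.add_re]
    congr 2
    · conv_lhs => rw [hFr _ a1]
      rw [Complex.re_ofReal_mul]
    · conv_lhs => rw [hFr _ a2]
      rw [Complex.re_ofReal_mul]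
  rw [e2] at key2
  have b1 : ‖Complex.I • ∫ y in (0:ℝ)..Real.pi, h (↑(0:ℝ) + ↑y * Complex.I)‖ ≤ ∫ θ in (0:ℝ)..Real.pi, ‖F (Complex.exp (θ * Complex.I))‖ := by
    rw [norm_smul, Complex.norm_I, one_mul]
    refine (intervalIntegral.norm_integral_le_integral_norm hpi.le).trans ?_
    apply intervalIntegral.integral_mono_on hpi.le
    · apply ContinuousOn.intervalIntegrable
      apply ContinuousOn.norm
      apply hhc.comp (by fun_prop)
      intro x hx
      rw [Set.uIcc_of_le hpi.le] at hx
      simp [hx.1, hx.2]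
    · apply ContinuousOn.intervalIntegrable
      apply ContinuousOn.norm
      apply hFc.comp (by fun_prop)
      intro x hx
      simp [Complex.norm_exp_ofReal_mul_I]
    · intro x hx
      simp only [hh, hg, Complex.ofReal_zero, zero_add, norm_mul, Complex.norm_exp_ofReal_mul_I, mul_one]
      exact mul_le_of_le_one_right (norm_nonneg _) (hW1 x hx.1 hx.2)
  have b2 : ‖Complex.I • ∫ y in (0:ℝ)..Real.pi, h (↑(-R) + ↑y * Complex.I)‖ ≤ Real.pi * M * Real.exp (-R) := by
    rw [norm_smul, Complex.norm_I, one_mul]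
    have := intervalIntegral.norm_integral_le_of_norm_le_const (a := 0) (b := Real.pi) (C := M * Real.exp (-R))
      (f := fun y : ℝ => h (↑(-R) + ↑y * Complex.I)) ?_
    · refine this.trans (le_of_eq ?_)
      rw [sub_zero, abs_of_pos hpi]; ring
    · intro y hy
      rw [Set.uIoc_of_le hpi.le] at hy
      simp only [hh, norm_mul]
      have hmm := hmem (↑(-R) + ↑y * Complex.I) (by simp [hR.le]) (by simp [hy.1.le]) (by simp [hy.2])
      have hn : ‖Complex.exp (↑(-R) + ↑y * Complex.I)‖ = Real.exp (-R) := by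
        rw [Complex.norm_exp]; simp
      rw [hn]
      exact mul_le_mul_of_nonneg_right (hM _ hmm) (Real.exp_pos _).le
  have c1 := (Complex.abs_re_le_norm _).trans b1
  have c2 := (Complex.abs_re_le_norm _).trans b2
  have c1' := (abs_le.1 c1).1
  have c2' := (abs_le.1 c2).2
  linarith

lemma halfdisc (F W : ℂ → ℂ) (hFc : ContinuousOn F (Metric.closedBall 0 1))
    (hFd : DifferentiableOn ℂ F (Metric.ball 0 1))
    (hW : ∀ w : ℂ, 0 ≤ w.im → DifferentiableAt ℂ W w)
    (hFr : ∀ t : ℝ, |t| < 1 → F t = ((‖F t‖ : ℝ) : ℂ))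
    (hW1 : ∀ θ : ℝ, 0 ≤ θ → θ ≤ Real.pi → ‖W (Complex.exp (θ * Complex.I))‖ ≤ 1)
    (hWr : ∀ t : ℝ, |t| ≤ 1 → 0 ≤ (W t).re) :
    ∫⁻ x in Set.Iio (0:ℝ), ENNReal.ofReal ((‖F (Real.exp x : ℝ)‖ * (W (Real.exp x : ℝ)).re +
        ‖F ((-Real.exp x : ℝ))‖ * (W ((-Real.exp x : ℝ))).re) * Real.exp x)
      ≤ ∫⁻ θ in Set.Ioo (0:ℝ) Real.pi, ENNReal.ofReal ‖F (Complex.exp (θ * Complex.I))‖ := by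
  have hpi := Real.pi_pos
  obtain ⟨M, hM⟩ := halfdisc_R F W hFc hFd hW hFr hW1
  set U : ℝ → ℝ := fun x => (‖F (Real.exp x : ℝ)‖ * (W (Real.exp x : ℝ)).re +
        ‖F ((-Real.exp x : ℝ))‖ * (W ((-Real.exp x : ℝ))).re) * Real.exp x with hU
  have hFcI : IntervalIntegrable (fun θ : ℝ => ‖F (Complex.exp (θ * Complex.I))‖) volume 0 Real.pi := by
    apply ContinuousOn.intervalIntegrable
    apply ContinuousOn.norm
    apply hFc.comp (by fun_prop)
    intro x hx
    simp [Complex.norm_exp_ofReal_mul_I]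
  have hrhs : ∫⁻ θ in Set.Ioo (0:ℝ) Real.pi, ENNReal.ofReal ‖F (Complex.exp (θ * Complex.I))‖
      = ENNReal.ofReal (∫ θ in (0:ℝ)..Real.pi, ‖F (Complex.exp (θ * Complex.I))‖) := by
    rw [intervalIntegral.integral_of_le hpi.le, integral_Ioc_eq_integral_Ioo, ofReal_integral_eq_lintegral_ofReal]
    · rw [intervalIntegrable_iff_integrableOn_Ioo_of_le hpi.le] at hFcI
      exact hFcI
    · exact Eventually.of_forall fun _ => norm_nonneg _
  have hUc : ContinuousOn U (Set.Iic 0) := by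
    have m1 : ∀ x : ℝ, x ≤ 0 → Real.exp x ≤ 1 := fun x hx => by simpa using hx
    have f1 : ContinuousOn (fun x : ℝ => F (Real.exp x : ℝ)) (Set.Iic 0) := by
      apply hFc.comp (by fun_prop)
      intro x hx
      rw [mem_closedBall_zero_iff, Complex.norm_real, Real.norm_of_nonneg (Real.exp_pos _).le]
      exact m1 x hx
    have f2 : ContinuousOn (fun x : ℝ => F (-Real.exp x : ℝ)) (Set.Iic 0) := by
      apply hFc.comp (by fun_prop)
      intro x hx
      rw [mem_closedBall_zero_iff, Complex.norm_real, norm_neg, Real.norm_of_nonneg (Real.exp_pos _).le]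
      exact m1 x hx
    have w0 : ∀ t : ℝ, ContinuousAt (fun t : ℝ => W (t:ℂ)) t := fun t =>
      (hW t (by simp)).continuousAt.comp' (Complex.continuous_ofReal.continuousAt)
    have w0' : Continuous (fun t : ℝ => W (t:ℂ)) := continuous_iff_continuousAt.2 w0
    have w1 : Continuous (fun x : ℝ => (W (Real.exp x : ℝ)).re) := Complex.continuous_re.comp (w0'.comp Real.continuous_exp)
    have w2 : Continuous (fun x : ℝ => (W (-Real.exp x : ℝ)).re) := Complex.continuous_re.comp (w0'.comp Real.continuous_exp.neg)
    exact ((f1.norm.mul w1.continuousOn).add (f2.norm.mul w2.continuousOn)).mul Real.continuous_exp.continuousOn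
  have hU0 : ∀ x : ℝ, x ≤ 0 → 0 ≤ U x := by
    intro x hx
    have hx1 : Real.exp x ≤ 1 := by simpa using hx
    have a1 : |Real.exp x| ≤ 1 := by rwa [abs_of_pos (Real.exp_pos x)]
    have a2 : |-Real.exp x| ≤ 1 := by rwa [abs_neg]
    have := hWr _ a1
    have := hWr _ a2
    simp only [hU]
    positivity
  have hlhs : ∀ R : ℝ, 0 < R → ∫⁻ x in Set.Ioo (-R) 0, ENNReal.ofReal (U x) = ENNReal.ofReal (∫ x in (-R)..0, U x) := by
    intro R hR
    rw [intervalIntegral.integral_of_le (by linarith), integral_Ioc_eq_integral_Ioo, ofReal_integral_eq_lintegral_ofReal]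
    · have : IntervalIntegrable U volume (-R) 0 := by
        apply ContinuousOn.intervalIntegrable
        apply hUc.mono
        rw [Set.uIcc_of_le (by linarith)]
        exact Set.Icc_subset_Iic_self
      rwa [intervalIntegrable_iff_integrableOn_Ioo_of_le (by linarith)] at this
    · rw [EventuallyLE, ae_restrict_iff' measurableSet_Ioo]
      exact Eventually.of_forall fun x hx => hU0 x hx.2.le
  have hun : Set.Iio (0:ℝ) = ⋃ k : ℕ, Set.Ioo (-((k:ℝ)+1)) 0 := by
    ext x
    simp only [Set.mem_Iio, Set.mem_iUnion, Set.mem_Ioo]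
    constructor
    · intro hx
      obtain ⟨k, hk⟩ := exists_nat_gt (-x)
      exact ⟨k, by linarith, hx⟩
    · rintro ⟨k, hk⟩; exact hk.2
  have hmono : Monotone fun k : ℕ => Set.Ioo (-((k:ℝ)+1)) 0 := by
    intro i j hij
    apply Set.Ioo_subset_Ioo_left
    have : (i:ℝ) ≤ j := by exact_mod_cast hij
    linarith
  have hT : Tendsto (fun k : ℕ => ∫⁻ x in Set.Ioo (-((k:ℝ)+1)) 0, ENNReal.ofReal (U x)) atTop (nhds (∫⁻ x in Set.Iio 0, ENNReal.ofReal (U x))) := by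
    rw [hun, setLIntegral_iUnion_of_directed _ hmono.directed_le]
    apply tendsto_atTop_iSup
    intro i j hij
    exact lintegral_mono_set (hmono hij)
  have hT2 : Tendsto (fun k : ℕ => ENNReal.ofReal ((∫ θ in (0:ℝ)..Real.pi, ‖F (Complex.exp (θ * Complex.I))‖) + M * Real.exp (-((k:ℝ)+1)))) atTop (nhds (ENNReal.ofReal (∫ θ in (0:ℝ)..Real.pi, ‖F (Complex.exp (θ * Complex.I))‖))) := by
    apply ENNReal.tendsto_ofReal
    have h1 : Tendsto (fun k : ℕ => Real.exp (-((k:ℝ)+1))) atTop (nhds 0) := by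
      apply Real.tendsto_exp_neg_atTop_nhds_zero.comp
      exact tendsto_atTop_add_const_right _ _ tendsto_natCast_atTop_atTop
    have := (h1.const_mul M).const_add (∫ θ in (0:ℝ)..Real.pi, ‖F (Complex.exp (θ * Complex.I))‖)
    simpa using this
  rw [hrhs]
  refine le_of_tendsto_of_tendsto' hT hT2 fun k => ?_
  rw [hlhs _ (by positivity)]
  exact ENNReal.ofReal_le_ofReal (hM _ (by positivity))

noncomputable def bet (τ : ℝ) : ℝ := Real.sinh τ * Real.cosh τ - τ

lemma bet_strict : StrictMonoOn bet (Set.Ici 0) := by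
  apply strictMonoOn_of_deriv_pos (convex_Ici 0)
  · unfold bet; fun_prop
  · intro x hx
    rw [interior_Ici] at hx
    have hx : 0 < x := hx
    have hd : HasDerivAt bet (Real.cosh x * Real.cosh x + Real.sinh x * Real.sinh x - 1) x :=
      ((Real.hasDerivAt_sinh x).fun_mul (Real.hasDerivAt_cosh x)).fun_sub (hasDerivAt_id' x)
    rw [hd.deriv]
    have hs : 0 < Real.sinh x := Real.sinh_pos_iff.2 hx
    nlinarith [Real.cosh_sq x]

lemma bet_pos {τ : ℝ} (h : 0 < τ) : 0 < bet τ := by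
  have := bet_strict (Set.mem_Ici.2 le_rfl) (Set.mem_Ici.2 h.le) h
  simpa [bet] using this

lemma bet_mono {τ σ : ℝ} (h : 0 ≤ τ) (h2 : τ ≤ σ) : bet τ ≤ bet σ :=
  bet_strict.monotoneOn (Set.mem_Ici.2 h) (Set.mem_Ici.2 (h.trans h2)) h2

noncomputable def Ffun (f : ℂ → ℂ) (pn : ℝ) (w : ℂ) : ℂ :=
  f w * Complex.exp (-((pn / 2 : ℝ) : ℂ) * (1 + w ^ 2)) * (1 - w ^ 2)

lemma Ffun_real (f : ℂ → ℂ) (pn t : ℝ) (ht : |t| < 1) :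
    ‖Ffun f pn t‖ = ‖f t‖ * Real.exp (-(pn / 2) * (1 + t ^ 2)) * (1 - t ^ 2) := by
  have h1 : 0 ≤ 1 - t^2 := by
    have := (sq_lt_one_iff_abs_lt_one t).2 ht
    linarith
  unfold Ffun
  have e1 : (1:ℂ) - (t:ℂ)^2 = ((1 - t^2 : ℝ) : ℂ) := by push_cast; ring
  have e2 : -((pn / 2 : ℝ) : ℂ) * (1 + (t:ℂ) ^ 2) = ((-(pn / 2) * (1 + t ^ 2) : ℝ) : ℂ) := by push_cast; ring
  rw [norm_mul, norm_mul, e1, e2, Complex.norm_real, Real.norm_of_nonneg h1, ← Complex.ofReal_exp,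
    Complex.norm_real, Real.norm_of_nonneg (Real.exp_pos _).le]

lemma Ffun_real' (f : ℂ → ℂ) (pn t : ℝ) (ht : |t| < 1) (hf : f t = ((‖f t‖ : ℝ) : ℂ)) :
    Ffun f pn t = ((‖Ffun f pn t‖ : ℝ) : ℂ) := by
  rw [Ffun_real f pn t ht]
  unfold Ffun
  conv_lhs => rw [hf]
  push_cast
  ring_nf

lemma Ffun_circ (f : ℂ → ℂ) (pn θ : ℝ) (h0 : 0 ≤ θ) (h1 : θ ≤ Real.pi) :
    ‖Ffun f pn (Complex.exp (θ * Complex.I))‖ = ‖f (Complex.exp (θ * Complex.I))‖ * Real.exp (-pn * Real.cos θ ^ 2) * (2 * Real.sin θ) := by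
  have hs : 0 ≤ Real.sin θ := Real.sin_nonneg_of_nonneg_of_le_pi h0 h1
  have hsc := Real.sin_sq_add_cos_sq θ
  have hscc : (Real.sin θ : ℂ)^2 + (Real.cos θ : ℂ)^2 = 1 := by exact_mod_cast hsc
  have hw : Complex.exp (θ * Complex.I) = (Real.cos θ:ℂ) + (Real.sin θ:ℂ) * Complex.I := by
    rw [Complex.exp_mul_I, ← Complex.ofReal_cos, ← Complex.ofReal_sin]
  have hI : Complex.I ^ 2 = -1 := Complex.I_sq
  unfold Ffun
  rw [norm_mul, norm_mul, Complex.norm_exp]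
  congr 1
  · congr 2
    rw [hw]
    clear hw hscc hs
    generalize Real.cos θ = C at *
    generalize Real.sin θ = S at *
    simp [pow_two]
    linear_combination (-pn/2) * hsc
  · have : 1 - Complex.exp (θ * Complex.I) ^ 2 = ((2 * Real.sin θ : ℝ) : ℂ) * (-Complex.I * Complex.exp (θ * Complex.I)) := by
      rw [hw]; push_cast
      rw [← Complex.ofReal_cos, ← Complex.ofReal_sin]
      linear_combination -hscc + (-(Real.sin θ:ℂ)^2 + 2 * (Real.sin θ:ℂ)^2) * hI
    rw [this, norm_mul, norm_mul, norm_neg, Complex.norm_I, Complex.norm_exp_ofReal_mul_I, Complex.norm_real,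
      Real.norm_of_nonneg (by positivity)]
    ring

lemma tanh_w (τ : ℝ) : (1 - Real.exp (-τ) ^ 2) / (1 + Real.exp (-τ) ^ 2) = Real.tanh τ := by
  rw [Real.tanh_eq_sinh_div_cosh, Real.sinh_eq, Real.cosh_eq]
  have h : Real.exp τ = (Real.exp (-τ))⁻¹ := by rw [Real.exp_neg, inv_inv]
  have := Real.exp_pos (-τ)
  rw [h]
  field_simp

lemma caseI_pt (q : Polynomial ℝ) (n p : ℝ) (hn : 3 ≤ n) (hp : 1 ≤ p) (hq : (q.natDegree : ℝ) + 1 ≤ n)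
    (a : ℝ) (ha : a ^ 2 = 2 * n) (D : ℕ) (hD : D = q.natDegree)
    (f : ℂ → ℂ) (hf : GoodF a p D (q.map (algebraMap ℝ ℂ)) f)
    (τ0 τ t : ℝ) (h0 : 0 < τ0) (h1 : τ0 ≤ τ) (ht : t = Real.exp (-τ) ∨ t = -Real.exp (-τ)) (y : ℝ)
    (hy : y = a * (t + t⁻¹) / 2) :
    Real.sinh τ * (|q.eval y| ^ p * Real.exp (-p * y ^ 2 / 2)) ≤
      1 / 2 * Real.exp (-(p * n * bet τ0 / 12)) * (‖Ffun f (p * n) t‖ * Ym (Real.tanh τ) * Real.exp (-τ)) := by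
  have hτ : 0 < τ := by linarith
  have hs : 0 < Real.sinh τ := Real.sinh_pos_iff.2 hτ
  have hta : |t| = Real.exp (-τ) := by
    rcases ht with rfl | rfl
    · rw [abs_of_pos (Real.exp_pos _)]
    · rw [abs_neg, abs_of_pos (Real.exp_pos _)]
  have ht1 : |t| < 1 := by rw [hta]; simpa using hτ
  have ht0 : t ≠ 0 := by rw [← abs_pos, hta]; exact Real.exp_pos _
  have ht2 : t ^ 2 = Real.exp (-τ) ^ 2 := by rw [← sq_abs, hta]
  have hinv : Real.exp τ * Real.exp (-τ) = 1 := by rw [← Real.exp_add]; simp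
  have hb := hf.bound t ht0 ht1
  rw [← hy] at hb
  have hev : ‖(q.map (algebraMap ℝ ℂ)).eval (y:ℂ)‖ = |q.eval y| := by
    rw [show (y:ℂ) = algebraMap ℝ ℂ y from rfl, Polynomial.eval_map_algebraMap, Polynomial.aeval_algebraMap_apply]
    simp
  rw [hev, Real.mul_rpow (abs_nonneg _) (by positivity), hta, ← Real.rpow_natCast, ← Real.exp_mul, ← Real.exp_mul] at hb
  have hq1 : |q.eval y| ^ p ≤ ‖f t‖ * Real.exp (p * D * τ) := by
    have e : Real.exp (-τ * D * p) * Real.exp (p * D * τ) = 1 := by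
      rw [← Real.exp_add]; simp; ring
    calc |q.eval y| ^ p = |q.eval y| ^ p * Real.exp (-τ * D * p) * Real.exp (p * D * τ) := by
          rw [mul_assoc, e, mul_one]
      _ ≤ _ := mul_le_mul_of_nonneg_right hb (Real.exp_pos _).le
  have hch : Real.cosh τ = (Real.exp τ + Real.exp (-τ)) / 2 := Real.cosh_eq τ
  have hsh : Real.sinh τ = (Real.exp τ - Real.exp (-τ)) / 2 := Real.sinh_eq τ
  have hy2 : y ^ 2 = 2 * n * Real.cosh τ ^ 2 := by
    rw [hy, ← ha, hch]
    rcases ht with rfl | rfl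
    · rw [← Real.exp_neg, neg_neg]; ring
    · rw [inv_neg, ← Real.exp_neg, neg_neg]; ring
  have h1t : 1 - t ^ 2 = 2 * Real.exp (-τ) * Real.sinh τ := by
    rw [ht2, hsh]; linear_combination -hinv
  have h2t : 1 + t ^ 2 = 2 * (Real.cosh τ ^ 2 - Real.sinh τ * Real.cosh τ) := by
    rw [ht2, hsh, hch]; linear_combination -hinv
  rw [Ffun_real f _ t ht1, h1t, h2t, hy2]
  have hY := Ym_ge τ hτ.le
  have hbm : bet τ0 ≤ bet τ := bet_mono h0.le h1
  have hb0 := bet_pos h0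
  have hexp : Real.exp (p * D * τ) * Real.exp (-p * (2 * n * Real.cosh τ ^ 2) / 2) ≤
      Real.exp (-(p * n * bet τ0 / 12)) * Real.exp (-(p * n / 2) * (2 * (Real.cosh τ ^ 2 - Real.sinh τ * Real.cosh τ))) * Real.exp (-τ) * Real.exp (τ - 11/4 * (Real.sinh τ * Real.cosh τ - τ)) * Real.exp (-τ) := by
    simp only [← Real.exp_add]
    apply Real.exp_le_exp.2
    have hbd : Real.sinh τ * Real.cosh τ = bet τ + τ := by unfold bet; ring
    have hpn : 3 ≤ p * n := by nlinarith
    have hpD : p * D + 1 ≤ p * n := by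
      rw [hD]
      nlinarith [mul_le_mul_of_nonneg_left hq (by linarith : (0:ℝ) ≤ p)]
    rw [hbd]
    have i1 : (p * D + 1) * τ ≤ p * n * τ := mul_le_mul_of_nonneg_right hpD hτ.le
    have i2 : p * n * bet τ0 ≤ p * n * bet τ := mul_le_mul_of_nonneg_left hbm (by linarith)
    have i3 : 3 * bet τ ≤ p * n * bet τ := mul_le_mul_of_nonneg_right hpn (by linarith)
    ring_nf at *
    linarith
  calc Real.sinh τ * (|q.eval y| ^ p * Real.exp (-p * (2 * n * Real.cosh τ ^ 2) / 2))
      ≤ Real.sinh τ * ((‖f t‖ * Real.exp (p * D * τ)) * Real.exp (-p * (2 * n * Real.cosh τ ^ 2) / 2)) := by gcongr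
    _ = Real.sinh τ * ‖f t‖ * (Real.exp (p * D * τ) * Real.exp (-p * (2 * n * Real.cosh τ ^ 2) / 2)) := by ring
    _ ≤ Real.sinh τ * ‖f t‖ * (Real.exp (-(p * n * bet τ0 / 12)) * Real.exp (-(p * n / 2) * (2 * (Real.cosh τ ^ 2 - Real.sinh τ * Real.cosh τ))) * Real.exp (-τ) * Real.exp (τ - 11/4 * (Real.sinh τ * Real.cosh τ - τ)) * Real.exp (-τ)) := by gcongr
    _ ≤ Real.sinh τ * ‖f t‖ * (Real.exp (-(p * n * bet τ0 / 12)) * Real.exp (-(p * n / 2) * (2 * (Real.cosh τ ^ 2 - Real.sinh τ * Real.cosh τ))) * Real.exp (-τ) * Ym (Real.tanh τ) * Real.exp (-τ)) := by gcongr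
    _ = _ := by ring

lemma caseI (q : Polynomial ℝ) (n p : ℝ) (hn : 3 ≤ n) (hp : 1 ≤ p) (hq : (q.natDegree : ℝ) + 1 ≤ n)
    (a : ℝ) (ha0 : 0 < a) (ha : a ^ 2 = 2 * n) (τ0 : ℝ) (h0 : 0 < τ0) (u : ℝ → ℝ)
    (hu : u = fun x => |q.eval x| ^ p * Real.exp (-p * x ^ 2 / 2)) :
    ∫⁻ x in Set.Ioi (a * Real.cosh τ0), ENNReal.ofReal (u x + u (-x)) ≤
      ENNReal.ofReal (Real.exp (-(p * n * bet τ0 / 12))) * ∫⁻ x in Set.Ioo (-a) a, ENNReal.ofReal (u x) := by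
  obtain ⟨f, hf⟩ := GoodF.exists a p ha0 (by linarith) (q.map (algebraMap ℝ ℂ))
  have hD : (q.map (algebraMap ℝ ℂ)).natDegree = q.natDegree := Polynomial.natDegree_map _
  have hexpc : Differentiable ℂ (fun w : ℂ => Complex.exp (-((p * n / 2 : ℝ) : ℂ) * (1 + w ^ 2))) := by fun_prop
  have hpolc : Differentiable ℂ (fun w : ℂ => 1 - w ^ 2) := by fun_prop
  have hYpos : ∀ t : ℝ, |t| ≤ 1 → 0 ≤ (Wm t).re := by
    intro t ht
    rw [Wm_real]
    rcases eq_or_ne t 0 with rfl | ht0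
    · norm_num [Ym]
    · have hlog : Real.exp (-(-Real.log |t|)) = |t| := by rw [neg_neg, Real.exp_log (abs_pos.2 ht0)]
      have := tanh_w (-Real.log |t|)
      rw [hlog, sq_abs] at this
      rw [this]
      refine le_trans (Real.exp_pos _).le (Ym_ge _ ?_)
      have := Real.log_nonpos (abs_nonneg t) ht
      linarith
  have hd := halfdisc (Ffun f (p * n)) Wm
    ((hf.cont.mul hexpc.continuous.continuousOn).mul hpolc.continuous.continuousOn)
    ((hf.diff.mul hexpc.differentiableOn).mul hpolc.differentiableOn)
    Wm_diff (fun t ht => Ffun_real' f _ t ht (hf.real t ht)) Wm_circ hYpos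
  have hun : ∀ x, 0 ≤ u x := by intro x; rw [hu]; positivity
  -- outside
  have hout : ∫⁻ x in Set.Ioi (a * Real.cosh τ0), ENNReal.ofReal (u x + u (-x)) ≤
      ENNReal.ofReal (a / 2 * Real.exp (-(p * n * bet τ0 / 12))) *
      ∫⁻ x in Set.Iio (0:ℝ), ENNReal.ofReal ((‖Ffun f (p * n) (Real.exp x : ℝ)‖ * (Wm (Real.exp x : ℝ)).re +
        ‖Ffun f (p * n) ((-Real.exp x : ℝ))‖ * (Wm ((-Real.exp x : ℝ))).re) * Real.exp x) := by
    have himg : Set.Ioi (a * Real.cosh τ0) ⊆ (fun x => a * Real.cosh x) '' Set.Iio (-τ0) := by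
      intro X hX
      have hX : a * Real.cosh τ0 < X := hX
      have hXa : Real.cosh τ0 < X / a := by rw [lt_div_iff₀ ha0]; linarith
      have h1X : 1 ≤ X / a := (Real.one_le_cosh τ0).trans hXa.le
      refine ⟨-Real.arcosh (X / a), ?_, ?_⟩
      · rw [Set.mem_Iio, neg_lt_neg_iff]
        rw [← Real.cosh_arcosh h1X, Real.cosh_lt_cosh, abs_of_pos h0, abs_of_nonneg (Real.arcosh_nonneg h1X)] at hXa
        exact hXa
      · simp only [Real.cosh_neg, Real.cosh_arcosh h1X]
        field_simp
    refine (lintegral_mono_set himg).trans ?_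
    rw [lintegral_image_eq_lintegral_abs_deriv_mul (f' := fun x => a * Real.sinh x) measurableSet_Iio
      (fun x _ => ((Real.hasDerivAt_cosh x).const_mul a).hasDerivWithinAt)]
    · rw [← lintegral_const_mul' _ _ ENNReal.ofReal_ne_top]
      refine le_trans ?_ (lintegral_mono_set (Set.Iio_subset_Iio (by linarith : -τ0 ≤ 0)))
      apply setLIntegral_mono' measurableSet_Iio
      intro x hx
      have hx : x < -τ0 := hx
      rw [← ENNReal.ofReal_mul (abs_nonneg _), ← ENNReal.ofReal_mul (by positivity)]
      apply ENNReal.ofReal_le_ofReal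
      have hsx : Real.sinh x < 0 := Real.sinh_neg_iff.2 (by linarith)
      have hab : |a * Real.sinh x| = a * Real.sinh (-x) := by
        rw [abs_of_neg (mul_neg_of_pos_of_neg ha0 hsx), Real.sinh_neg]; ring
      have hW1 : (Wm (Real.exp x : ℝ)).re = Ym (Real.tanh (-x)) := by
        rw [Wm_real, ← tanh_w (-x), neg_neg]
      have hW2 : (Wm (-Real.exp x : ℝ)).re = Ym (Real.tanh (-x)) := by
        rw [Wm_real, ← tanh_w (-x), neg_neg, neg_sq]
      have p1 := caseI_pt q n p hn hp hq a ha _ hD f hf τ0 (-x) (Real.exp x) h0 (by linarith) (Or.inl (by simp)) (a * Real.cosh x)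
        (by rw [Real.cosh_eq, Real.exp_neg]; ring)
      have p2 := caseI_pt q n p hn hp hq a ha _ hD f hf τ0 (-x) (-Real.exp x) h0 (by linarith) (Or.inr (by simp)) (-(a * Real.cosh x))
        (by rw [Real.cosh_eq, Real.exp_neg, inv_neg]; ring)
      rw [neg_neg] at p1 p2
      rw [hab, hW1, hW2, hu]
      simp only
      have p12 := mul_le_mul_of_nonneg_left (add_le_add p1 p2) ha0.le
      refine le_trans (le_of_eq ?_) (p12.trans (le_of_eq ?_)) <;> ring
    · intro x hx y hy hxy
      have hx : x < -τ0 := hx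
      have hy : y < -τ0 := hy
      have hxy : a * Real.cosh x = a * Real.cosh y := hxy
      have := mul_left_cancel₀ ha0.ne' hxy
      rw [← Real.cosh_neg x, ← Real.cosh_neg y] at this
      have h2 := Real.cosh_injOn (Set.mem_Ici.2 (by linarith)) (Set.mem_Ici.2 (by linarith)) this
      linarith
  have hin : ENNReal.ofReal (a / 2) * ∫⁻ θ in Set.Ioo (0:ℝ) Real.pi, ENNReal.ofReal ‖Ffun f (p * n) (Complex.exp (θ * Complex.I))‖ ≤ ∫⁻ x in Set.Ioo (-a) a, ENNReal.ofReal (u x) := by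
    have himg : (fun θ => a * Real.cos θ) '' Set.Ioo 0 Real.pi ⊆ Set.Ioo (-a) a := by
      rintro _ ⟨θ, hθ, rfl⟩
      have hs := Real.sin_pos_of_mem_Ioo hθ
      have hsc := Real.sin_sq_add_cos_sq θ
      have : |Real.cos θ| < 1 := by
        rw [← sq_lt_one_iff_abs_lt_one]; nlinarith
      rw [abs_lt] at this
      constructor <;> nlinarith
    refine le_trans ?_ (lintegral_mono_set himg)
    rw [lintegral_image_eq_lintegral_abs_deriv_mul (f' := fun x => a * (-Real.sin x)) measurableSet_Ioo
      (fun x _ => ((Real.hasDerivAt_cos x).const_mul a).hasDerivWithinAt)]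
    · rw [← lintegral_const_mul' _ _ ENNReal.ofReal_ne_top]
      apply setLIntegral_mono' measurableSet_Ioo
      intro θ hθ
      rw [← ENNReal.ofReal_mul (abs_nonneg _), ← ENNReal.ofReal_mul (by positivity)]
      apply ENNReal.ofReal_le_ofReal
      have hs := Real.sin_pos_of_mem_Ioo hθ
      rw [Ffun_circ f _ θ hθ.1.le hθ.2.le, ← hf.circ θ, hu]
      have hev : ‖(q.map (algebraMap ℝ ℂ)).eval ((a * Real.cos θ : ℝ):ℂ)‖ = |q.eval (a * Real.cos θ)| := by
        rw [show ((a * Real.cos θ : ℝ):ℂ) = algebraMap ℝ ℂ (a * Real.cos θ) from rfl, Polynomial.eval_map_algebraMap, Polynomial.aeval_algebraMap_apply]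
        simp
      rw [hev, mul_neg, abs_neg, abs_of_pos (mul_pos ha0 hs)]
      beta_reduce
      have : -p * (a * Real.cos θ) ^ 2 / 2 = -(p * n) * Real.cos θ ^ 2 := by
        rw [mul_pow, ha]; ring
      rw [this]
      apply le_of_eq; ring
    · intro x hx y hy hxy
      have hxy : a * Real.cos x = a * Real.cos y := hxy
      have := mul_left_cancel₀ ha0.ne' hxy
      exact Real.injOn_cos ⟨hx.1.le, hx.2.le⟩ ⟨hy.1.le, hy.2.le⟩ this
  refine hout.trans ?_
  rw [mul_comm (a / 2), ENNReal.ofReal_mul (Real.exp_pos _).le, mul_assoc]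
  gcongr
  exact le_trans (by gcongr) hin

lemma caseII_pt (q : Polynomial ℝ) (n : ℝ) (hn : 0 < n) (hq : (q.natDegree : ℝ) ≤ n)
    (a : ℝ) (ha0 : 0 < a) (ha : a ^ 2 = 2 * n) (τ0 : ℝ) (h0 : 0 < τ0) (M : ℝ)
    (hM : ∀ y ∈ Set.Icc (-a) a, |q.eval y * Real.exp (-y ^ 2 / 2)| ≤ M) (y : ℝ) (hy : a * Real.cosh τ0 ≤ |y|) :
    |q.eval y * Real.exp (-y ^ 2 / 2)| ≤ Real.exp (-(n * bet τ0)) * M := by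
  obtain ⟨f, hf⟩ := GoodF.exists a 1 ha0 one_pos (q.map (algebraMap ℝ ℂ))
  have hD : (q.map (algebraMap ℝ ℂ)).natDegree = q.natDegree := Polynomial.natDegree_map _
  have hev : ∀ y : ℝ, ‖(q.map (algebraMap ℝ ℂ)).eval (y:ℂ)‖ = |q.eval y| := by
    intro y
    rw [show (y:ℂ) = algebraMap ℝ ℂ y from rfl, Polynomial.eval_map_algebraMap, Polynomial.aeval_algebraMap_apply]
    simp
  set G : ℂ → ℂ := fun w => f w * Complex.exp (-((n / 2 : ℝ) : ℂ) * (1 + w ^ 2)) with hG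
  have hexpc : Differentiable ℂ (fun w : ℂ => Complex.exp (-((n / 2 : ℝ) : ℂ) * (1 + w ^ 2))) := by fun_prop
  have hmax : ∀ w ∈ Metric.closedBall (0:ℂ) 1, ‖G w‖ ≤ M := by
    intro w hw
    apply Complex.norm_le_of_forall_mem_frontier_norm_le (U := Metric.ball (0:ℂ) 1) Metric.isBounded_ball
    · constructor
      · exact hf.diff.mul hexpc.differentiableOn
      · rw [closure_ball _ one_ne_zero]
        exact hf.cont.mul hexpc.continuous.continuousOn
    · intro z hz
      rw [frontier_ball _ one_ne_zero, mem_sphere_zero_iff_norm] at hz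
      have hz2 : z = Complex.exp (z.arg * Complex.I) := by
        have := Complex.norm_mul_exp_arg_mul_I z
        rw [hz] at this
        simpa using this.symm
      set θ := z.arg
      have h1 : ‖G z‖ = |q.eval (a * Real.cos θ) * Real.exp (-(a * Real.cos θ) ^ 2 / 2)| := by
        rw [abs_mul, abs_of_pos (Real.exp_pos _), ← hev, hG]
        have := hf.circ θ
        rw [Real.rpow_one] at this
        simp only
        rw [this, norm_mul, ← hz2, Complex.norm_exp]
        congr 2
        rw [hz2, Complex.exp_mul_I, ← Complex.ofReal_cos, ← Complex.ofReal_sin]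
        have hsc := Real.sin_sq_add_cos_sq θ
        rw [neg_div, mul_pow, ha]
        generalize Real.cos θ = C at *
        generalize Real.sin θ = S at *
        simp [pow_two]
        linear_combination (-n/2) * hsc
      rw [h1]
      apply hM
      have := Real.neg_one_le_cos θ
      have := Real.cos_le_one θ
      constructor <;> nlinarith
    · rw [closure_ball _ one_ne_zero]; exact hw
  have h1y : 1 ≤ |y| / a := by
    rw [le_div_iff₀ ha0]
    nlinarith [Real.one_le_cosh τ0]
  set τ := Real.arcosh (|y| / a) with hτ
  have hcτ : a * Real.cosh τ = |y| := by
    rw [hτ, Real.cosh_arcosh h1y]; field_simp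
  have hτ0 : 0 ≤ τ := Real.arcosh_nonneg h1y
  have hττ : τ0 ≤ τ := by
    have : Real.cosh τ0 ≤ Real.cosh τ := by
      rw [← hcτ] at hy
      exact le_of_mul_le_mul_left hy ha0
    rwa [Real.cosh_le_cosh, abs_of_pos h0, abs_of_nonneg hτ0] at this
  have hτp : 0 < τ := by linarith
  have hbm : bet τ0 ≤ bet τ := bet_mono h0.le hττ
  obtain ⟨t, ht, hyt⟩ : ∃ t : ℝ, (t = Real.exp (-τ) ∨ t = -Real.exp (-τ)) ∧ y = a * (t + t⁻¹) / 2 := by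
    rcases abs_cases y with ⟨h, _⟩ | ⟨h, _⟩
    · refine ⟨Real.exp (-τ), Or.inl rfl, ?_⟩
      rw [← h, ← hcτ, Real.cosh_eq, ← Real.exp_neg, neg_neg]; ring
    · refine ⟨-Real.exp (-τ), Or.inr rfl, ?_⟩
      have : y = -|y| := by linarith
      rw [this, ← hcτ, Real.cosh_eq, inv_neg, ← Real.exp_neg, neg_neg]; ring
  have hta : |t| = Real.exp (-τ) := by
    rcases ht with rfl | rfl
    · rw [abs_of_pos (Real.exp_pos _)]
    · rw [abs_neg, abs_of_pos (Real.exp_pos _)]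
  have ht1 : |t| < 1 := by rw [hta]; simpa using hτp
  have ht0 : t ≠ 0 := by rw [← abs_pos, hta]; exact Real.exp_pos _
  have ht2 : t ^ 2 = Real.exp (-τ) ^ 2 := by rw [← sq_abs, hta]
  have hinv : Real.exp τ * Real.exp (-τ) = 1 := by rw [← Real.exp_add]; simp
  have hb := hf.bound t ht0 ht1
  rw [← hyt, hev, hD, hta, Real.rpow_one, ← Real.rpow_natCast, ← Real.exp_mul] at hb
  have hG2 := hmax t (by rw [mem_closedBall_zero_iff, Complex.norm_real]; exact ht1.le)
  have hGt : ‖G t‖ = ‖f t‖ * Real.exp (-(n / 2) * (1 + t ^ 2)) := by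
    simp only [hG]
    have e2 : -((n / 2 : ℝ) : ℂ) * (1 + (t:ℂ) ^ 2) = ((-(n / 2) * (1 + t ^ 2) : ℝ) : ℂ) := by push_cast; ring
    rw [norm_mul, e2, ← Complex.ofReal_exp, Complex.norm_real, Real.norm_of_nonneg (Real.exp_pos _).le]
  rw [hGt] at hG2
  have hch : Real.cosh τ = (Real.exp τ + Real.exp (-τ)) / 2 := Real.cosh_eq τ
  have hsh : Real.sinh τ = (Real.exp τ - Real.exp (-τ)) / 2 := Real.sinh_eq τ
  have hy2 : y ^ 2 = 2 * n * Real.cosh τ ^ 2 := by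
    rw [← sq_abs, ← hcτ, mul_pow, ha]
  have h2t : 1 + t ^ 2 = 2 * (Real.cosh τ ^ 2 - Real.sinh τ * Real.cosh τ) := by
    rw [ht2, hsh, hch]; linear_combination -hinv
  have hM0 : 0 ≤ M := le_trans (by positivity) hG2
  set D : ℝ := (q.natDegree : ℝ) with hDdef
  rw [abs_mul, abs_of_pos (Real.exp_pos _)]
  have hexp : Real.exp (-y ^ 2 / 2) ≤ Real.exp (-τ * D) * Real.exp (-(n / 2) * (1 + t ^ 2)) * Real.exp (-(n * bet τ0)) := by
    rw [← Real.exp_add, ← Real.exp_add, Real.exp_le_exp, hy2, h2t]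
    have hbd : Real.sinh τ * Real.cosh τ = bet τ + τ := by unfold bet; ring
    rw [hbd]
    have i1 : D * τ ≤ n * τ := mul_le_mul_of_nonneg_right hq hτ0
    have i2 : n * bet τ0 ≤ n * bet τ := mul_le_mul_of_nonneg_left hbm (by linarith)
    ring_nf at *
    linarith
  calc |q.eval y| * Real.exp (-y ^ 2 / 2) ≤ |q.eval y| * (Real.exp (-τ * D) * Real.exp (-(n / 2) * (1 + t ^ 2)) * Real.exp (-(n * bet τ0))) := by gcongr
    _ = (|q.eval y| * Real.exp (-τ * D)) * Real.exp (-(n / 2) * (1 + t ^ 2)) * Real.exp (-(n * bet τ0)) := by ring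
    _ ≤ ‖f t‖ * Real.exp (-(n / 2) * (1 + t ^ 2)) * Real.exp (-(n * bet τ0)) := by gcongr
    _ ≤ M * Real.exp (-(n * bet τ0)) := by gcongr
    _ = _ := by ring

lemma caseII (q : Polynomial ℝ) (n : ℝ) (hn : 0 < n) (hq : (q.natDegree : ℝ) ≤ n)
    (a : ℝ) (ha0 : 0 < a) (ha : a ^ 2 = 2 * n) (τ0 : ℝ) (h0 : 0 < τ0) (A : ℝ) (hA : A = a * Real.cosh τ0)
    (P : ℝ → ℝ) (hP : P = fun x => q.eval x * Real.exp (-x ^ 2 / 2)) :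
    eLpNorm P ∞ (volume.restrict (Set.Icc (-A) A)ᶜ) ≤ ENNReal.ofReal (Real.exp (-(n * bet τ0))) *
      eLpNorm P ∞ (volume.restrict (Set.Icc (-A) A)) := by
  have hPc : Continuous P := by rw [hP]; fun_prop
  have haA : a < A := by
    rw [hA]; nlinarith [Real.one_lt_cosh.2 h0.ne']
  -- sup over Ioo bounded by essSup
  set E := eLpNorm P ∞ (volume.restrict (Set.Icc (-A) A)) with hE
  rcases eq_or_ne E ∞ with hEt | hEt
  · rw [hEt, ENNReal.mul_top]
    · exact le_top
    · simp [Real.exp_pos]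
  have hpt : ∀ y ∈ Set.Ioo (-A) A, |P y| ≤ E.toReal := by
    by_contra hcon
    push Not at hcon
    obtain ⟨y, hy, hlt⟩ := hcon
    have hopen : IsOpen ({x | E.toReal < |P x|} ∩ Set.Ioo (-A) A) :=
      (isOpen_lt continuous_const hPc.abs).inter isOpen_Ioo
    have hpos := hopen.measure_pos volume ⟨y, hlt, hy⟩
    have hae : ∀ᵐ x ∂(volume.restrict (Set.Icc (-A) A)), ‖P x‖ₑ ≤ E := by
      rw [hE, eLpNorm_exponent_top]
      exact ae_le_eLpNormEssSup
    rw [ae_restrict_iff' measurableSet_Icc] at hae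
    refine hpos.ne' (measure_mono_null ?_ hae)
    intro x hx
    simp only [Set.mem_compl_iff, Set.mem_setOf_eq, not_forall]
    refine ⟨Set.Ioo_subset_Icc_self hx.2, ?_⟩
    intro hle
    have := ENNReal.toReal_mono hEt hle
    rw [toReal_enorm, Real.norm_eq_abs] at this
    exact absurd hx.1 (not_lt.2 this)
  rw [eLpNorm_exponent_top]
  apply eLpNormEssSup_le_of_ae_enorm_bound
  rw [ae_restrict_iff' measurableSet_Icc.compl]
  refine Eventually.of_forall fun y hy => ?_
  have hyA : A ≤ |y| := by
    by_contra h
    push Not at h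
    rw [abs_lt] at h
    exact hy ⟨h.1.le, h.2.le⟩
  have := caseII_pt q n hn hq a ha0 ha τ0 h0 E.toReal (fun y hy => by
    have := hpt y ⟨by linarith [hy.1], by linarith [hy.2]⟩
    rwa [hP] at this) y (hA ▸ hyA)
  have h2 : |P y| ≤ Real.exp (-(n * bet τ0)) * E.toReal := by rw [hP]; exact this
  rw [← ofReal_norm_eq_enorm, Real.norm_eq_abs]
  refine (ENNReal.ofReal_le_ofReal h2).trans ?_
  rw [ENNReal.ofReal_mul (Real.exp_pos _).le, ENNReal.ofReal_toReal hEt]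

noncomputable def gg (x : ℝ) : ℝ := x * Real.exp (-x ^ 2 / 2)

lemma gg_mono {x y : ℝ} (h0 : 0 ≤ x) (h : x ≤ y) (h1 : y ≤ 1) : gg x ≤ gg y := by
  unfold gg
  have e : Real.exp (-y ^ 2 / 2) = Real.exp (-x ^ 2 / 2) * Real.exp (-(y ^ 2 - x ^ 2) / 2) := by
    rw [← Real.exp_add]; congr 1; ring
  have h2 := Real.add_one_le_exp (-(y ^ 2 - x ^ 2) / 2)
  have h3 : x ≤ y * Real.exp (-(y ^ 2 - x ^ 2) / 2) := by
    refine le_trans ?_ (mul_le_mul_of_nonneg_left h2 (h0.trans h))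
    have : 0 ≤ (y - x) * (1 - y * (y + x) / 2) := mul_nonneg (by linarith) (by nlinarith)
    linarith
  rw [e]
  nlinarith [mul_le_mul_of_nonneg_left h3 (Real.exp_pos (-x ^ 2 / 2)).le]

lemma gg_anti {x y : ℝ} (h0 : 1 ≤ x) (h : x ≤ y) : gg y ≤ gg x := by
  unfold gg
  have e : Real.exp (-x ^ 2 / 2) = Real.exp (-y ^ 2 / 2) * Real.exp ((y ^ 2 - x ^ 2) / 2) := by
    rw [← Real.exp_add]; congr 1; ring
  have h2 := Real.add_one_le_exp ((y ^ 2 - x ^ 2) / 2)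
  have h3 : y ≤ x * Real.exp ((y ^ 2 - x ^ 2) / 2) := by
    refine le_trans ?_ (mul_le_mul_of_nonneg_left h2 (by linarith))
    have : 0 ≤ (y - x) * (x * (y + x) / 2 - 1) := mul_nonneg (by linarith) (by nlinarith)
    linarith
  rw [e]
  nlinarith [mul_le_mul_of_nonneg_left h3 (Real.exp_pos (-y ^ 2 / 2)).le]

lemma gg_deriv (x : ℝ) : HasDerivAt (fun x : ℝ => -Real.exp (-x ^ 2 / 2)) (gg x) x := by
  have h := ((((hasDerivAt_id' x).fun_pow 2).fun_neg.div_const 2).exp).fun_neg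
  refine h.congr_deriv ?_
  unfold gg
  simp
  ring

lemma gg_int_out : ∫⁻ x in Set.Ioi (Real.sqrt 2), ENNReal.ofReal (gg x) = ENNReal.ofReal (Real.exp (-1)) := by
  have hs : 0 < Real.sqrt 2 := by positivity
  have ht : Tendsto (fun x : ℝ => -Real.exp (-x ^ 2 / 2)) atTop (nhds 0) := by
    have h1 : Tendsto (fun x : ℝ => x ^ 2 / 2) atTop atTop :=
      (tendsto_pow_atTop two_ne_zero).atTop_div_const (by norm_num)
    have := (Real.tendsto_exp_neg_atTop_nhds_zero.comp h1).neg
    simp only [neg_zero] at this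
    refine this.congr fun x => ?_
    simp [neg_div]
  have hpos : ∀ x ∈ Set.Ioi (Real.sqrt 2), 0 ≤ gg x := fun x hx => by
    have : 0 < x := hs.trans hx
    unfold gg; positivity
  have hi := integrableOn_Ioi_deriv_of_nonneg' (fun x _ => gg_deriv x) hpos ht
  have hI := integral_Ioi_of_hasDerivAt_of_nonneg' (fun x _ => gg_deriv x) hpos ht
  rw [← ofReal_integral_eq_lintegral_ofReal hi, hI]
  · congr 1
    rw [Real.sq_sqrt (by norm_num)]
    norm_num
  · rw [EventuallyLE, ae_restrict_iff' measurableSet_Ioi]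
    exact Eventually.of_forall hpos

lemma gg_int_in : ENNReal.ofReal (38/100) ≤ ∫⁻ x in Set.Ioo (68/100 : ℝ) (135/100), ENNReal.ofReal (gg x) := by
  have hc : Continuous gg := by unfold gg; fun_prop
  have hI := intervalIntegral.integral_eq_sub_of_hasDerivAt (a := 68/100) (b := 135/100) (fun x _ => gg_deriv x) (hc.intervalIntegrable _ _)
  have hii : IntervalIntegrable gg volume (68/100) (135/100) := hc.intervalIntegrable _ _
  rw [intervalIntegrable_iff_integrableOn_Ioo_of_le (by norm_num)] at hii
  rw [intervalIntegral.integral_of_le (by norm_num), integral_Ioc_eq_integral_Ioo] at hI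
  rw [← ofReal_integral_eq_lintegral_ofReal hii, hI]
  · apply ENNReal.ofReal_le_ofReal
    have b1 := Real.exp_bound (x := -(68/100:ℝ)^2/2) (n := 4) (by norm_num [abs_le]) (by norm_num)
    have b2 := Real.exp_bound (x := -(135/100:ℝ)^2/2) (n := 7) (by norm_num [abs_le]) (by norm_num)
    rw [abs_le] at b1 b2
    have b1 := b1.1
    have b2 := b2.2
    norm_num [Finset.sum_range_succ, Nat.factorial, abs_of_neg, abs_of_pos] at b1 b2 ⊢
    linarith
  · rw [EventuallyLE, ae_restrict_iff' measurableSet_Ioo]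
    refine Eventually.of_forall fun x hx => ?_
    have : 0 < x := by linarith [hx.1]
    simp only [Pi.zero_apply]
    unfold gg; positivity

lemma gg_low {x : ℝ} (h1 : 68/100 ≤ x) (h2 : x ≤ 135/100) : 538/1000 ≤ gg x := by
  rcases le_total x 1 with h | h
  · refine le_trans ?_ (gg_mono (by norm_num) h1 h)
    unfold gg
    have b1 := Real.exp_bound (x := -(68/100:ℝ)^2/2) (n := 5) (by norm_num [abs_le]) (by norm_num)
    rw [abs_le] at b1
    have b1 := b1.1
    norm_num [Finset.sum_range_succ, Nat.factorial, abs_of_neg, abs_of_pos] at b1 ⊢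
    linarith
  · refine le_trans ?_ (gg_anti h h2)
    unfold gg
    have b1 := Real.exp_bound (x := -(135/100:ℝ)^2/2) (n := 7) (by norm_num [abs_le]) (by norm_num)
    rw [abs_le] at b1
    have b1 := b1.1
    norm_num [Finset.sum_range_succ, Nat.factorial, abs_of_neg, abs_of_pos] at b1 ⊢
    linarith

lemma gg_up {x : ℝ} (h1 : Real.sqrt 2 ≤ x) : gg x ≤ 521/1000 := by
  have h2 : Real.sqrt 2 < 1.4143 := by rw [Real.sqrt_lt' (by norm_num)]; norm_num
  have h3 : 1 ≤ Real.sqrt 2 := by rw [Real.one_le_sqrt]; norm_num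
  refine (gg_anti h3 h1).trans ?_
  unfold gg
  rw [Real.sq_sqrt (by norm_num)]
  have h4 : Real.exp (-2/2) = (Real.exp 1)⁻¹ := by rw [← Real.exp_neg]; norm_num
  rw [h4, ← div_eq_mul_inv, div_le_iff₀ (Real.exp_pos _)]
  have := Real.exp_one_gt_d9
  linarith

lemma conv_abs (p : ℝ) (hp : 1 ≤ p) (l x y : ℝ) (h0 : 0 ≤ l) (h1 : l ≤ 1) :
    |(1 + l) / 2 * x + (1 - l) / 2 * y| ^ p ≤ (1 + l) / 2 * |x| ^ p + (1 - l) / 2 * |y| ^ p := by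
  have hc := (convexOn_rpow hp).2 (Set.mem_Ici.2 (abs_nonneg x)) (Set.mem_Ici.2 (abs_nonneg y))
    (by linarith : 0 ≤ (1 + l) / 2) (by linarith : 0 ≤ (1 - l) / 2) (by ring)
  refine le_trans (Real.rpow_le_rpow (abs_nonneg _) ?_ (by linarith)) hc
  refine (abs_add_le _ _).trans (le_of_eq ?_)
  rw [abs_mul, abs_mul, abs_of_nonneg (by linarith : 0 ≤ (1 + l) / 2), abs_of_nonneg (by linarith : 0 ≤ (1 - l) / 2)]
  rfl

lemma N_ratio (p : ℝ) (hp : 1 ≤ p) (α β x y : ℝ) (hy : 0 < y) (hxy : y ≤ x) :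
    (|α * x + β| ^ p + |α * (-x) + β| ^ p) * y ^ p ≤ (|α * y + β| ^ p + |α * (-y) + β| ^ p) * x ^ p := by
  have hx : 0 < x := hy.trans_le hxy
  set l := y / x with hl
  have hl0 : 0 ≤ l := by positivity
  have hl1 : l ≤ 1 := by rw [hl, div_le_one hx]; exact hxy
  have hlx : l * x = y := by rw [hl]; field_simp
  have c1 := conv_abs p hp l (α * y + β) (α * y - β) hl0 hl1
  have c2 := conv_abs p hp l (α * (-y) + β) (-(α * y) - β) hl0 hl1
  have e1 : |α * x + β| ^ p * y ^ p = |(1 + l) / 2 * (α * y + β) + (1 - l) / 2 * (α * y - β)| ^ p * x ^ p := by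
    rw [← Real.mul_rpow (abs_nonneg _) hy.le, ← Real.mul_rpow (abs_nonneg _) hx.le]
    congr 1
    rw [← abs_of_pos hy, ← abs_of_pos hx, ← abs_mul, ← abs_mul, abs_of_pos hy, abs_of_pos hx]
    congr 1
    linear_combination (-β) * hlx
  have e2 : |α * (-x) + β| ^ p * y ^ p = |(1 + l) / 2 * (α * (-y) + β) + (1 - l) / 2 * (-(α * y) - β)| ^ p * x ^ p := by
    rw [← Real.mul_rpow (abs_nonneg _) hy.le, ← Real.mul_rpow (abs_nonneg _) hx.le]
    congr 1
    rw [← abs_of_pos hy, ← abs_of_pos hx, ← abs_mul, ← abs_mul, abs_of_pos hy, abs_of_pos hx]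
    congr 1
    linear_combination (-β) * hlx
  have a1 : |α * y - β| = |α * (-y) + β| := by rw [← abs_neg]; congr 1; ring
  have a2 : |-(α * y) - β| = |α * y + β| := by rw [← abs_neg]; congr 1; ring
  rw [a1] at c1
  rw [a2] at c2
  rw [add_mul, e1, e2, ← add_mul]
  gcongr ?_ * _
  linarith

lemma caseIII (p : ℝ) (hp : 1 ≤ p) (α β : ℝ) (A : ℝ) (hA : Real.sqrt 2 ≤ A) (u : ℝ → ℝ)
    (hu : u = fun x => |α * x + β| ^ p * Real.exp (-p * x ^ 2 / 2)) :
    ∫⁻ x in Set.Ioi A, ENNReal.ofReal (u x + u (-x)) ≤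
      ENNReal.ofReal (Real.exp (-(3/100 * p))) * ∫⁻ x in Set.Ioo 0 A, ENNReal.ofReal (u x + u (-x)) := by
  have hs2 : 0 < Real.sqrt 2 := by positivity
  have h135 : (135/100 : ℝ) < Real.sqrt 2 := by apply Real.lt_sqrt_of_sq_lt; norm_num
  have hgpos : ∀ x : ℝ, 0 < x → 0 < gg x := fun x hx => by unfold gg; positivity
  have hgp : ∀ x : ℝ, 0 < x → gg x ^ p = x ^ p * Real.exp (-p * x ^ 2 / 2) := by
    intro x hx
    unfold gg
    rw [Real.mul_rpow hx.le (Real.exp_pos _).le, ← Real.exp_mul]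
    congr 2; ring
  have hS : ∀ x y : ℝ, 0 < y → y ≤ x → (u x + u (-x)) * gg y ^ p ≤ (u y + u (-y)) * gg x ^ p := by
    intro x y hy hxy
    rw [hgp y hy, hgp x (hy.trans_le hxy), hu]
    simp only [neg_sq]
    have := mul_le_mul_of_nonneg_right (N_ratio p hp α β x y hy hxy)
      (by positivity : 0 ≤ Real.exp (-p * x ^ 2 / 2) * Real.exp (-p * y ^ 2 / 2))
    refine le_trans (le_of_eq ?_) (this.trans (le_of_eq ?_)) <;> ring
  set G := gg (Real.sqrt 2) with hG
  have hG0 : 0 < G := hgpos _ hs2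
  have hGp : 0 < G ^ p := Real.rpow_pos_of_pos hG0 _
  have hun : ∀ x, 0 ≤ u x := by intro x; rw [hu]; positivity
  set K := (u (Real.sqrt 2) + u (-Real.sqrt 2)) / G ^ p with hK
  have hK0 : 0 ≤ K := div_nonneg (add_nonneg (hun _) (hun _)) hGp.le
  have hsplit : ∀ x : ℝ, 0 < x → gg x ^ p = gg x ^ (p - 1) * gg x := by
    intro x hx
    rw [← Real.rpow_add_one (hgpos x hx).ne']; congr 1; ring
  have hout : ∫⁻ x in Set.Ioi A, ENNReal.ofReal (u x + u (-x)) ≤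
      ENNReal.ofReal (K * (521/1000) ^ (p - 1)) * ENNReal.ofReal (Real.exp (-1)) := by
    refine (lintegral_mono_set (Set.Ioi_subset_Ioi hA)).trans ?_
    rw [← gg_int_out, ← lintegral_const_mul' _ _ ENNReal.ofReal_ne_top]
    apply setLIntegral_mono' measurableSet_Ioi
    intro x hx
    have hx : Real.sqrt 2 < x := hx
    have hx0 : 0 < x := hs2.trans hx
    rw [← ENNReal.ofReal_mul (by positivity)]
    apply ENNReal.ofReal_le_ofReal
    have h1 := hS x _ hs2 hx.le
    rw [← le_div_iff₀ hGp, mul_div_right_comm] at h1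
    refine h1.trans ?_
    rw [hsplit x hx0, ← mul_assoc]
    have := hgpos x hx0
    gcongr
    exact gg_up hx.le
  have hin : ENNReal.ofReal (K * (538/1000) ^ (p - 1)) * ENNReal.ofReal (38/100) ≤
      ∫⁻ x in Set.Ioo 0 A, ENNReal.ofReal (u x + u (-x)) := by
    refine le_trans (mul_le_mul_right gg_int_in _) ?_
    refine le_trans ?_ (lintegral_mono_set (Set.Ioo_subset_Ioo (by norm_num : (0:ℝ) ≤ 68/100) (h135.le.trans hA)))
    rw [← lintegral_const_mul' _ _ ENNReal.ofReal_ne_top]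
    apply setLIntegral_mono' measurableSet_Ioo
    intro x hx
    have hx0 : 0 < x := by linarith [hx.1]
    rw [← ENNReal.ofReal_mul (by positivity)]
    apply ENNReal.ofReal_le_ofReal
    have h1 := hS (Real.sqrt 2) x hx0 (by linarith [hx.2])
    rw [← div_le_iff₀ hGp, mul_div_right_comm] at h1
    refine le_trans ?_ h1
    rw [hsplit x hx0, ← mul_assoc]
    have := hgpos x hx0
    gcongr
    exact gg_low hx.1.le hx.2.le
  refine hout.trans (le_trans ?_ (mul_le_mul_right hin _))
  rw [← ENNReal.ofReal_mul (by positivity), ← ENNReal.ofReal_mul (by positivity), ← ENNReal.ofReal_mul (by positivity)]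
  apply ENNReal.ofReal_le_ofReal
  have e3 : (97/100 : ℝ) ≤ Real.exp (-(3/100)) := by
    have := Real.add_one_le_exp (-(3/100) : ℝ)
    linarith
  have e4 : Real.exp (-(3/100 * p)) = Real.exp (-(3/100)) ^ (p - 1) * Real.exp (-(3/100)) := by
    rw [← Real.exp_mul, ← Real.exp_add]; congr 1; ring
  have e5 : Real.exp (-1) ≤ 97/100 * (38/100) := by
    have := Real.exp_one_gt_d9
    rw [Real.exp_neg, inv_le_comm₀ (Real.exp_pos _) (by norm_num)]
    norm_num
    linarith
  have e6 : (521/1000 : ℝ) ^ (p - 1) ≤ Real.exp (-(3/100)) ^ (p - 1) * (538/1000) ^ (p - 1) := by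
    rw [← Real.mul_rpow (Real.exp_pos _).le (by norm_num)]
    apply Real.rpow_le_rpow (by norm_num) (by linarith) (by linarith)
  rw [e4]
  calc K * (521 / 1000) ^ (p - 1) * Real.exp (-1)
      ≤ K * (Real.exp (-(3/100)) ^ (p - 1) * (538/1000) ^ (p - 1)) * (Real.exp (-(3/100)) * (38/100)) := by
        gcongr
        linarith
    _ = _ := by ring

lemma refl_lint (s : Set ℝ) (hs : MeasurableSet s) (v : ℝ → ℝ≥0∞) :
    ∫⁻ x in (fun x => -x) '' s, v x = ∫⁻ x in s, v (-x) := by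
  rw [lintegral_image_eq_lintegral_abs_deriv_mul (f' := fun _ => -1) hs
    (fun x _ => (hasDerivAt_neg' x).hasDerivWithinAt) neg_injective.injOn]
  simp

lemma out_split (A : ℝ) (u : ℝ → ℝ) (hu : ∀ x, 0 ≤ u x) (hm : Measurable u) :
    ∫⁻ x in (Set.Icc (-A) A)ᶜ, ENNReal.ofReal (u x) ≤ ∫⁻ x in Set.Ioi A, ENNReal.ofReal (u x + u (-x)) := by
  have h1 : (Set.Icc (-A) A)ᶜ ⊆ Set.Ioi A ∪ (fun x => -x) '' Set.Ioi A := by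
    intro x hx
    by_cases h : A < x
    · exact Or.inl h
    · refine Or.inr ⟨-x, ?_, by simp⟩
      by_contra h2
      simp only [Set.mem_Ioi, not_lt] at h h2
      exact hx ⟨by linarith, h⟩
  refine (lintegral_mono_set h1).trans ((lintegral_union_le _ _ _).trans ?_)
  rw [refl_lint _ measurableSet_Ioi, ← lintegral_add_left (by fun_prop)]
  apply le_of_eq
  apply lintegral_congr
  intro x
  rw [ENNReal.ofReal_add (hu _) (hu _)]

lemma in_split (A : ℝ) (u : ℝ → ℝ) (hu : ∀ x, 0 ≤ u x) (hm : Measurable u) :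
    ∫⁻ x in Set.Ioo 0 A, ENNReal.ofReal (u x + u (-x)) ≤ ∫⁻ x in Set.Icc (-A) A, ENNReal.ofReal (u x) := by
  have h1 : Set.Ioo 0 A ∪ (fun x => -x) '' Set.Ioo 0 A ⊆ Set.Icc (-A) A := by
    rintro x (hx | ⟨y, hy, rfl⟩)
    · exact ⟨by linarith [hx.1, hx.2], hx.2.le⟩
    · exact ⟨by linarith [hy.1, hy.2], by linarith [hy.1, hy.2]⟩
  refine le_trans ?_ (lintegral_mono_set h1)
  rw [lintegral_union, refl_lint _ measurableSet_Ioo, ← lintegral_add_left (by fun_prop)]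
  · apply le_of_eq
    apply lintegral_congr
    intro x
    rw [ENNReal.ofReal_add (hu _) (hu _)]
  · rw [Set.image_neg_eq_neg]
    exact measurableSet_Ioo.neg
  · rw [Set.disjoint_left]
    rintro x hx ⟨y, hy, rfl⟩
    have h1 := hx.1
    have h2 := hy.1
    simp only at h1
    linarith

lemma case_fin (δ : ℝ) (hδ : 0 < δ) (τ0 : ℝ) (h0 : 0 < τ0) (hτ : Real.cosh τ0 = 1 + δ) (n : ℝ)
    (q : Polynomial ℝ) (hq : (q.natDegree : ℝ) + 1 ≤ n) (p : ℝ) (hp : 1 ≤ p) (c : ℝ) (hc1 : c ≤ bet τ0 / 12)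
    (hc2 : c ≤ 1/100) (hc0 : 0 < c) (A : ℝ) (hA : A = Real.sqrt (2 * n) * (1 + δ)) (u : ℝ → ℝ)
    (hu : u = fun x => |q.eval x| ^ p * Real.exp (-p * x ^ 2 / 2)) :
    ∫⁻ x in (Set.Icc (-A) A)ᶜ, ENNReal.ofReal (u x) ≤
      ENNReal.ofReal (Real.exp (-c * n * p)) * ∫⁻ x in Set.Icc (-A) A, ENNReal.ofReal (u x) := by
  have hD0 : (0:ℝ) ≤ q.natDegree := Nat.cast_nonneg _
  have hn1 : 1 ≤ n := by linarith
  have hun : ∀ x, 0 ≤ u x := by intro x; rw [hu]; positivity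
  have hm : Measurable u := by
    have : Continuous u := by
      rw [hu]
      apply Continuous.mul
      · exact (q.continuous.abs).rpow_const fun _ => Or.inr (by linarith)
      · fun_prop
    exact this.measurable
  refine (out_split A u hun hm).trans ?_
  have ha0 : 0 < Real.sqrt (2 * n) := by positivity
  by_cases hn3 : 3 ≤ n
  · have h := caseI q n p hn3 hp hq (Real.sqrt (2 * n)) ha0 (Real.sq_sqrt (by positivity)) τ0 h0 u hu
    rw [hτ, ← hA] at h
    refine h.trans ?_
    have haA : Real.sqrt (2 * n) ≤ A := by rw [hA]; nlinarith
    gcongr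
    · have : c * (n * p) ≤ bet τ0 / 12 * (n * p) := mul_le_mul_of_nonneg_right hc1 (by positivity)
      linarith
    · intro x hx
      exact ⟨by linarith [hx.1], by linarith [hx.2]⟩
  · push Not at hn3
    have hd1 : q.natDegree ≤ 1 := by
      have : (q.natDegree : ℝ) < 2 := by linarith
      have : q.natDegree < 2 := by exact_mod_cast this
      omega
    have hqe : ∀ x, q.eval x = q.coeff 1 * x + q.coeff 0 := by
      intro x
      conv_lhs => rw [Polynomial.eq_X_add_C_of_natDegree_le_one hd1]
      simp
    have hA2 : Real.sqrt 2 ≤ A := by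
      rw [hA]
      have : Real.sqrt 2 ≤ Real.sqrt (2 * n) := Real.sqrt_le_sqrt (by linarith)
      nlinarith
    have h := caseIII p hp (q.coeff 1) (q.coeff 0) A hA2 u (by rw [hu]; funext x; rw [hqe])
    refine h.trans ?_
    refine mul_le_mul' ?_ (in_split A u hun hm)
    apply ENNReal.ofReal_le_ofReal
    apply Real.exp_le_exp.2
    have : c * n ≤ 3/100 := by nlinarith
    nlinarith

theorem stmt0 (δ : ℝ) (hδ : 0 < δ) :
    ∃ c : ℝ, 0 < c ∧ ∀ (n : ℝ), 0 < n → ∀ (p : ℝ≥0∞), 1 ≤ p → ∀ P : ℝ → ℝ, P ∈ PiH ⌊n⌋₊ →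
      eLpNorm P p (volume.restrict ((Set.Icc (-(Real.sqrt (2 * n) * (1 + δ))) (Real.sqrt (2 * n) * (1 + δ)))ᶜ)) ≤
        ENNReal.ofReal (Real.exp (-c * n)) *
          eLpNorm P p (volume.restrict (Set.Icc (-(Real.sqrt (2 * n) * (1 + δ))) (Real.sqrt (2 * n) * (1 + δ)))) := by
  have hτ : Real.cosh (Real.arcosh (1 + δ)) = 1 + δ := Real.cosh_arcosh (by linarith)
  have h0 : 0 < Real.arcosh (1 + δ) := Real.arcosh_pos (by linarith)
  set τ0 := Real.arcosh (1 + δ)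
  have hb := bet_pos h0
  refine ⟨min (bet τ0 / 12) (1/100), by positivity, ?_⟩
  intro n hn p hp P hP
  obtain ⟨q, hq, hPq⟩ := PiH_poly _ P hP
  by_cases hq0 : q = 0
  · have : P = 0 := by rw [hPq, hq0]; funext x; simp
    rw [this]; simp
  have hdeg : q.natDegree < ⌊n⌋₊ := by
    rw [Polynomial.mem_degreeLT] at hq
    exact (Polynomial.natDegree_lt_iff_degree_lt hq0).2 hq
  have hqn : (q.natDegree : ℝ) + 1 ≤ n := by
    have h1 : ((q.natDegree + 1 : ℕ) : ℝ) ≤ (⌊n⌋₊ : ℝ) := by exact_mod_cast hdeg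
    push_cast at h1
    exact h1.trans (Nat.floor_le hn.le)
  set c := min (bet τ0 / 12) (1/100) with hc
  have hc0 : 0 < c := by rw [hc]; positivity
  have hc1 : c ≤ bet τ0 / 12 := min_le_left _ _
  have hc2 : c ≤ 1/100 := min_le_right _ _
  set A := Real.sqrt (2 * n) * (1 + δ) with hA
  rcases eq_or_ne p ∞ with rfl | hpt
  · have := caseII q n hn (by linarith) (Real.sqrt (2 * n)) (by positivity) (Real.sq_sqrt (by positivity)) τ0 h0 A
      (by rw [hτ]) P hPq
    refine this.trans ?_
    gcongr
    have : c * n ≤ bet τ0 * n := mul_le_mul_of_nonneg_right (by linarith) hn.le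
    linarith
  · have hp0 : p ≠ 0 := by rintro rfl; simp at hp
    have hpr : 1 ≤ p.toReal := by
      have := ENNReal.toReal_mono hpt hp
      simpa using this
    have hmain := case_fin δ hδ τ0 h0 hτ n q hqn p.toReal hpr c hc1 hc2 hc0 A hA _ rfl
    have hrw : ∀ x, ‖P x‖ₑ ^ p.toReal = ENNReal.ofReal (|q.eval x| ^ p.toReal * Real.exp (-p.toReal * x ^ 2 / 2)) := by
      intro x
      rw [← ofReal_norm, Real.norm_eq_abs, ENNReal.ofReal_rpow_of_nonneg (abs_nonneg _) (by linarith), hPq]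
      congr 1
      beta_reduce
      rw [abs_mul, abs_of_pos (Real.exp_pos _), Real.mul_rpow (abs_nonneg _) (Real.exp_pos _).le, ← Real.exp_mul]
      congr 2
      ring
    rw [eLpNorm_eq_lintegral_rpow_enorm_toReal hp0 hpt, eLpNorm_eq_lintegral_rpow_enorm_toReal hp0 hpt]
    simp_rw [hrw]
    refine (ENNReal.rpow_le_rpow hmain (by positivity)).trans ?_
    rw [ENNReal.mul_rpow_of_nonneg _ _ (by positivity)]
    apply le_of_eq
    congr 1
    rw [ENNReal.ofReal_rpow_of_nonneg (Real.exp_pos _).le (by positivity), ← Real.exp_mul]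
    congr 2
    field_simp
end

section
/- There exist constants c₁, c₂ > 0 such that for every integer n ≥ 1, every 1 ≤ p ≤ ∞, and every weighted polynomial P ∈ Π_n, one has c₁ ‖P‖_{p,[−2√n, 2√n]} ≤ ‖P‖_p ≤ c₂ ‖P‖_{p,[−2√n, 2√n]}. -/
open MeasureTheory Filter ENNReal ProbabilityTheory

lemma aux_U0 (x : ℝ) (hx : 1 ≤ x) (m : ℕ) :
    0 ≤ (Polynomial.Chebyshev.U ℝ m).eval x ∧
    (Polynomial.Chebyshev.U ℝ m).eval x ≤ (Polynomial.Chebyshev.U ℝ (m + 1 : ℕ)).eval x := by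
  induction m with
  | zero => simp; linarith
  | succ m ih =>
    obtain ⟨h0, h1⟩ := ih
    have h3 : (Polynomial.Chebyshev.U ℝ (m + 1 + 1 : ℕ)).eval x =
        2 * x * (Polynomial.Chebyshev.U ℝ (m + 1 : ℕ)).eval x
          - (Polynomial.Chebyshev.U ℝ m).eval x := by
      have := Polynomial.Chebyshev.U_add_two ℝ (m : ℤ)
      have e : ((m + 1 + 1 : ℕ) : ℤ) = (m : ℤ) + 2 := by push_cast; ring
      rw [e, this]
      simp
    refine ⟨h0.trans h1, ?_⟩
    rw [h3]; nlinarith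

lemma aux_U (x : ℝ) (hx : 1 ≤ x) (m : ℕ) :
    (Polynomial.Chebyshev.U ℝ m).eval x ≤ (2 * x) ^ m := by
  induction m with
  | zero => simp
  | succ m ih =>
    have h4 : (Polynomial.Chebyshev.U ℝ (m + 1 : ℕ)).eval x ≤
        2 * x * (Polynomial.Chebyshev.U ℝ m).eval x := by
      cases m with
      | zero => simp
      | succ k =>
        have e : ((k + 1 + 1 : ℕ) : ℤ) = (k : ℤ) + 2 := by push_cast; ring
        have h5 := congrArg (Polynomial.eval x) (Polynomial.Chebyshev.U_add_two ℝ (k : ℤ))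
        rw [e, h5]
        have := (aux_U0 x hx k).1
        simp
        linarith
    calc _ ≤ 2 * x * (Polynomial.Chebyshev.U ℝ m).eval x := h4
      _ ≤ 2 * x * (2 * x) ^ m := by gcongr
      _ = _ := by ring

lemma aux_antideriv (n : ℕ) (Q : Polynomial ℝ) (hQ : Q.natDegree < n) :
    ∃ F : Polynomial ℝ, F.degree ≤ n ∧ Polynomial.derivative F = Q := by
  refine ⟨∑ i ∈ Finset.range n, Polynomial.C (Q.coeff i / (i + 1)) * Polynomial.X ^ (i + 1), ?_, ?_⟩
  · refine (Polynomial.degree_sum_le _ _).trans (Finset.sup_le fun i hi => ?_)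
    refine (Polynomial.degree_C_mul_X_pow_le _ _).trans ?_
    have := Finset.mem_range.1 hi
    exact_mod_cast this
  · conv_rhs => rw [Q.as_sum_range' n hQ]
    rw [Polynomial.derivative_sum]
    refine Finset.sum_congr rfl fun i _ => ?_
    rw [Polynomial.derivative_C_mul_X_pow, ← Polynomial.C_mul_X_pow_eq_monomial]
    have : (i : ℝ) + 1 ≠ 0 := by positivity
    have e : Q.coeff i / ((i : ℝ) + 1) * ((i + 1 : ℕ) : ℝ) = Q.coeff i := by
      push_cast
      field_simp
    rw [e, Nat.add_sub_cancel]

lemma aux_one_side (n : ℕ) (hn : 1 ≤ n) (Q : Polynomial ℝ) (hQ : Q.natDegree < n) (r A : ℝ)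
    (hr : 0 < r) (hA : ∫ y in (-r)..r, |Q.eval y| ≤ A) (x : ℝ) (hx : r ≤ x) :
    Q.eval x ≤ (n / r) * (2 * x / r) ^ (n - 1) * A := by
  have hn' : (0:ℝ) < n := by exact_mod_cast hn
  have hx0 : 0 < x := hr.trans_le hx
  set K : ℝ := (n / r) * (2 * x / r) ^ (n - 1) with hK
  have hKpos : 0 < K := by positivity
  obtain ⟨F, hF, hFQ⟩ := aux_antideriv n Q hQ
  have hI0 : 0 ≤ ∫ y in (-r)..r, |Q.eval y| :=
    intervalIntegral.integral_nonneg (by linarith) fun _ _ => abs_nonneg _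
  have hint : ∀ a b : ℝ, IntervalIntegrable (fun y => |Q.eval y|) volume a b := fun a b =>
    (Q.continuous.abs).intervalIntegrable _ _
  suffices h : ∀ B, A < B → Q.eval x / K ≤ B by
    have := le_of_forall_gt_imp_ge_of_dense h
    rw [div_le_iff₀ hKpos] at this
    linarith
  intro B hB
  have hB0 : 0 < B := by linarith
  rw [div_le_iff₀ hKpos]
  set G : Polynomial ℝ := Polynomial.C (1 / B) *
    ((F - Polynomial.C (F.eval 0)).comp (Polynomial.C r * Polynomial.X)) with hG
  have hGdeg : G.degree ≤ n := by
    have h1 : (F - Polynomial.C (F.eval 0)).natDegree ≤ n := by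
      refine (Polynomial.natDegree_sub_C).le.trans ?_
      exact Polynomial.natDegree_le_of_degree_le hF
    rw [← Polynomial.natDegree_le_iff_degree_le]
    refine (Polynomial.natDegree_C_mul_le _ _).trans ?_
    refine Polynomial.natDegree_comp_le.trans ?_
    have h2 : (Polynomial.C r * Polynomial.X).natDegree ≤ 1 :=
      (Polynomial.natDegree_C_mul_le _ _).trans (by simp)
    nlinarith
  have hFbd : ∀ y ∈ Set.Icc (-r) r, |F.eval y - F.eval 0| ≤ B := by
    intro y hy
    have h1 : ∫ t in (0:ℝ)..y, Q.eval t = F.eval y - F.eval 0 := by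
      refine intervalIntegral.integral_eq_sub_of_hasDerivAt (f := fun t => F.eval t) (fun t _ => ?_)
        (Q.continuous.intervalIntegrable _ _)
      have := F.hasDerivAt t
      rwa [hFQ] at this
    rw [← h1]
    have h2 := intervalIntegral.norm_integral_le_abs_integral_norm (f := fun t => Q.eval t)
      (a := 0) (b := y) (μ := volume)
    simp only [Real.norm_eq_abs] at h2
    refine h2.trans ?_
    have h3 := intervalIntegral.abs_integral_mono_interval (f := fun t => |Q.eval t|)
      (a := 0) (b := y) (c := -r) (d := r) (μ := volume) (by
        intro z hz
        rw [Set.uIoc_of_le (by linarith)]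
        rcases Set.mem_uIoc.1 hz with h | h
        · exact ⟨by linarith [h.1], by linarith [h.2, hy.2]⟩
        · exact ⟨by linarith [h.1, hy.1], by linarith [h.2]⟩) (.of_forall fun _ => abs_nonneg _) (hint _ _)
    rw [abs_of_nonneg hI0] at h3
    linarith
  have hGbd : ∀ y ∈ Set.Icc (-1 : ℝ) 1, |G.eval y| ≤ 1 := by
    intro y hy
    have := hFbd (r * y) ⟨by nlinarith [hy.1], by nlinarith [hy.2]⟩
    simp [hG, abs_mul, abs_of_pos hB0]
    rw [inv_mul_le_iff₀ hB0]
    linarith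
  have key := Polynomial.Chebyshev.eval_iterate_derivative_le_of_forall_abs_le_one (k := 1)
    (x := x / r) (by rwa [le_div_iff₀ hr, one_mul]) hGdeg hGbd
  simp only [Function.iterate_one] at key
  rw [Polynomial.Chebyshev.T_derivative_eq_U] at key
  have e : (n : ℤ) - 1 = ((n - 1 : ℕ) : ℤ) := by omega
  have hU := (aux_U (x / r) (by rwa [le_div_iff₀ hr, one_mul]) (n - 1))
  have hd : (Polynomial.derivative G).eval (x / r) = r / B * Q.eval x := by
    simp [hG, Polynomial.derivative_comp, hFQ]
    have : r * (x / r) = x := by field_simp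
    rw [this]; ring
  rw [hd, e] at key
  simp at key
  have h3 : r / B * Q.eval x ≤ n * (2 * x / r) ^ (n - 1) := by
    refine key.trans ?_
    rw [mul_div_assoc]
    gcongr
  have h4 : Q.eval x = (B / r) * (r / B * Q.eval x) := by field_simp
  rw [h4]
  calc _ ≤ (B / r) * (n * (2 * x / r) ^ (n - 1)) := by gcongr
    _ = _ := by rw [hK]; ring

lemma aux_poly (n : ℕ) (hn : 1 ≤ n) (Q : Polynomial ℝ) (hQ : Q.natDegree < n) (r A : ℝ)
    (hr : 0 < r) (hA : ∫ y in (-r)..r, |Q.eval y| ≤ A) (x : ℝ) (hx : r ≤ |x|) :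
    |Q.eval x| ≤ (n / r) * (2 * |x| / r) ^ (n - 1) * A := by
  have gen : ∀ Q : Polynomial ℝ, Q.natDegree < n → ∫ y in (-r)..r, |Q.eval y| ≤ A →
      ∀ x, r ≤ x → |Q.eval x| ≤ (n / r) * (2 * x / r) ^ (n - 1) * A := by
    intro Q hQ hA x hx
    refine abs_le'.2 ⟨aux_one_side n hn Q hQ r A hr hA x hx, ?_⟩
    have := aux_one_side n hn (-Q) (by simpa using hQ) r A hr (by simpa using hA) x hx
    simpa using this
  rcases abs_cases x with ⟨h, _⟩ | ⟨h, _⟩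
  · rw [h] at hx ⊢; exact gen Q hQ hA x hx
  · rw [h] at hx ⊢
    have := gen (Q.comp (-Polynomial.X)) (by rw [Polynomial.natDegree_comp]; simpa using hQ) (by
      have h2 := intervalIntegral.integral_comp_neg (a := -r) (b := r) (fun y => |Q.eval y|)
      simp only [neg_neg] at h2
      simpa [h2] using hA) (-x) hx
    simpa using this

lemma aux_psi (k : ℕ) : ∃ H : Polynomial ℝ, H.natDegree ≤ k ∧
    ∀ x, iteratedDeriv k (fun t : ℝ => Real.exp (-t ^ 2)) x = H.eval x * Real.exp (-x ^ 2) := by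
  induction k with
  | zero => exact ⟨1, by simp, by simp⟩
  | succ k ih =>
    obtain ⟨H, hH, h⟩ := ih
    refine ⟨Polynomial.derivative H - 2 * Polynomial.X * H, ?_, ?_⟩
    · refine (Polynomial.natDegree_sub_le _ _).trans (max_le ?_ ?_)
      · exact (Polynomial.natDegree_derivative_le _).trans (by omega)
      · refine Polynomial.natDegree_mul_le.trans ?_
        have : (2 * Polynomial.X : Polynomial ℝ).natDegree ≤ 1 :=
          (Polynomial.natDegree_C_mul_le (2:ℝ) Polynomial.X).trans (by simp)
        omega
    · intro x
      rw [iteratedDeriv_succ, funext h]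
      have h1 : HasDerivAt (fun t : ℝ => Real.exp (-t ^ 2)) (Real.exp (-x ^ 2) * (-(2 * x))) x := by
        have := ((hasDerivAt_pow 2 x).neg).exp
        simpa using this
      have h2 : HasDerivAt (fun t : ℝ => H.eval t * Real.exp (-t ^ 2)) _ x :=
        (H.hasDerivAt x).mul h1
      rw [h2.deriv]
      simp
      ring

lemma aux_PiH (n : ℕ) (hn : 1 ≤ n) (P : ℝ → ℝ) (hP : P ∈ PiH n) :
    ∃ Q : Polynomial ℝ, Q.natDegree < n ∧ ∀ x, P x = Q.eval x * Real.exp (-x ^ 2 / 2) := by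
  suffices h : ∃ Q : Polynomial ℝ, Q.natDegree ≤ n - 1 ∧
      ∀ x, P x = Q.eval x * Real.exp (-x ^ 2 / 2) by
    obtain ⟨Q, h1, h2⟩ := h
    exact ⟨Q, by omega, h2⟩
  induction hP using Submodule.span_induction with
  | mem f hf =>
    obtain ⟨k, hk, rfl⟩ := hf
    obtain ⟨H, hH, h⟩ := aux_psi k
    refine ⟨Polynomial.C ((Real.sqrt Real.pi * 2 ^ k * (Nat.factorial k : ℝ)) ^ (-(1 : ℝ) / 2) *
      (-1 : ℝ) ^ k) * H, (Polynomial.natDegree_C_mul_le _ _).trans (by omega), fun x => ?_⟩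
    have e : Real.exp (-x ^ 2 / 2) = Real.exp (x ^ 2 / 2) * Real.exp (-x ^ 2) := by
      rw [← Real.exp_add]; ring_nf
    rw [psiH, h, e, Polynomial.eval_mul, Polynomial.eval_C]
    ring
  | zero => exact ⟨0, by simp, by simp⟩
  | add f g _ _ hf hg =>
    obtain ⟨Q, h1, h2⟩ := hf
    obtain ⟨R, h3, h4⟩ := hg
    exact ⟨Q + R, (Polynomial.natDegree_add_le _ _).trans (max_le h1 h3), fun x => by
      simp [h2, h4]; ring⟩
  | smul a f _ hf =>
    obtain ⟨Q, h1, h2⟩ := hf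
    exact ⟨Polynomial.C a * Q, (Polynomial.natDegree_C_mul_le _ _).trans h1, fun x => by
      simp [h2]; ring⟩

lemma aux_num (n : ℕ) (hn : 1 ≤ n) (t : ℝ) (ht : 2 ≤ t) :
    2 * n * (2 * t) ^ (n - 1) * Real.exp (n / 2 - n * t ^ 2 / 2) ≤
      67 * Real.exp (-(0.02 * (n * t ^ 2))) := by
  have hn' : (1:ℝ) ≤ n := by exact_mod_cast hn
  have h1 : (2 * t) ^ (n - 1) ≤ (2 * t) ^ n := pow_le_pow_right₀ (by linarith) (by omega)
  have h4 : (4:ℝ) ≤ Real.exp 1.3863 := by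
    have e : (4:ℝ) = Real.exp (Real.log 2 + Real.log 2) := by
      rw [Real.exp_add, Real.exp_log (by norm_num)]; norm_num
    rw [e]
    exact Real.exp_le_exp.2 (by have := Real.log_two_lt_d9; linarith)
  have h2 : 2 * t ≤ Real.exp (0.3863 + t / 2) := by
    have := Real.add_one_le_exp (t / 2 - 1)
    have e : (0.3863 + t / 2 : ℝ) = 1.3863 + (t / 2 - 1) := by ring
    rw [e, Real.exp_add]
    calc 2 * t = 4 * (t / 2 - 1 + 1) := by ring
      _ ≤ _ := by gcongr; linarith
  have h3 : (2 * t) ^ n ≤ Real.exp (n * (0.3863 + t / 2)) := by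
    rw [Real.exp_nat_mul]
    gcongr
  have h5 : 2 * (n:ℝ) ≤ 67 * Real.exp (0.03 * n) := by
    have := Real.add_one_le_exp (0.03 * (n:ℝ))
    linarith
  calc 2 * n * (2 * t) ^ (n - 1) * Real.exp (n / 2 - n * t ^ 2 / 2)
      ≤ (67 * Real.exp (0.03 * n)) * Real.exp (n * (0.3863 + t / 2)) *
        Real.exp (n / 2 - n * t ^ 2 / 2) := by
        gcongr
        exact h1.trans h3
    _ = 67 * Real.exp (0.03 * n + n * (0.3863 + t / 2) + (n / 2 - n * t ^ 2 / 2)) := by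
        rw [Real.exp_add, Real.exp_add]; ring
    _ ≤ _ := by
        gcongr
        have : 0.03 + 0.3863 + t / 2 + 1 / 2 - t ^ 2 / 2 + 0.02 * t ^ 2 ≤ 0 := by nlinarith
        nlinarith

lemma aux_pt (n : ℕ) (hn : 1 ≤ n) (P : ℝ → ℝ) (hP : P ∈ PiH n) (x : ℝ)
    (hx : 2 * Real.sqrt n ≤ |x|) :
    2 * Real.sqrt n * |P x| ≤ 67 * Real.exp (-(0.02 * x ^ 2)) *
      ∫ y in (-Real.sqrt n)..(Real.sqrt n), |P y| := by
  obtain ⟨Q, hQ, h⟩ := aux_PiH n hn P hP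
  have hn' : (1:ℝ) ≤ n := by exact_mod_cast hn
  set r := Real.sqrt n with hr
  have hr0 : 0 < r := Real.sqrt_pos.2 (by linarith)
  have hrr : r ^ 2 = n := Real.sq_sqrt (by linarith)
  set I := ∫ y in (-r)..r, |P y| with hI
  have hI0 : 0 ≤ I := intervalIntegral.integral_nonneg (by linarith) fun _ _ => abs_nonneg _
  have hPc : Continuous P := by
    rw [funext h]
    exact Q.continuous.mul (by fun_prop)
  have hA : ∫ y in (-r)..r, |Q.eval y| ≤ Real.exp (n / 2) * I := by
    rw [hI, ← intervalIntegral.integral_const_mul]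
    refine intervalIntegral.integral_mono_on (by linarith) (Q.continuous.abs.intervalIntegrable _ _)
      ((hPc.abs.const_mul _).intervalIntegrable _ _) fun y hy => ?_
    rw [h, abs_mul, abs_of_pos (Real.exp_pos _)]
    have : 1 ≤ Real.exp (n / 2) * Real.exp (-y ^ 2 / 2) := by
      rw [← Real.exp_add]
      apply Real.one_le_exp
      have : y ^ 2 ≤ r ^ 2 := sq_le_sq' hy.1 hy.2
      linarith
    nlinarith [abs_nonneg (Q.eval y)]
  have h1 := aux_poly n hn Q hQ r _ hr0 hA x (by linarith)
  have h2 := aux_num n hn (|x| / r) (by rwa [le_div_iff₀ hr0])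
  have e1 : (n:ℝ) * (|x| / r) ^ 2 = x ^ 2 := by
    rw [div_pow, sq_abs, hrr]; field_simp
  rw [e1] at h2
  rw [h, abs_mul, abs_of_pos (Real.exp_pos _)]
  calc 2 * r * (|Q.eval x| * Real.exp (-x ^ 2 / 2))
      ≤ 2 * r * ((n / r) * (2 * |x| / r) ^ (n - 1) * (Real.exp (n / 2) * I) *
        Real.exp (-x ^ 2 / 2)) := by gcongr
    _ = (2 * n * (2 * (|x| / r)) ^ (n - 1) * Real.exp (n / 2 - x ^ 2 / 2)) * I := by
        rw [sub_eq_add_neg, Real.exp_add, mul_div_assoc, neg_div]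
        field_simp
    _ ≤ _ := by gcongr

lemma aux_g : ∃ M : ℝ, 0 ≤ M ∧ ∀ p : ℝ≥0∞, 1 ≤ p →
    eLpNorm (fun x : ℝ => Real.exp (-(0.02 * x ^ 2))) p volume ≤ ENNReal.ofReal M := by
  set g : ℝ → ℝ := fun x : ℝ => Real.exp (-(0.02 * x ^ 2)) with hg
  have hg1 : ∀ x, ‖g x‖ₑ ≤ 1 := fun x => by
    rw [Real.enorm_eq_ofReal (Real.exp_pos _).le]
    simp only [ENNReal.ofReal_le_one, Real.exp_le_one_iff]
    nlinarith [sq_nonneg x]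
  have hint : Integrable g := by
    have := integrable_exp_neg_mul_sq (b := 0.02) (by norm_num)
    simpa [hg, neg_mul] using this
  set J : ℝ≥0∞ := max 1 (∫⁻ x, ‖g x‖ₑ) with hJ
  have hJt : J ≠ ⊤ := by
    simp only [hJ, ne_eq, max_eq_top, not_or]
    exact ⟨by simp, hint.2.ne⟩
  refine ⟨J.toReal, by positivity, fun p hp => ?_⟩
  rw [ENNReal.ofReal_toReal hJt]
  by_cases hpt : p = ⊤
  · subst hpt
    rw [eLpNorm_exponent_top]
    refine (eLpNormEssSup_le_of_ae_enorm_bound (C := 1) (.of_forall hg1)).trans (le_max_left _ _)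
  · have hp0 : p ≠ 0 := (zero_lt_one.trans_le hp).ne'
    have hp1 : 1 ≤ p.toReal := by
      simpa using (ENNReal.toReal_le_toReal (by simp) hpt).2 hp
    rw [eLpNorm_eq_lintegral_rpow_enorm_toReal hp0 hpt]
    calc (∫⁻ x, ‖g x‖ₑ ^ p.toReal) ^ (1 / p.toReal) ≤ J ^ (1 / p.toReal) := by
          gcongr
          refine le_trans (lintegral_mono fun x => ?_) (le_max_right _ _)
          simpa using ENNReal.rpow_le_rpow_of_exponent_ge (hg1 x) hp1
      _ ≤ J ^ (1:ℝ) := by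
          refine ENNReal.rpow_le_rpow_of_exponent_le (le_max_left _ _) ?_
          rw [div_le_one (by linarith)]; exact hp1
      _ = J := by simp

theorem stmt1 :
    ∃ c₁ : ℝ, 0 < c₁ ∧ ∃ c₂ : ℝ, 0 < c₂ ∧ ∀ (n : ℕ), 1 ≤ n → ∀ (p : ℝ≥0∞), 1 ≤ p →
      ∀ P : ℝ → ℝ, P ∈ PiH n →
        ENNReal.ofReal c₁ * eLpNorm P p (volume.restrict (Set.Icc (-(2 * Real.sqrt n)) (2 * Real.sqrt n))) ≤
            eLpNorm P p volume ∧
          eLpNorm P p volume ≤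
            ENNReal.ofReal c₂ * eLpNorm P p (volume.restrict (Set.Icc (-(2 * Real.sqrt n)) (2 * Real.sqrt n))) := by
  obtain ⟨M, hM, hg⟩ := aux_g
  refine ⟨1, one_pos, 1 + 67 * M, by positivity, fun n hn p hp P hP => ⟨?_, ?_⟩⟩
  · simpa using eLpNorm_mono_measure P Measure.restrict_le_self
  have hn' : (1:ℝ) ≤ n := by exact_mod_cast hn
  have hPc : Continuous P := by
    obtain ⟨Q, -, h⟩ := aux_PiH n hn P hP
    rw [funext h]
    exact Q.continuous.mul (by fun_prop)
  have hPt := aux_pt n hn P hP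
  set r := Real.sqrt n with hr
  have hr1 : 1 ≤ r := Real.one_le_sqrt.2 hn'
  set S : Set ℝ := Set.Icc (-(2 * r)) (2 * r) with hS
  set I := ∫ y in (-r)..r, |P y| with hI
  have hI0 : 0 ≤ I := intervalIntegral.integral_nonneg (by linarith) fun _ _ => abs_nonneg _
  have hmS : MeasurableSet S := measurableSet_Icc
  -- the L¹ norm on the small interval is controlled
  have hIle : ENNReal.ofReal I ≤ ENNReal.ofReal (2 * r) * eLpNorm P p (volume.restrict S) := by
    have h1 : ENNReal.ofReal I = eLpNorm P 1 (volume.restrict (Set.Ioc (-r) r)) := by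
      rw [hI, intervalIntegral.integral_of_le (by linarith), eLpNorm_one_eq_lintegral_enorm]
      have hi : Integrable P (volume.restrict (Set.Ioc (-r) r)) :=
        (hPc.integrableOn_Icc).mono_set Set.Ioc_subset_Icc_self
      simpa using ofReal_integral_norm_eq_lintegral_enorm hi
    rw [h1]
    refine (eLpNorm_le_eLpNorm_mul_rpow_measure_univ hp hPc.aestronglyMeasurable).trans ?_
    rw [mul_comm]
    gcongr
    · have e : (volume.restrict (Set.Ioc (-r) r)) Set.univ = ENNReal.ofReal (2 * r) := by
        rw [Measure.restrict_apply_univ, Real.volume_Ioc]; ring_nf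
      rw [e]
      calc _ ≤ ENNReal.ofReal (2 * r) ^ (1:ℝ) := by
            refine ENNReal.rpow_le_rpow_of_exponent_le ?_ ?_
            · exact ENNReal.one_le_ofReal.2 (by linarith)
            · simp
        _ = _ := by simp
    · intro y hy
      exact ⟨by linarith [hy.1], by linarith [hy.2]⟩
  -- splitting
  have hsplit : eLpNorm P p volume ≤
      eLpNorm P p (volume.restrict S) + eLpNorm P p (volume.restrict Sᶜ) := by
    rw [← eLpNorm_indicator_eq_eLpNorm_restrict hmS,
      ← eLpNorm_indicator_eq_eLpNorm_restrict hmS.compl]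
    conv_lhs => rw [← Set.indicator_self_add_compl S P]
    exact eLpNorm_add_le (hPc.aestronglyMeasurable.indicator hmS)
      (hPc.aestronglyMeasurable.indicator hmS.compl) hp
  have hout : eLpNorm P p (volume.restrict Sᶜ) ≤
      ENNReal.ofReal (67 * M) * eLpNorm P p (volume.restrict S) := by
    have h1 : eLpNorm P p (volume.restrict Sᶜ) ≤
        eLpNorm ((67 / (2 * r) * I) • fun x : ℝ => Real.exp (-(0.02 * x ^ 2))) p
          (volume.restrict Sᶜ) := by
      refine eLpNorm_mono_ae ((ae_restrict_iff' hmS.compl).2 (.of_forall fun x hx => ?_))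
      have hx' : 2 * r ≤ |x| := by
        by_contra hlt
        exact hx (Set.mem_Icc.2 (abs_le.1 (not_le.1 hlt).le))
      have := hPt x hx'
      have hpos : 0 ≤ 67 / (2 * r) * I * Real.exp (-(0.02 * x ^ 2)) := by positivity
      rw [Pi.smul_apply, smul_eq_mul, Real.norm_eq_abs, Real.norm_eq_abs, abs_of_nonneg hpos]
      have e : 67 / (2 * r) * I * Real.exp (-(0.02 * x ^ 2)) =
        (67 * Real.exp (-(0.02 * x ^ 2)) * I) / (2 * r) := by ring
      rw [e, le_div_iff₀ (by positivity)]
      linarith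
    refine h1.trans ?_
    rw [eLpNorm_const_smul]
    have h2 : eLpNorm (fun x : ℝ => Real.exp (-(0.02 * x ^ 2))) p (volume.restrict Sᶜ) ≤
        ENNReal.ofReal M := (eLpNorm_mono_measure _ Measure.restrict_le_self).trans (hg p hp)
    have e3 : ‖67 / (2 * r) * I‖ₑ = ENNReal.ofReal (67 / (2 * r)) * ENNReal.ofReal I := by
      rw [Real.enorm_eq_ofReal (by positivity), ENNReal.ofReal_mul (by positivity)]
    rw [e3]
    calc _ ≤ ENNReal.ofReal (67 / (2 * r)) *
          (ENNReal.ofReal (2 * r) * eLpNorm P p (volume.restrict S)) * ENNReal.ofReal M := by gcongr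
      _ = (ENNReal.ofReal (67 / (2 * r)) * ENNReal.ofReal (2 * r) * ENNReal.ofReal M) *
          eLpNorm P p (volume.restrict S) := by ring
      _ = _ := by
        rw [← ENNReal.ofReal_mul (by positivity), ← ENNReal.ofReal_mul (by positivity)]
        congr 3
        field_simp
  calc _ ≤ _ := hsplit
    _ ≤ eLpNorm P p (volume.restrict S) +
      ENNReal.ofReal (67 * M) * eLpNorm P p (volume.restrict S) := by gcongr
    _ = _ := by
      rw [ENNReal.ofReal_add (by norm_num) (by positivity), add_mul, ENNReal.ofReal_one, one_mul]
end

section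
/- Let c₁, c₂, c₃, c₄ > 0. Let f ∈ C₀(ℝ) ∩ L¹(ℝ), let m ≥ n ≥ 1 be integers, and let ν be a positive measure in SMZ(m) with constants (c₁,c₂,c₃,c₄). Then there exists a constant c > 0, depending only on (c₁,c₂,c₃,c₄), such that ‖𝔉(f) − 𝔉(S_n(ν;f))‖_∞ ≤ c ‖f − S_n(ν;f)‖_1 ≤ c ( E_{1,⌊n/2⌋}(f) + n · E_{∞,⌊n/2⌋}(f) ). -/
open MeasureTheory Filter ENNReal ProbabilityTheory

namespace HermAux

open Polynomial

theorem integrable_poly (p : ℝ[X]) {b : ℝ} (hb : 0 < b) :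
    Integrable (fun x : ℝ => p.eval x * Real.exp (-b * x ^ 2)) := by
  induction p using Polynomial.induction_on' with
  | add p q hp hq =>
    refine (hp.add hq).congr (Filter.Eventually.of_forall fun x => ?_)
    simp only [Pi.add_apply, eval_add]; ring
  | monomial k a =>
    have h := integrable_rpow_mul_exp_neg_mul_sq hb (s := k)
      (by have : (0 : ℝ) ≤ k := Nat.cast_nonneg k
          linarith)
    refine (h.const_mul a).congr (Filter.Eventually.of_forall fun x => ?_)
    simp only [eval_monomial, Real.rpow_natCast]; ring

noncomputable def gI (p : ℝ[X]) : ℝ := ∫ x : ℝ, p.eval x * Real.exp (-x ^ 2)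

theorem integrable_poly1 (p : ℝ[X]) :
    Integrable (fun x : ℝ => p.eval x * Real.exp (-x ^ 2)) := by
  simpa using integrable_poly p (b := 1) one_pos

theorem gI_add (p q : ℝ[X]) : gI (p + q) = gI p + gI q := by
  unfold gI
  rw [← integral_add (integrable_poly1 p) (integrable_poly1 q)]
  congr 1; ext x; simp only [eval_add]; ring

theorem gI_C_mul (a : ℝ) (p : ℝ[X]) : gI (C a * p) = a * gI p := by
  unfold gI
  rw [← integral_const_mul]
  congr 1; ext x; simp only [eval_mul, eval_C]; ring

theorem gI_mono (p q : ℝ[X]) (h : ∀ x, p.eval x ≤ q.eval x) : gI p ≤ gI q := by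
  unfold gI
  refine integral_mono (integrable_poly1 p) (integrable_poly1 q) fun x => ?_
  exact mul_le_mul_of_nonneg_right (h x) (Real.exp_pos _).le

theorem gI_nonneg (p : ℝ[X]) (h : ∀ x, 0 ≤ p.eval x) : 0 ≤ gI p :=
  integral_nonneg fun x => mul_nonneg (h x) (Real.exp_pos _).le

theorem hasDerivAt_pe (p : ℝ[X]) (x : ℝ) :
    HasDerivAt (fun x : ℝ => p.eval x * Real.exp (-x ^ 2))
      ((derivative p - C 2 * X * p).eval x * Real.exp (-x ^ 2)) x := by
  have h1 := p.hasDerivAt x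
  have h2 : HasDerivAt (fun x : ℝ => Real.exp (-x ^ 2)) (Real.exp (-x ^ 2) * (-(2 * x))) x := by
    have := ((hasDerivAt_pow 2 x).neg).exp
    simpa using this
  have := h1.mul h2
  refine this.congr_deriv ?_
  simp only [eval_sub, eval_mul, eval_C, eval_X]; ring

theorem gI_ibp (p : ℝ[X]) : gI (derivative p) = gI (C 2 * X * p) := by
  have h := integral_eq_zero_of_hasDerivAt_of_integrable (hasDerivAt_pe p)
    (integrable_poly1 _) (integrable_poly1 p)
  have h2 : gI (derivative p - C 2 * X * p) = 0 := h
  have h3 := gI_add (derivative p - C 2 * X * p) (C 2 * X * p)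
  rw [sub_add_cancel, h2, zero_add] at h3
  exact h3

/-- creation-operator norm identity -/
theorem gI_star (q : ℝ[X]) :
    gI ((C 2 * X * q - derivative q) ^ 2) = gI (derivative q ^ 2) + 2 * gI (q ^ 2) := by
  have h := gI_ibp (q * (C 2 * X * q - derivative q) + q * derivative q)
  have e1 : derivative (q * (C 2 * X * q - derivative q) + q * derivative q) + C 0 =
      C 2 * q ^ 2 + C 2 * (C 2 * X * q * derivative q) := by
    simp only [derivative_mul, derivative_sub, derivative_add, derivative_C, derivative_X, C_0]
    have : (C 2 : ℝ[X]) = 2 := rfl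
    rw [this]; ring
  rw [C_0, add_zero] at e1
  rw [e1] at h
  have e2 : C 2 * X * (q * (C 2 * X * q - derivative q) + q * derivative q) =
     (C 2 * X * q) ^ 2 := by ring
  rw [e2, gI_add, gI_C_mul, gI_C_mul] at h
  have h5 := gI_add ((C 2 * X * q - derivative q) ^ 2) (C 2 * (C 2 * X * q * derivative q))
  have e3 : (C 2 * X * q - derivative q) ^ 2 + C 2 * (C 2 * X * q * derivative q) =
      (C 2 * X * q) ^ 2 + derivative q ^ 2 := by
    have : (C 2 : ℝ[X]) = 2 := rfl
    rw [this]; ring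
  rw [e3, gI_add, gI_C_mul] at h5
  linarith

theorem gI_adj (p q : ℝ[X]) :
    gI (derivative p * q) = gI (p * (C 2 * X * q - derivative q)) := by
  have h := gI_ibp (p * q)
  rw [derivative_mul, gI_add] at h
  have h2 := gI_add (p * (C 2 * X * q - derivative q)) (p * derivative q)
  have e : p * (C 2 * X * q - derivative q) + p * derivative q = C 2 * X * (p * q) := by ring
  rw [e] at h2
  linarith

theorem gI_deriv (d : ℕ) : ∀ p : ℝ[X], p.natDegree ≤ d →
    gI (derivative p ^ 2) ≤ 2 * d * gI (p ^ 2) := by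
  induction d with
  | zero =>
    intro p hp
    have : derivative p = 0 := derivative_of_natDegree_zero (Nat.le_zero.mp hp)
    rw [this]; simp [gI]
  | succ d ih =>
    intro p hp
    set q := derivative p with hq
    have hqd : q.natDegree ≤ d := (natDegree_derivative_le p).trans (by omega)
    have h1 := ih q hqd
    have h2 := gI_star q
    have h3 := gI_adj p q
    rw [← hq, ← sq] at h3
    set r := C 2 * X * q - derivative q with hr
    set s : ℝ := 2 * ((d + 1 : ℕ) : ℝ) with hs
    have hs0 : 0 < s := by positivity
    have h4 : 0 ≤ gI ((C s * p - r) ^ 2) := gI_nonneg _ fun x => by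
      rw [eval_pow]; positivity
    have e : (C s * p - r) ^ 2 = C (s ^ 2) * p ^ 2 + (C (-2 * s) * (p * r) + r ^ 2) := by
      simp only [C_mul, C_pow, C_neg]
      have : (C 2 : ℝ[X]) = 2 := rfl
      rw [this]; ring
    rw [e, gI_add, gI_add, gI_C_mul, gI_C_mul, ← h3] at h4
    have h5 : gI (r ^ 2) ≤ s * gI (q ^ 2) := by
      rw [h2, hs]; push_cast; linarith
    have h6 : s * gI (q ^ 2) ≤ s * (s * gI (p ^ 2)) := by nlinarith
    exact le_of_mul_le_mul_left h6 hs0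

theorem gI_X (d : ℕ) (p : ℝ[X]) (hp : p.natDegree ≤ d) :
    gI ((X * p) ^ 2) ≤ (2 * d + 1) * gI (p ^ 2) := by
  have h1 := gI_deriv d p hp
  have h2 := gI_star p
  have h3 : gI ((X * p) ^ 2) ≤
      gI (C (1 / 2) * ((C 2 * X * p - derivative p) ^ 2) + C (1 / 2) * (derivative p ^ 2)) := by
    refine gI_mono _ _ fun x => ?_
    simp only [eval_add, eval_sub, eval_mul, eval_pow, eval_C, eval_X]
    nlinarith [sq_nonneg (x * p.eval x - (derivative p).eval x)]
  rw [gI_add, gI_C_mul, gI_C_mul, h2] at h3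
  linarith

theorem sup_bound (n : ℕ) (p : ℝ[X]) (hp : p.natDegree < n) (x : ℝ) :
    p.eval x ^ 2 * Real.exp (-x ^ 2) ≤ 8 * n * gI (p ^ 2) := by
  obtain ⟨d, rfl⟩ : ∃ d, n = d + 1 := ⟨n - 1, by omega⟩
  have hd : p.natDegree ≤ d := by omega
  have hder : ∀ y, HasDerivAt (fun x : ℝ => (p ^ 2).eval x * Real.exp (-x ^ 2)) _ y :=
    hasDerivAt_pe (p ^ 2)
  have hint := integrable_poly1 (derivative (p ^ 2) - C 2 * X * p ^ 2)
  have h0 := tendsto_zero_of_hasDerivAt_of_integrableOn_Iic (a := x) (fun y _ => hder y)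
    hint.integrableOn (integrable_poly1 (p ^ 2)).integrableOn
  have h1 := integral_Iic_of_hasDerivAt_of_tendsto' (a := x) (fun y _ => hder y)
    hint.integrableOn h0
  set r : ℝ[X] := p ^ 2 + (C 2 * (derivative p ^ 2) + C 2 * (X * p) ^ 2) with hr
  have hrint := integrable_poly1 r
  have hrn : ∀ y, 0 ≤ r.eval y := fun y => by
    simp only [hr, eval_add, eval_mul, eval_pow, eval_C, eval_X]; positivity
  have h2 : ∫ y in Set.Iic x, (derivative (p ^ 2) - C 2 * X * p ^ 2).eval y * Real.exp (-y ^ 2)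
      ≤ gI r := by
    refine le_trans (setIntegral_mono hint.integrableOn hrint.integrableOn fun y => ?_)
      (setIntegral_le_integral hrint (Eventually.of_forall fun y =>
        mul_nonneg (hrn y) (Real.exp_pos _).le))
    refine mul_le_mul_of_nonneg_right ?_ (Real.exp_pos _).le
    simp only [hr, derivative_pow, eval_add, eval_sub, eval_mul, eval_pow, eval_C, eval_X]
    norm_num
    nlinarith [sq_nonneg (p.eval y - ((derivative p).eval y - y * p.eval y)),
      sq_nonneg ((derivative p).eval y + y * p.eval y)]
  rw [h1, sub_zero] at h2
  rw [hr, gI_add, gI_add, gI_C_mul, gI_C_mul] at h2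
  have h3 := gI_deriv d p hd
  have h4 := gI_X d p hd
  have h5 : 0 ≤ gI (p ^ 2) := gI_nonneg _ fun x => by rw [eval_pow]; positivity
  rw [eval_pow] at h2
  push_cast
  nlinarith

/-- weighted Cauchy-Schwarz -/
theorem cs {μ : Measure ℝ} {g w : ℝ → ℝ} (hg : AEStronglyMeasurable g μ) (hw : ∀ x, 0 < w x)
    (h1 : Integrable (fun x => g x ^ 2 * w x) μ) (h2 : Integrable (fun x => (w x)⁻¹) μ) :
    Integrable g μ ∧
      (∫ x, |g x| ∂μ) ^ 2 ≤ (∫ x, g x ^ 2 * w x ∂μ) * ∫ x, (w x)⁻¹ ∂μ := by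
  have key : ∀ x t, 0 ≤ t ^ 2 * (g x ^ 2 * w x) - 2 * t * |g x| + (w x)⁻¹ := fun x t => by
    have h := hw x
    have : t ^ 2 * (g x ^ 2 * w x) - 2 * t * |g x| + (w x)⁻¹ = (t * |g x| * w x - 1) ^ 2 * (w x)⁻¹ := by
      rw [← sq_abs (g x)]; field_simp; ring
    rw [this]; positivity
  have hI : Integrable g μ := by
    refine (h1.add h2).mono' hg (Eventually.of_forall fun x => ?_)
    have := key x 1
    have h3 : 0 ≤ g x ^ 2 * w x := mul_nonneg (sq_nonneg _) (hw x).le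
    have h4 : 0 < (w x)⁻¹ := inv_pos.2 (hw x)
    simp only [Real.norm_eq_abs, Pi.add_apply]
    by_cases h5 : 0 ≤ |g x|
    · linarith
    · exact absurd (abs_nonneg _) h5
  refine ⟨hI, ?_⟩
  have h := discrim_le_zero (a := ∫ x, g x ^ 2 * w x ∂μ) (b := -2 * ∫ x, |g x| ∂μ)
    (c := ∫ x, (w x)⁻¹ ∂μ) (fun t => by
      have h0 : 0 ≤ ∫ x, (t ^ 2 * (g x ^ 2 * w x) - 2 * t * |g x| + (w x)⁻¹) ∂μ :=
        integral_nonneg fun x => key x t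
      have i1 : Integrable (fun x => t ^ 2 * (g x ^ 2 * w x)) μ := h1.const_mul _
      have i2 : Integrable (fun x => 2 * t * |g x|) μ := hI.abs.const_mul _
      have i3 : Integrable (fun x => t ^ 2 * (g x ^ 2 * w x) - 2 * t * |g x|) μ := i1.sub i2
      rw [integral_add i3 h2, integral_sub i1 i2, integral_const_mul,
        integral_const_mul] at h0
      linarith)
  rw [discrim] at h
  nlinarith

/-- weighted polynomial -/
noncomputable def wp (p : ℝ[X]) (x : ℝ) : ℝ := p.eval x * Real.exp (-(x ^ 2 / 2))

theorem wp_sq (p : ℝ[X]) (x : ℝ) : wp p x ^ 2 = (p ^ 2).eval x * Real.exp (-x ^ 2) := by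
  unfold wp
  rw [mul_pow, ← Real.exp_nat_mul, eval_pow]
  congr 2; push_cast; ring

theorem wp_cont (p : ℝ[X]) : Continuous (wp p) := by
  unfold wp; fun_prop

theorem wp_int (p : ℝ[X]) : Integrable (wp p) := by
  refine (integrable_poly p (b := 1 / 2) (by norm_num)).congr (Eventually.of_forall fun x => ?_)
  unfold wp
  simp only
  congr 2; ring

theorem wp_sq_int (p : ℝ[X]) : Integrable (fun x => wp p x ^ 2) :=
  (integrable_poly1 (p ^ 2)).congr (Eventually.of_forall fun x => (wp_sq p x).symm)

theorem wp_sq_integral (p : ℝ[X]) : ∫ x, wp p x ^ 2 = gI (p ^ 2) := by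
  unfold gI; congr 1; ext x; exact wp_sq p x

theorem wp_X (p : ℝ[X]) (x : ℝ) : wp (X * p) x = x * wp p x := by
  unfold wp; rw [eval_mul, eval_X]; ring

theorem gI_sq_nonneg (p : ℝ[X]) : 0 ≤ gI (p ^ 2) :=
  gI_nonneg _ fun x => by rw [eval_pow]; positivity

theorem wp_one_add (p : ℝ[X]) (x : ℝ) :
    wp p x ^ 2 * (1 + x ^ 2) = wp p x ^ 2 + wp (X * p) x ^ 2 := by
  rw [wp_X]; ring

/-- L1 bounded by weighted L2 -/
theorem l1_le (p : ℝ[X]) :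
    (∫ x, |wp p x|) ^ 2 ≤ (gI (p ^ 2) + gI ((X * p) ^ 2)) * Real.pi := by
  have h := (cs (μ := volume) (g := wp p) (w := fun x => 1 + x ^ 2)
    (wp_cont p).aestronglyMeasurable (fun x => by positivity)
    (((wp_sq_int p).add (wp_sq_int (X * p))).congr
      (Eventually.of_forall fun x => (wp_one_add p x).symm))
    integrable_inv_one_add_sq).2
  rw [integral_univ_inv_one_add_sq] at h
  simp only [wp_one_add] at h
  rwa [integral_add (wp_sq_int p) (wp_sq_int _), wp_sq_integral, wp_sq_integral] at h

theorem l1_le_n (n : ℕ) (p : ℝ[X]) (hp : p.natDegree < n) :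
    (∫ x, |wp p x|) ^ 2 ≤ 2 * n * Real.pi * gI (p ^ 2) := by
  refine (l1_le p).trans ?_
  have h := gI_X (n - 1) p (by omega)
  rw [Nat.cast_sub (by omega)] at h
  push_cast at h
  nlinarith [Real.pi_pos, gI_sq_nonneg p]

theorem l2_le_l1 (n : ℕ) (p : ℝ[X]) (hp : p.natDegree < n) :
    gI (p ^ 2) ≤ 8 * n * (∫ x, |wp p x|) ^ 2 := by
  set s := ∫ x, |wp p x| with hs
  set a := gI (p ^ 2) with ha
  have ha0 : 0 ≤ a := gI_sq_nonneg p
  have hs0 : 0 ≤ s := integral_nonneg fun x => abs_nonneg _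
  set M := Real.sqrt (8 * n * a) with hM
  have hsup : ∀ x, |wp p x| ≤ M := fun x => by
    rw [hM, ← Real.sqrt_sq_eq_abs]
    refine Real.sqrt_le_sqrt ?_
    rw [wp_sq, eval_pow]; exact sup_bound n p hp x
  have h1 : a ≤ M * s := by
    rw [ha, ← wp_sq_integral, hs, ← integral_const_mul]
    refine integral_mono (wp_sq_int p) ((wp_int p).abs.const_mul _) fun x => ?_
    have := hsup x
    simp only
    rw [← sq_abs, sq]
    exact mul_le_mul_of_nonneg_right this (abs_nonneg _)
  have hM2 : M ^ 2 = 8 * n * a := Real.sq_sqrt (by positivity)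
  rcases ha0.eq_or_lt with h | h
  · rw [← h]; positivity
  · have h3 : a * a ≤ a * (8 * n * s ^ 2) := by
      calc a * a ≤ (M * s) * (M * s) := mul_self_le_mul_self ha0 h1
        _ = M ^ 2 * s ^ 2 := by ring
        _ = _ := by rw [hM2]; ring
    exact le_of_mul_le_mul_left h3 h

/-- restricted range inequality (crude) -/
theorem restricted (n : ℕ) (p : ℝ[X]) (hp : p.natDegree < n) :
    ∫ x, |wp p x| ≤ 2 * ∫ x in Set.Icc (-(10 * n : ℝ)) (10 * n), |wp p x| := by
  set s := ∫ x, |wp p x| with hs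
  have hs0 : 0 ≤ s := integral_nonneg fun x => abs_nonneg _
  have hn : (1 : ℝ) ≤ n := by exact_mod_cast (by omega : 1 ≤ n)
  set L : ℝ := 10 * n with hL
  have hL0 : 0 < L := by positivity
  have hsplit := integral_add_compl (measurableSet_Icc (a := -L) (b := L)) (wp_int p).abs
  have hX2 : ∀ x, wp (X * (X * p)) x = x ^ 2 * wp p x := fun x => by
    rw [wp_X, wp_X]; ring
  have htail : ∫ x in (Set.Icc (-L) L)ᶜ, |wp p x| ≤ (L ^ 2)⁻¹ * ∫ x, |wp (X * (X * p)) x| := by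
    rw [← integral_const_mul]
    refine le_trans (setIntegral_mono_on (wp_int p).abs.integrableOn
      ((wp_int (X * (X * p))).abs.const_mul _).integrableOn measurableSet_Icc.compl
      (fun x hx => ?_)) (setIntegral_le_integral ((wp_int _).abs.const_mul _)
        (Eventually.of_forall fun x => by positivity))
    rw [hX2, abs_mul, abs_of_nonneg (sq_nonneg x), ← mul_assoc]
    have hx2 : L ^ 2 ≤ x ^ 2 := by
      rw [Set.mem_compl_iff, Set.mem_Icc, ← abs_le, not_le] at hx
      rw [← sq_abs x]
      exact pow_le_pow_left₀ hL0.le hx.le 2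
    have : 1 ≤ (L ^ 2)⁻¹ * x ^ 2 := by
      rw [inv_mul_eq_div, le_div_iff₀ (by positivity)]; linarith
    nlinarith [abs_nonneg (wp p x)]
  have hdeg1 : (X * p).natDegree ≤ n := by
    refine natDegree_mul_le.trans ?_
    rw [natDegree_X]; omega
  have hdeg2 : (X * (X * p)).natDegree ≤ n + 1 := by
    refine natDegree_mul_le.trans ?_
    rw [natDegree_X]; omega
  have h0 := gI_X (n - 1) p (by omega)
  rw [Nat.cast_sub (by omega)] at h0
  push_cast at h0
  have h1 := gI_X n _ hdeg1
  have h2 := gI_X (n + 1) _ hdeg2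
  push_cast at h2
  have h3 := l1_le (X * (X * p))
  have h4 := l2_le_l1 n p hp
  rw [← hs] at h4
  set a := gI (p ^ 2) with ha
  have ha0 : 0 ≤ a := gI_sq_nonneg p
  set T := ∫ x, |wp (X * (X * p)) x| with hT
  have hpi := Real.pi_lt_d2
  have b1 : gI ((X * (X * p)) ^ 2) ≤ 6 * n ^ 2 * a := by
    have : gI ((X * p) ^ 2) ≤ 2 * n * a := by nlinarith
    have h5 : (2 * (n : ℝ) + 1) * gI ((X * p) ^ 2) ≤ (3 * n) * (2 * n * a) :=
      mul_le_mul (by linarith) this (gI_sq_nonneg _) (by positivity)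
    linarith
  have b2 : gI ((X * (X * (X * p))) ^ 2) ≤ 30 * n ^ 3 * a := by
    have h5 : (2 * ((n : ℝ) + 1) + 1) * gI ((X * (X * p)) ^ 2) ≤ (5 * n) * (6 * n ^ 2 * a) :=
      mul_le_mul (by linarith) b1 (gI_sq_nonneg _) (by positivity)
    linarith
  have b3 : (6 : ℝ) * n ^ 2 * a ≤ 6 * n ^ 3 * a := by
    have : (n : ℝ) ^ 2 ≤ n ^ 3 := pow_le_pow_right₀ hn (by norm_num)
    nlinarith
  have b4 : T ^ 2 ≤ (36 * n ^ 3 * a) * 3.15 :=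
    h3.trans (mul_le_mul (by linarith) hpi.le Real.pi_pos.le (by positivity))
  have b5 : T ^ 2 ≤ (50 * n ^ 2 * s) ^ 2 := by
    have : (36 * n ^ 3 * a) * 3.15 ≤ (36 * n ^ 3 * (8 * n * s ^ 2)) * 3.15 := by gcongr
    have h9 : 0 ≤ (n : ℝ) ^ 4 * s ^ 2 := by positivity
    nlinarith
  have b6 : T ≤ 50 * n ^ 2 * s := le_of_sq_le_sq b5 (by positivity)
  have b7 : (L ^ 2)⁻¹ * T ≤ s / 2 := by
    rw [inv_mul_eq_div, div_le_iff₀ (by positivity), hL]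
    nlinarith
  linarith
where
  le_of_sq_le_sq {a b : ℝ} (h : a ^ 2 ≤ b ^ 2) (hb : 0 ≤ b) : a ≤ b := abs_le_of_sq_le_sq' h hb |>.2

end HermAux

namespace HermAux

open Polynomial

noncomputable def hp : ℕ → ℝ[X]
  | 0 => 1
  | k + 1 => C 2 * X * hp k - derivative (hp k)

theorem hp_deriv (k : ℕ) : iteratedDeriv k (fun t : ℝ => Real.exp (-t ^ 2)) =
    fun x => (-1) ^ k * ((hp k).eval x * Real.exp (-x ^ 2)) := by
  induction k with
  | zero => ext x; simp [hp]
  | succ k ih =>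
    rw [iteratedDeriv_succ, ih]
    ext x
    rw [((hasDerivAt_pe (hp k) x).const_mul ((-1) ^ k)).deriv, hp]
    simp only [eval_sub, eval_mul, eval_C, eval_X]
    ring

theorem hp_coeff (k : ℕ) : (∀ j, k < j → (hp k).coeff j = 0) ∧ (hp k).coeff k = 2 ^ k := by
  induction k with
  | zero =>
    refine ⟨fun j hj => ?_, by simp [hp]⟩
    rw [hp, coeff_one, if_neg (by omega)]
  | succ k ih =>
    have e : ∀ j, (hp (k + 1)).coeff (j + 1) =
        2 * (hp k).coeff j - (hp k).coeff (j + 1 + 1) * (((j + 1 : ℕ) : ℝ) + 1) := by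
      intro j
      rw [hp, coeff_sub, mul_assoc, coeff_C_mul, coeff_X_mul, coeff_derivative]
    constructor
    · intro j hj
      obtain ⟨i, rfl⟩ : ∃ i, j = i + 1 := ⟨j - 1, by omega⟩
      rw [e, ih.1 i (by omega), ih.1 _ (by omega)]; ring
    · rw [e, ih.2, ih.1 _ (by omega)]; ring

theorem psiH_eq (k : ℕ) : ∃ a : ℝ, a ≠ 0 ∧ psiH k = wp (C a * hp k) := by
  refine ⟨(Real.sqrt Real.pi * 2 ^ k * (Nat.factorial k : ℝ)) ^ (-(1 : ℝ) / 2), ?_, ?_⟩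
  · have : 0 < Real.sqrt Real.pi * 2 ^ k * (Nat.factorial k : ℝ) := by
      have := Real.pi_pos; positivity
    exact (Real.rpow_pos_of_pos this _).ne'
  · ext x
    rw [psiH, hp_deriv, wp]
    have h1 : ((-1 : ℝ) ^ k) * (-1) ^ k = 1 := by rw [← mul_pow]; norm_num
    have h2 : Real.exp (x ^ 2 / 2) * Real.exp (-x ^ 2) = Real.exp (-(x ^ 2 / 2)) := by
      rw [← Real.exp_add]; congr 1; ring
    rw [eval_mul, eval_C, ← h2]
    generalize (Real.sqrt Real.pi * 2 ^ k * (Nat.factorial k : ℝ)) ^ (-(1 : ℝ) / 2) = a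
    linear_combination (a * Real.exp (x ^ 2 / 2) * eval x (hp k) * Real.exp (-x ^ 2)) * h1

theorem wp_add (p q : ℝ[X]) : wp (p + q) = wp p + wp q := by
  ext x; simp only [wp, eval_add, Pi.add_apply]; ring

theorem wp_sub (p q : ℝ[X]) (x : ℝ) : wp (p - q) x = wp p x - wp q x := by
  simp only [wp, eval_sub]; ring

theorem wp_C_mul (a : ℝ) (q : ℝ[X]) : wp (C a * q) = a • wp q := by
  ext x; simp only [wp, eval_mul, eval_C, Pi.smul_apply, smul_eq_mul]; ring

theorem PiH_mono {m n : ℕ} (h : m ≤ n) : PiH m ≤ PiH n := by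
  refine Submodule.span_mono ?_
  rintro f ⟨k, hk, rfl⟩
  exact ⟨k, by omega, rfl⟩

theorem exists_of_mem {n : ℕ} {P : ℝ → ℝ} (hP : P ∈ PiH n) :
    ∃ p : ℝ[X], (∀ j, n ≤ j → p.coeff j = 0) ∧ P = wp p := by
  unfold PiH at hP
  induction hP using Submodule.span_induction with
  | mem f hf =>
    obtain ⟨k, hk, rfl⟩ := hf
    obtain ⟨a, -, h⟩ := psiH_eq k
    refine ⟨_, fun j hj => ?_, h⟩
    rw [coeff_C_mul, (hp_coeff k).1 j (by omega), mul_zero]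
  | zero => exact ⟨0, by simp, by ext x; simp [wp]⟩
  | add f g _ _ hf hg =>
    obtain ⟨p, hp, rfl⟩ := hf
    obtain ⟨q, hq, rfl⟩ := hg
    exact ⟨p + q, fun j hj => by rw [coeff_add, hp j hj, hq j hj, add_zero], (wp_add p q).symm⟩
  | smul a f _ hf =>
    obtain ⟨p, hp, rfl⟩ := hf
    exact ⟨C a * p, fun j hj => by rw [coeff_C_mul, hp j hj, mul_zero], (wp_C_mul a p).symm⟩

theorem exists_of_mem' {n : ℕ} (hn : 1 ≤ n) {P : ℝ → ℝ} (hP : P ∈ PiH n) :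
    ∃ p : ℝ[X], p.natDegree < n ∧ P = wp p := by
  obtain ⟨p, h, rfl⟩ := exists_of_mem hP
  refine ⟨p, ?_, rfl⟩
  have : p.natDegree ≤ n - 1 := natDegree_le_iff_coeff_eq_zero.2 fun j hj => h j (by omega)
  omega

theorem wp_mem (n : ℕ) : ∀ p : ℝ[X], (∀ j, n ≤ j → p.coeff j = 0) → wp p ∈ PiH n := by
  induction n with
  | zero =>
    intro p h
    have : p = 0 := by ext j; simpa using h j (Nat.zero_le j)
    have h0 : wp p = 0 := by ext x; simp [wp, this]
    rw [h0]; exact Submodule.zero_mem _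
  | succ n ih =>
    intro p h
    obtain ⟨a, ha, hpsi⟩ := psiH_eq n
    set t := p.coeff n / (a * 2 ^ n) with ht
    have h1 : wp (p - C t * (C a * hp n)) ∈ PiH n := by
      refine ih _ fun j hj => ?_
      rw [coeff_sub, coeff_C_mul, coeff_C_mul]
      rcases hj.eq_or_lt with rfl | hj
      · rw [(hp_coeff n).2, ht]; field_simp; ring
      · rw [(hp_coeff n).1 j hj, h j hj]; ring
    have h2 : wp (C t * (C a * hp n)) ∈ PiH (n + 1) := by
      rw [wp_C_mul, ← hpsi]
      exact Submodule.smul_mem _ _ (Submodule.subset_span ⟨n, by omega, rfl⟩)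
    have h3 := Submodule.add_mem _ (PiH_mono (Nat.le_succ n) h1) h2
    rwa [← wp_add, sub_add_cancel] at h3

theorem wp_mem' {n : ℕ} {p : ℝ[X]} (h : p.natDegree < n) : wp p ∈ PiH n :=
  wp_mem n p fun j hj => coeff_eq_zero_of_natDegree_lt (by omega)

/-- consequences of SMZ in terms of real integrals -/
theorem smz_real {m : ℕ} {c₁ c₂ c₃ c₄ : ℝ} (h₁ : 0 < c₁) (h₂ : 0 < c₂) {ν : Measure ℝ}
    (h : SMZ m c₁ c₂ c₃ c₄ ν) (p : ℝ[X]) (hp : p.natDegree < m) :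
    Integrable (fun x => wp p x ^ 2) ν ∧ c₁ * gI (p ^ 2) ≤ ∫ x, wp p x ^ 2 ∂ν ∧
      ∫ x, wp p x ^ 2 ∂ν ≤ c₂ * gI (p ^ 2) := by
  obtain ⟨ha, hb⟩ := h.1 (wp p) (wp_mem' hp)
  rw [← ofReal_integral_eq_lintegral_ofReal (wp_sq_int p) (Eventually.of_forall fun x => sq_nonneg _),
    wp_sq_integral] at ha hb
  have hI : Integrable (fun x => wp p x ^ 2) ν := by
    refine ⟨((wp_cont p).pow 2).aestronglyMeasurable, ?_⟩
    rw [hasFiniteIntegral_iff_ofReal (Eventually.of_forall fun x => sq_nonneg _)]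
    exact hb.trans_lt (ENNReal.mul_lt_top ENNReal.ofReal_lt_top ENNReal.ofReal_lt_top)
  rw [← ofReal_integral_eq_lintegral_ofReal hI (Eventually.of_forall fun x => sq_nonneg _),
    ← ENNReal.ofReal_mul (by positivity)] at ha hb
  refine ⟨hI, ?_, ?_⟩
  · exact (ENNReal.ofReal_le_ofReal_iff (integral_nonneg fun x => sq_nonneg _)).1 ha
  · exact (ENNReal.ofReal_le_ofReal_iff (mul_nonneg h₂.le (gI_sq_nonneg p))).1 hb

theorem poisson (y : ℝ) (hy : 0 ≤ y) (m : ℕ) (hm : 1 ≤ m) :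
    (1 + y)⁻¹ ≤ (∑ j ∈ Finset.range m, (1 / ((j + 1 : ℝ) * (j.factorial : ℝ))) *
      (y ^ j * Real.exp (-y))) + 1 / (m + 1) := by
  rcases hy.eq_or_lt with rfl | hy
  · obtain ⟨k, rfl⟩ : ∃ k, m = k + 1 := ⟨m - 1, by omega⟩
    rw [Finset.sum_range_succ']
    have h1 : 0 ≤ ∑ j ∈ Finset.range k, (1 / (((j + 1 : ℕ) + 1 : ℝ) * ((j + 1).factorial : ℝ))) *
      ((0 : ℝ) ^ (j + 1) * Real.exp (-0)) := Finset.sum_nonneg fun j _ => by positivity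
    have h2 : (0 : ℝ) ≤ 1 / ((k + 1 : ℕ) + 1) := by positivity
    simp only [Nat.cast_zero, Nat.factorial_zero, pow_zero, neg_zero, Real.exp_zero] at h1 ⊢
    norm_num at h1 h2 ⊢
    linarith
  have hu : HasSum (fun j : ℕ => y ^ j / (j.factorial : ℝ)) (Real.exp y) := by
    rw [Real.exp_eq_exp_ℝ]; exact NormedSpace.expSeries_div_hasSum_exp y
  have hT : HasSum (fun j : ℕ => (1 / ((j + 1 : ℝ) * (j.factorial : ℝ))) * y ^ j)
      ((Real.exp y - 1) / y) := by
    have h1 := ((hasSum_nat_add_iff' 1).2 hu).div_const y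
    simp only [Finset.range_one, Finset.sum_singleton, pow_zero, Nat.factorial_zero, Nat.cast_one,
      div_one] at h1
    have e : (fun j : ℕ => (1 / ((j + 1 : ℝ) * (j.factorial : ℝ))) * y ^ j) =
        fun j : ℕ => y ^ (j + 1) / ((j + 1).factorial : ℝ) / y := by
      ext j
      rw [Nat.factorial_succ, pow_succ]; push_cast
      field_simp
    rw [e]
    exact h1
  have hF : HasSum (fun j : ℕ => if j ∈ Finset.range m then
      (1 / ((j + 1 : ℝ) * (j.factorial : ℝ))) * y ^ j else 0)
      (∑ j ∈ Finset.range m, (1 / ((j + 1 : ℝ) * (j.factorial : ℝ))) * y ^ j) := by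
    have : HasSum (fun j : ℕ => if j ∈ Finset.range m then
      (1 / ((j + 1 : ℝ) * (j.factorial : ℝ))) * y ^ j else 0) _ :=
      hasSum_sum_of_ne_finset_zero (f := fun j : ℕ => if j ∈ Finset.range m then
      (1 / ((j + 1 : ℝ) * (j.factorial : ℝ))) * y ^ j else 0) (s := Finset.range m)
      (fun b hb => if_neg hb)
    rwa [Finset.sum_congr rfl fun j hj => if_pos hj] at this
  have hle := hasSum_le (fun j => ?_) hT (hF.add (hu.mul_left (1 / ((m : ℝ) + 1))))
  · have he : Real.exp (-y) * Real.exp y = 1 := by rw [← Real.exp_add]; simp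
    have hep := Real.exp_pos (-y)
    have h3 : (1 + y)⁻¹ ≤ Real.exp (-y) * ((Real.exp y - 1) / y) := by
      rw [mul_div_assoc', mul_sub, he, le_div_iff₀ hy, inv_mul_le_iff₀ (by positivity)]
      have := Real.add_one_le_exp y
      nlinarith
    have h4 := mul_le_mul_of_nonneg_left hle hep.le
    refine h3.trans (h4.trans (le_of_eq ?_))
    rw [mul_add, Finset.mul_sum]
    congr 1
    · exact Finset.sum_congr rfl fun j _ => by ring
    · linear_combination (1 / ((m : ℝ) + 1)) * he
  · simp only [Finset.mem_range]
    split_ifs with h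
    · have : 0 ≤ 1 / ((m : ℝ) + 1) * (y ^ j / (j.factorial : ℝ)) := by positivity
      linarith
    · rw [zero_add]
      have hj : (m : ℝ) ≤ j := by exact_mod_cast not_lt.1 h
      have : 1 / ((j + 1 : ℝ) * (j.factorial : ℝ)) * y ^ j =
        1 / ((j : ℝ) + 1) * (y ^ j / (j.factorial : ℝ)) := by field_simp
      rw [this]
      gcongr

theorem gI_pow_succ (j : ℕ) : gI ((X ^ (j + 1)) ^ 2) = (j + 1 / 2) * gI ((X ^ j) ^ 2) := by
  have h := gI_ibp (X ^ (2 * j + 1))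
  have e1 : derivative (X ^ (2 * j + 1) : ℝ[X]) = C (2 * j + 1 : ℝ) * (X ^ j) ^ 2 := by
    rw [derivative_X_pow]; push_cast; congr 1; rw [← pow_mul]; congr 1; omega
  have e2 : C 2 * X * X ^ (2 * j + 1) = C (2 : ℝ) * (X ^ (j + 1)) ^ 2 := by ring
  rw [e1, e2, gI_C_mul, gI_C_mul] at h
  linarith

theorem gsum (m : ℕ) : ∑ j ∈ Finset.range m, (1 / ((j + 1 : ℝ) * (j.factorial : ℝ))) *
    gI ((X ^ j) ^ 2) = 2 * (gI 1 - gI ((X ^ m) ^ 2) / (m.factorial : ℝ)) := by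
  induction m with
  | zero => simp
  | succ m ih =>
    rw [Finset.sum_range_succ, ih, gI_pow_succ, Nat.factorial_succ]
    push_cast
    have : (m.factorial : ℝ) ≠ 0 := by positivity
    field_simp
    ring

theorem nu_weight {m : ℕ} (hm : 1 ≤ m) {c₁ c₂ c₃ c₄ : ℝ} (h₁ : 0 < c₁) (h₂ : 0 < c₂) (h₄ : 0 < c₄)
    {ν : Measure ℝ} (h : SMZ m c₁ c₂ c₃ c₄ ν) :
    IsFiniteMeasure ν ∧ ν.real Set.univ ≤ c₄ * Real.sqrt m ∧
    Integrable (fun x : ℝ => (1 + x ^ 2)⁻¹) ν ∧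
      ∫ x, (1 + x ^ 2)⁻¹ ∂ν ≤ 2 * c₂ * gI 1 + c₄ := by
  have hfin : IsFiniteMeasure ν := ⟨h.2.2.trans_lt ENNReal.ofReal_lt_top⟩
  have hreal : ν.real Set.univ ≤ c₄ * Real.sqrt m :=
    ENNReal.toReal_le_of_le_ofReal (by positivity) h.2.2
  have hw : Integrable (fun x : ℝ => (1 + x ^ 2)⁻¹) ν := by
    refine (integrable_const (1 : ℝ)).mono' ?_ (Eventually.of_forall fun x => ?_)
    · exact (Measurable.aestronglyMeasurable (by fun_prop))
    · rw [Real.norm_eq_abs, abs_of_nonneg (by positivity)]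
      exact inv_le_one_of_one_le₀ (by nlinarith [sq_nonneg x])
  refine ⟨hfin, hreal, hw, ?_⟩
  have hj : ∀ j ∈ Finset.range m, Integrable (fun x => wp (X ^ j) x ^ 2) ν ∧
      ∫ x, wp (X ^ j) x ^ 2 ∂ν ≤ c₂ * gI ((X ^ j) ^ 2) := fun j hj => by
    have := smz_real h₁ h₂ h (X ^ j) (by rw [natDegree_X_pow]; exact Finset.mem_range.1 hj)
    exact ⟨this.1, this.2.2⟩
  have hi : ∀ j ∈ Finset.range m, Integrable (fun x => (1 / ((j + 1 : ℝ) * (j.factorial : ℝ))) *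
      wp (X ^ j) x ^ 2) ν := fun j hjm => (hj j hjm).1.const_mul _
  have hmono : ∫ x, (1 + x ^ 2)⁻¹ ∂ν ≤ ∫ x, ((∑ j ∈ Finset.range m,
      (1 / ((j + 1 : ℝ) * (j.factorial : ℝ))) * wp (X ^ j) x ^ 2) + 1 / ((m : ℝ) + 1)) ∂ν := by
    refine integral_mono hw ((integrable_finsetSum _ hi).add (integrable_const _)) fun x => ?_
    have := poisson (x ^ 2) (sq_nonneg x) m hm
    refine this.trans (le_of_eq ?_)
    congr 1
    refine Finset.sum_congr rfl fun j _ => ?_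
    rw [wp_sq]
    simp only [eval_pow, eval_X]
    ring
  rw [integral_add (integrable_finsetSum _ hi) (integrable_const _),
    integral_finsetSum _ hi, integral_const] at hmono
  have hs : ∑ j ∈ Finset.range m, ∫ x, (1 / ((j + 1 : ℝ) * (j.factorial : ℝ))) *
      wp (X ^ j) x ^ 2 ∂ν ≤ 2 * c₂ * gI 1 := by
    calc _ ≤ ∑ j ∈ Finset.range m, c₂ * ((1 / ((j + 1 : ℝ) * (j.factorial : ℝ))) *
            gI ((X ^ j) ^ 2)) := by
          refine Finset.sum_le_sum fun j hjm => ?_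
          rw [integral_const_mul]
          have := mul_le_mul_of_nonneg_left (hj j hjm).2
            (by positivity : 0 ≤ 1 / ((j + 1 : ℝ) * (j.factorial : ℝ)))
          linarith
      _ = c₂ * (2 * (gI 1 - gI ((X ^ m) ^ 2) / (m.factorial : ℝ))) := by
          rw [← Finset.mul_sum, gsum]
      _ ≤ _ := by
          have : 0 ≤ gI ((X ^ m) ^ 2) / (m.factorial : ℝ) :=
            div_nonneg (gI_sq_nonneg _) (by positivity)
          nlinarith
  have ht : ν.real Set.univ • (1 / ((m : ℝ) + 1)) ≤ c₄ := by
    rw [smul_eq_mul, mul_one_div, div_le_iff₀ (by positivity)]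
    have : Real.sqrt m ≤ m + 1 := by
      rw [Real.sqrt_le_left (by positivity)]; nlinarith [(Nat.cast_nonneg m : (0 : ℝ) ≤ m)]
    nlinarith
  linarith

theorem nu_l1 {m n : ℕ} (hnm : n ≤ m) {c₁ c₂ c₃ c₄ : ℝ} (h₁ : 0 < c₁) (h₂ : 0 < c₂)
    (h₄ : 0 < c₄) {ν : Measure ℝ} (h : SMZ m c₁ c₂ c₃ c₄ ν) (p : ℝ[X]) (hp : p.natDegree < n) :
    Integrable (wp p) ν ∧
      (∫ x, |wp p x| ∂ν) ^ 2 ≤ (2 * c₂ * (2 * c₂ * gI 1 + c₄)) * n * gI (p ^ 2) := by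
  obtain ⟨hfin, hreal, hw, hw2⟩ := nu_weight (by omega) h₁ h₂ h₄ h
  have hn : (1 : ℝ) ≤ n := by exact_mod_cast (by omega : 1 ≤ n)
  obtain ⟨i1, -, b1⟩ := smz_real h₁ h₂ h p (by omega)
  have hg1 : 0 ≤ gI 1 := by simpa using gI_sq_nonneg 1
  have ha := gI_sq_nonneg p
  rcases hnm.eq_or_lt with rfl | hlt
  · have := cs (μ := ν) (g := wp p) (w := fun _ => 1) (wp_cont p).aestronglyMeasurable
      (fun _ => one_pos) (by simpa using i1) (integrable_const _)
    refine ⟨this.1, this.2.trans ?_⟩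
    simp only [mul_one, inv_one, integral_const, smul_eq_mul]
    have hsq : Real.sqrt n ≤ n := by
      rw [Real.sqrt_le_left (by positivity)]; nlinarith
    calc _ ≤ (c₂ * gI (p ^ 2)) * (c₄ * n) := by
          refine mul_le_mul b1 (hreal.trans ?_) (by positivity) (by positivity)
          exact mul_le_mul_of_nonneg_left hsq h₄.le
      _ ≤ _ := by
          have e1 : 0 ≤ c₂ * c₄ * n * gI (p ^ 2) := by positivity
          have e2 : 0 ≤ c₂ * (c₂ * gI 1) * n * gI (p ^ 2) := by positivity
          nlinarith
  · obtain ⟨i2, -, b2⟩ := smz_real h₁ h₂ h (X * p) (by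
      refine lt_of_le_of_lt natDegree_mul_le ?_
      rw [natDegree_X]; omega)
    have := cs (μ := ν) (g := wp p) (w := fun x => 1 + x ^ 2) (wp_cont p).aestronglyMeasurable
      (fun x => by positivity)
      ((i1.add i2).congr (Eventually.of_forall fun x => (wp_one_add p x).symm)) hw
    refine ⟨this.1, this.2.trans ?_⟩
    simp only [wp_one_add]
    rw [integral_add i1 i2]
    have h0 := gI_X (n - 1) p (by omega)
    rw [Nat.cast_sub (by omega)] at h0
    push_cast at h0
    have h3 : ∫ x, wp p x ^ 2 ∂ν + ∫ x, wp (X * p) x ^ 2 ∂ν ≤ c₂ * (2 * n * gI (p ^ 2)) := by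
      have : c₂ * gI ((X * p) ^ 2) ≤ c₂ * ((2 * (n - 1) + 1) * gI (p ^ 2)) :=
        mul_le_mul_of_nonneg_left h0 h₂.le
      linarith
    calc _ ≤ (c₂ * (2 * n * gI (p ^ 2))) * (2 * c₂ * gI 1 + c₄) :=
          mul_le_mul h3 hw2 (integral_nonneg fun x => by positivity) (by positivity)
      _ = _ := by ring

end HermAux

namespace HermAux

open Polynomial

theorem core {m n : ℕ} (hnm : n ≤ m) {c₁ c₂ c₃ c₄ : ℝ} (h₁ : 0 < c₁) (h₂ : 0 < c₂)
    (h₄ : 0 < c₄) {ν : Measure ℝ} (h : SMZ m c₁ c₂ c₃ c₄ ν) {f : ℝ → ℝ} (hf : Continuous f)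
    (hfi : Integrable f) (s p₁ p₂ : ℝ[X]) (hs : s.natDegree < n) (hp₁ : p₁.natDegree < n)
    (hp₂ : p₂.natDegree < n)
    (hmin : (∫⁻ t, ENNReal.ofReal ((f t - wp s t) ^ 2) ∂ν) ≤
      ∫⁻ t, ENNReal.ofReal ((f t - wp p₂ t) ^ 2) ∂ν)
    (b : ℝ) (hb : ∀ x, |f x - wp p₂ x| ≤ b) :
    ∫ x, |f x - wp s x| ≤ 3 * (∫ x, |f x - wp p₁ x|) +
      (40 + Real.sqrt (8 * Real.pi * (2 * c₂ * (2 * c₂ * gI 1 + c₄))) / c₁) * (n * b) := by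
  have hb0 : 0 ≤ b := (abs_nonneg _).trans (hb 0)
  have hn : (1 : ℝ) ≤ n := by exact_mod_cast (by omega : 1 ≤ n)
  have hg1 : 0 ≤ gI 1 := by simpa using gI_sq_nonneg 1
  have iP₁ : Integrable (fun x => |f x - wp p₁ x|) := (hfi.sub (wp_int p₁)).abs
  set a := ∫ x, |f x - wp p₁ x| with ha
  set D := 2 * c₂ * (2 * c₂ * gI 1 + c₄) with hD
  have hD0 : 0 ≤ D := by positivity
  -- comparison of the two approximants
  have hQd : (p₁ - p₂).natDegree < n :=
    lt_of_le_of_lt (natDegree_sub_le _ _) (max_lt hp₁ hp₂)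
  have hQ : ∫ x, |wp (p₁ - p₂) x| ≤ 2 * a + 40 * (n * b) := by
    refine (restricted n _ hQd).trans ?_
    have e1 : ∫ x in Set.Icc (-(10 * n : ℝ)) (10 * n), |wp (p₁ - p₂) x| ≤
        ∫ x in Set.Icc (-(10 * n : ℝ)) (10 * n), (|f x - wp p₁ x| + b) := by
      refine setIntegral_mono (wp_int _).abs.integrableOn
        (iP₁.integrableOn.add (integrableOn_const (by simp))) fun x => ?_
      rw [wp_sub]
      have : wp p₁ x - wp p₂ x = -(f x - wp p₁ x) + (f x - wp p₂ x) := by ring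
      simp only
      rw [this]
      refine (abs_add_le _ _).trans ?_
      rw [abs_neg]
      linarith [hb x]
    rw [integral_add iP₁.integrableOn (integrableOn_const (by simp)), setIntegral_const,
      Real.volume_real_Icc_of_le (by linarith), smul_eq_mul] at e1
    have e2 : ∫ x in Set.Icc (-(10 * n : ℝ)) (10 * n), |f x - wp p₁ x| ≤ a :=
      setIntegral_le_integral iP₁ (Eventually.of_forall fun x => abs_nonneg _)
    linarith
  -- the projection part
  have hRd : (s - p₂).natDegree < n :=
    lt_of_le_of_lt (natDegree_sub_le _ _) (max_lt hs hp₂)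
  obtain ⟨hfin, -⟩ := nu_weight (by omega : 1 ≤ m) h₁ h₂ h₄ h
  obtain ⟨iR, bR⟩ := nu_l1 hnm h₁ h₂ h₄ h _ hRd
  obtain ⟨iR2, lR, -⟩ := smz_real h₁ h₂ h (s - p₂) (by omega)
  set I := ∫ x, |wp (s - p₂) x| ∂ν with hI
  set r := gI ((s - p₂) ^ 2) with hr
  have hr0 : 0 ≤ r := gI_sq_nonneg _
  have hI0 : 0 ≤ I := integral_nonneg fun x => abs_nonneg _
  have hGc : Continuous (fun x => f x - wp p₂ x) := hf.sub (wp_cont p₂)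
  have iG2 : Integrable (fun x => (f x - wp p₂ x) ^ 2) ν := by
    refine (integrable_const (b ^ 2)).mono' (hGc.pow 2).aestronglyMeasurable
      (Eventually.of_forall fun x => ?_)
    rw [Real.norm_eq_abs, abs_of_nonneg (sq_nonneg _), ← sq_abs]
    exact pow_le_pow_left₀ (abs_nonneg _) (hb x) 2
  have iGR : Integrable (fun x => (f x - wp p₂ x) * wp (s - p₂) x) ν := by
    refine (iR.abs.const_mul b).mono' (hGc.mul (wp_cont _)).aestronglyMeasurable
      (Eventually.of_forall fun x => ?_)
    rw [Real.norm_eq_abs, abs_mul]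
    exact mul_le_mul_of_nonneg_right (hb x) (abs_nonneg _)
  have eS : ∀ x, (f x - wp s x) ^ 2 = (f x - wp p₂ x) ^ 2 -
      2 * ((f x - wp p₂ x) * wp (s - p₂) x) + wp (s - p₂) x ^ 2 := fun x => by
    rw [wp_sub]; ring
  have iGR2 : Integrable (fun x => 2 * ((f x - wp p₂ x) * wp (s - p₂) x)) ν := iGR.const_mul 2
  have iA : Integrable (fun x => (f x - wp p₂ x) ^ 2 -
      2 * ((f x - wp p₂ x) * wp (s - p₂) x)) ν := iG2.sub iGR2
  have iS : Integrable (fun x => (f x - wp s x) ^ 2) ν :=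
    (iA.add iR2).congr (Eventually.of_forall fun x => (eS x).symm)
  rw [← ofReal_integral_eq_lintegral_ofReal iS (Eventually.of_forall fun x => sq_nonneg _),
    ← ofReal_integral_eq_lintegral_ofReal iG2 (Eventually.of_forall fun x => sq_nonneg _),
    ENNReal.ofReal_le_ofReal_iff (integral_nonneg fun x => sq_nonneg _)] at hmin
  simp only [eS] at hmin
  rw [integral_add iA iR2, integral_sub iG2 iGR2, integral_const_mul] at hmin
  have hGR : ∫ x, (f x - wp p₂ x) * wp (s - p₂) x ∂ν ≤ b * I := by
    rw [hI, ← integral_const_mul]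
    refine integral_mono iGR (iR.abs.const_mul b) fun x => ?_
    refine (le_abs_self _).trans ?_
    rw [abs_mul]
    exact mul_le_mul_of_nonneg_right (hb x) (abs_nonneg _)
  have k1 : c₁ * r ≤ 2 * b * I := by linarith
  have k2 : c₁ ^ 2 * r ≤ 4 * b ^ 2 * D * n := by
    rcases hr0.eq_or_lt with h0 | h0
    · rw [← h0]; rw [mul_zero]; positivity
    · have e : r * (c₁ ^ 2 * r) ≤ r * (4 * b ^ 2 * D * n) := by
        calc r * (c₁ ^ 2 * r) = (c₁ * r) ^ 2 := by ring
          _ ≤ (2 * b * I) ^ 2 := pow_le_pow_left₀ (by positivity) k1 2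
          _ = 4 * b ^ 2 * I ^ 2 := by ring
          _ ≤ 4 * b ^ 2 * (D * n * r) := by gcongr
          _ = _ := by ring
      exact le_of_mul_le_mul_left e h0
  have k3 := l1_le_n n _ hRd
  set N := ∫ x, |wp (s - p₂) x| with hN
  have k4 : N ≤ Real.sqrt (8 * Real.pi * D) / c₁ * (n * b) := by
    have hpi := Real.pi_pos
    have e : (c₁ * N) ^ 2 ≤ (Real.sqrt (8 * Real.pi * D) * (n * b)) ^ 2 := by
      rw [mul_pow _ (_ * b), Real.sq_sqrt (by positivity)]
      calc (c₁ * N) ^ 2 = c₁ ^ 2 * N ^ 2 := by ring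
        _ ≤ c₁ ^ 2 * (2 * n * Real.pi * r) := by gcongr
        _ = 2 * n * Real.pi * (c₁ ^ 2 * r) := by ring
        _ ≤ 2 * n * Real.pi * (4 * b ^ 2 * D * n) := by gcongr
        _ = _ := by ring
    have e2 := (abs_le_of_sq_le_sq' e (by positivity)).2
    rw [div_mul_eq_mul_div, le_div_iff₀ h₁]; linarith
  -- final triangle inequality
  have iQ : Integrable (fun x => |wp (p₁ - p₂) x|) := (wp_int _).abs
  have iN : Integrable (fun x => |wp (s - p₂) x|) := (wp_int _).abs
  have iPQ : Integrable (fun x => |f x - wp p₁ x| + |wp (p₁ - p₂) x|) := iP₁.add iQ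
  have fin : ∫ x, |f x - wp s x| ≤
      ∫ x, (|f x - wp p₁ x| + |wp (p₁ - p₂) x| + |wp (s - p₂) x|) := by
    refine integral_mono (hfi.sub (wp_int s)).abs (iPQ.add iN) fun x => ?_
    have : f x - wp s x = (f x - wp p₁ x) + wp (p₁ - p₂) x + - wp (s - p₂) x := by
      rw [wp_sub, wp_sub]; ring
    simp only
    rw [this]
    refine (abs_add_le _ _).trans ?_
    rw [abs_neg]
    linarith [abs_add_le (f x - wp p₁ x) (wp (p₁ - p₂) x)]
  rw [integral_add iPQ iN, integral_add iP₁ iQ] at fin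
  rw [add_mul]
  linarith

theorem l1_eq {f S : ℝ → ℝ} (hf : Integrable f) (hS : Integrable S) :
    eLpNorm (fun t => f t - S t) 1 volume = ENNReal.ofReal (∫ t, ‖f t - S t‖) := by
  rw [eLpNorm_one_eq_lintegral_enorm]
  exact (ofReal_integral_norm_eq_lintegral_enorm (hf.sub hS)).symm

theorem fourier_part {f S : ℝ → ℝ} (hf : Integrable f) (hS : Integrable S) (ω : ℝ) :
    (‖fourierT f ω - fourierT S ω‖₊ : ℝ≥0∞) ≤ eLpNorm (fun t => f t - S t) 1 volume := by
  have hn : ∀ t : ℝ, ‖Complex.exp (-(Complex.I * ω * t))‖ = 1 := fun t => by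
    rw [Complex.norm_exp]; simp
  have key : ∀ {g : ℝ → ℝ}, Integrable g →
      Integrable (fun t : ℝ => (g t : ℂ) * Complex.exp (-(Complex.I * ω * t))) := by
    intro g hg
    refine hg.norm.mono' (hg.ofReal.aestronglyMeasurable.mul
      (Continuous.aestronglyMeasurable (by fun_prop))) (Eventually.of_forall fun t => ?_)
    rw [norm_mul, hn, mul_one, Complex.norm_real]
  rw [l1_eq hf hS, ← enorm_eq_nnnorm, ← ofReal_norm]
  refine ENNReal.ofReal_le_ofReal ?_
  unfold fourierT
  rw [← mul_sub, ← integral_sub (key hf) (key hS), norm_mul]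
  have h1 : ‖((Real.sqrt (2 * Real.pi) : ℝ) : ℂ)⁻¹‖ ≤ 1 := by
    rw [norm_inv, Complex.norm_real, Real.norm_eq_abs, abs_of_nonneg (Real.sqrt_nonneg _)]
    refine inv_le_one_of_one_le₀ ?_
    rw [Real.one_le_sqrt]
    linarith [Real.pi_gt_three]
  have h2 : ‖∫ t : ℝ, ((f t : ℂ) * Complex.exp (-(Complex.I * ω * t)) -
      (S t : ℂ) * Complex.exp (-(Complex.I * ω * t)))‖ ≤ ∫ t, ‖f t - S t‖ := by
    refine (norm_integral_le_integral_norm _).trans (le_of_eq ?_)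
    congr 1; ext t
    rw [← sub_mul, norm_mul, hn, mul_one, ← Complex.ofReal_sub, Complex.norm_real]
  calc _ ≤ 1 * ∫ t, ‖f t - S t‖ := mul_le_mul h1 h2 (norm_nonneg _) zero_le_one
    _ = _ := one_mul _

theorem sup_everywhere {g : ℝ → ℝ} (hg : Continuous g) (hfin : eLpNorm g ⊤ volume ≠ ⊤) (x : ℝ) :
    |g x| ≤ (eLpNorm g ⊤ volume).toReal := by
  set b := (eLpNorm g ⊤ volume).toReal with hb
  have hae : ∀ᵐ y, |g y| ≤ b := by
    have := ae_le_eLpNormEssSup (f := g) (μ := volume)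
    filter_upwards [this] with y hy
    rw [← eLpNorm_exponent_top] at hy
    have := ENNReal.toReal_mono hfin hy
    rw [toReal_enorm, Real.norm_eq_abs] at this
    exact this
  by_contra hx
  have ho : IsOpen {y | b < |g y|} := isOpen_lt continuous_const hg.abs
  have h0 : volume {y | b < |g y|} = 0 := by
    rw [ae_iff] at hae
    simpa using hae
  have := (ho.measure_eq_zero_iff volume).1 h0
  have hm : x ∈ {y | b < |g y|} := not_le.1 hx
  rw [this] at hm
  exact hm

end HermAux

theorem stmt2 (c₁ c₂ c₃ c₄ : ℝ) (h₁ : 0 < c₁) (h₂ : 0 < c₂) (h₃ : 0 < c₃) (h₄ : 0 < c₄) :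
    ∃ c : ℝ, 0 < c ∧
      ∀ (f : ℝ → ℝ), Continuous f → Tendsto f (cocompact ℝ) (nhds 0) → Integrable f volume →
      ∀ (m n : ℕ), 1 ≤ n → n ≤ m →
      ∀ (ν : Measure ℝ), SMZ m c₁ c₂ c₃ c₄ ν →
      ∀ Sf : ℝ → ℝ, Sf ∈ PiH n →
        (∀ P ∈ PiH n,
          (∫⁻ t, ENNReal.ofReal ((f t - Sf t) ^ 2) ∂ν) ≤ ∫⁻ t, ENNReal.ofReal ((f t - P t) ^ 2) ∂ν) →
        (⨆ ω : ℝ, (‖fourierT f ω - fourierT Sf ω‖₊ : ℝ≥0∞)) ≤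
            ENNReal.ofReal c * eLpNorm (fun t => f t - Sf t) 1 volume ∧
          eLpNorm (fun t => f t - Sf t) 1 volume ≤
            ENNReal.ofReal c * (degApproxH 1 (n / 2) f + (n : ℝ≥0∞) * degApproxH ⊤ (n / 2) f) := by

  have hg1 : 0 ≤ HermAux.gI 1 := by simpa using HermAux.gI_sq_nonneg 1
  set E := Real.sqrt (8 * Real.pi * (2 * c₂ * (2 * c₂ * HermAux.gI 1 + c₄))) / c₁ with hE
  have hE0 : 0 ≤ E := div_nonneg (Real.sqrt_nonneg _) h₁.le
  refine ⟨40 + E, by positivity, ?_⟩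
  intro f hf _ hfi m n hn hnm ν hν Sf hSf hmin
  obtain ⟨s, hs, rfl⟩ := HermAux.exists_of_mem' hn hSf
  have hc1 : 1 ≤ ENNReal.ofReal (40 + E) := by
    rw [ENNReal.one_le_ofReal]; linarith
  constructor
  · refine iSup_le fun ω => ?_
    calc _ ≤ _ := HermAux.fourier_part hfi (HermAux.wp_int s) ω
      _ = 1 * eLpNorm (fun t => f t - HermAux.wp s t) 1 volume := (one_mul _).symm
      _ ≤ _ := by gcongr
  · have hc0 : ENNReal.ofReal (40 + E) ≠ 0 := fun h => by rw [h] at hc1; simp at hc1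
    have hn0 : (n : ℝ≥0∞) ≠ 0 := by exact_mod_cast (by omega : n ≠ 0)
    have main : ∀ P₁ ∈ PiH (n / 2), ∀ P₂ ∈ PiH (n / 2),
        eLpNorm (fun t => f t - HermAux.wp s t) 1 volume ≤
          ENNReal.ofReal (40 + E) * (eLpNorm (fun x => f x - P₁ x) 1 volume +
            n * eLpNorm (fun x => f x - P₂ x) ⊤ volume) := by
      intro P₁ hP₁ P₂ hP₂
      have hP₂' := HermAux.PiH_mono (Nat.div_le_self n 2) hP₂
      obtain ⟨p₁, hp₁, rfl⟩ := HermAux.exists_of_mem' hn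
        (HermAux.PiH_mono (Nat.div_le_self n 2) hP₁)
      obtain ⟨p₂, hp₂, rfl⟩ := HermAux.exists_of_mem' hn hP₂'
      by_cases htop : eLpNorm (fun x => f x - HermAux.wp p₂ x) ⊤ volume = ⊤
      · rw [htop, ENNReal.mul_top hn0, add_top, ENNReal.mul_top hc0]
        exact le_top
      · have hb : ∀ x, |f x - HermAux.wp p₂ x| ≤
            (eLpNorm (fun x => f x - HermAux.wp p₂ x) ⊤ volume).toReal := HermAux.sup_everywhere (hf.sub (HermAux.wp_cont p₂)) htop
        have hcore := HermAux.core hnm h₁ h₂ h₄ hν hf hfi s p₁ p₂ hs hp₁ hp₂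
          (hmin _ hP₂') _ hb
        set b := (eLpNorm (fun x => f x - HermAux.wp p₂ x) ⊤ volume).toReal with hbdef
        have hb0 : 0 ≤ b := ENNReal.toReal_nonneg
        rw [← ENNReal.ofReal_toReal htop, ← hbdef]
        rw [HermAux.l1_eq hfi (HermAux.wp_int s), HermAux.l1_eq hfi (HermAux.wp_int p₁),
          ← ENNReal.ofReal_natCast n, ← ENNReal.ofReal_mul (by positivity),
          ← ENNReal.ofReal_add (integral_nonneg fun x => norm_nonneg _) (by positivity),
          ← ENNReal.ofReal_mul (by positivity)]
        refine ENNReal.ofReal_le_ofReal ?_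
        simp only [Real.norm_eq_abs]
        refine hcore.trans ?_
        have ha : 0 ≤ ∫ x, |f x - HermAux.wp p₁ x| := integral_nonneg fun x => abs_nonneg _
        rw [← hE]
        nlinarith
    unfold degApproxH
    rw [mul_add, ← mul_assoc]
    have hct : ENNReal.ofReal (40 + E) ≠ ⊤ := ENNReal.ofReal_ne_top
    have hcn0 : ENNReal.ofReal (40 + E) * n ≠ 0 := mul_ne_zero hc0 hn0
    have hcnt : ENNReal.ofReal (40 + E) * n ≠ ⊤ :=
      ENNReal.mul_ne_top hct (ENNReal.natCast_ne_top n)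
    rw [ENNReal.mul_iInf_of_ne hc0 hct, ENNReal.mul_iInf_of_ne hcn0 hcnt]
    simp_rw [ENNReal.mul_iInf_of_ne hc0 hct, ENNReal.mul_iInf_of_ne hcn0 hcnt]
    refine ENNReal.le_iInf₂_add_iInf₂ fun P₁ hP₁ P₂ hP₂ => ?_
    rw [mul_assoc, ← mul_add]
    exact main P₁ hP₁ P₂ hP₂
end
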